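/- Let N ≥ 2, 0 ≤ α ≤ 1, and let (f, g) be a density pair on ℝ^N with g locally α-Hölder. Let E ⊆ ℝ^N be Lebesgue measurable with Leb(E) > 0, Leb(ℝ^N ∖ E) > 0, |E| < ∞ and H^{N−1}(∂^e E) < ∞. Then there exist positive constants r̄, ε̄, C_per such that: for every ε ∈ ℝ with |ε| < ε̄ and every w ∈ ℝ^N there exists a measurable set F such that E Δ F is contained in the union of at most two balls of radius at most r̄, none of which intersects B(w, r̄), |F| = |E| + ε, and P(F) ≤ P(E) + C_per |ε|^β, where β = (α + (N−1)(1−α))/(α + N(1−α)). -/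

import Mathlib

open MeasureTheory Metric Set Filter

noncomputable section

abbrev Pt (N : ℕ) := EuclideanSpace ℝ (Fin N)

variable {N : ℕ}

/-- The density ratio of `E` at `x` tends to `l` as the radius tends to `0⁺`. -/
def densTendsto (E : Set (Pt N)) (x : Pt N) (l : ENNReal) : Prop :=
  Tendsto (fun r : ℝ => volume (E ∩ ball x r) / volume (ball x r))
    (nhdsWithin 0 (Ioi 0)) (nhds l)

/-- The essential boundary of a set. -/
def essBdry (E : Set (Pt N)) : Set (Pt N) :=
  {x | ¬ densTendsto E x 0 ∧ ¬ densTendsto E x 1}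

/-- Weighted volume (as an extended nonnegative real). -/
def wVolE (f : Pt N → ℝ) (E : Set (Pt N)) : ENNReal :=
  ∫⁻ x in E, ENNReal.ofReal (f x) ∂(μH[(N : ℝ)])

/-- Weighted volume. -/
def wVol (f : Pt N → ℝ) (E : Set (Pt N)) : ℝ := (wVolE f E).toReal

/-- Weighted perimeter. -/
def wPer (g : Pt N → ℝ) (E : Set (Pt N)) : ℝ :=
  (∫⁻ x in essBdry E, ENNReal.ofReal (g x) ∂(μH[(N : ℝ) - 1])).toReal

/-- A density pair: lower semicontinuous, positive, locally bounded functions. -/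
def IsDensityPair (f g : Pt N → ℝ) : Prop :=
  LowerSemicontinuous f ∧ LowerSemicontinuous g ∧
  (∀ x, 0 < f x) ∧ (∀ x, 0 < g x) ∧
  ∀ K : Set (Pt N), IsCompact K → ∃ C : ℝ, ∀ x ∈ K, f x ≤ C ∧ g x ≤ C

/-- `g` is locally `α`-Hölder. -/
def LocallyHolder (α : ℝ) (g : Pt N → ℝ) : Prop :=
  ∀ K : Set (Pt N), IsCompact K → ∃ C : ℝ, ∀ y ∈ K, ∀ z ∈ K, |g y - g z| ≤ C * dist y z ^ α

/-- An `m`-cluster: measurable, essentially pairwise disjoint chambers. -/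
def IsCluster {m : ℕ} (E : Fin m → Set (Pt N)) : Prop :=
  (∀ i, MeasurableSet (E i)) ∧ ∀ i j, i ≠ j → volume (E i ∩ E j) = 0

/-- The chambers of a cluster including the exterior chamber `E₀`. -/
def chamber {m : ℕ} (E : Fin m → Set (Pt N)) (i : Fin (m + 1)) : Set (Pt N) :=
  if h : i = 0 then (⋃ j, E j)ᶜ else E (i.pred h)

/-- The weighted perimeter of a cluster. -/
def clPer (g : Pt N → ℝ) {m : ℕ} (E : Fin m → Set (Pt N)) : ℝ :=
  ((∑ i, wPer g (E i)) + wPer g (⋃ i, E i)) / 2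

/-- The cluster has finite perimeter. -/
def FinPerCluster {m : ℕ} (E : Fin m → Set (Pt N)) : Prop :=
  ∀ i, μH[(N : ℝ) - 1] (essBdry (E i)) < ⊤

/-- The cluster has finite weighted volume. -/
def FinVolCluster (f : Pt N → ℝ) {m : ℕ} (E : Fin m → Set (Pt N)) : Prop :=
  ∀ i, wVolE f (E i) < ⊤

/-- Nondegeneracy: all chambers including the exterior one have positive Lebesgue measure. -/
def Nondegenerate {m : ℕ} (E : Fin m → Set (Pt N)) : Prop :=
  0 < volume ((⋃ i, E i)ᶜ) ∧ ∀ i, 0 < volume (E i)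

/-- The `ε`–`ε^β` property for clusters with constants `(rbar, εbar, Cper)`. -/
def EpsEpsBeta (f g : Pt N → ℝ) {m : ℕ} (E : Fin m → Set (Pt N))
    (β rbar εbar Cper : ℝ) : Prop :=
  ∀ ε : EuclideanSpace ℝ (Fin m), ‖ε‖ < εbar → ∀ w : Pt N,
    ∃ F : Fin m → Set (Pt N), IsCluster F ∧
      (∃ (c : Fin (m * (m + 1) / 2 + 1) → Pt N) (ρ : Fin (m * (m + 1) / 2 + 1) → ℝ),
        (∀ k, ρ k ≤ rbar) ∧
        (∀ k, Disjoint (ball (c k) (ρ k)) (ball w rbar)) ∧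
        (⋃ i, symmDiff (E i) (F i)) ⊆ ⋃ k, ball (c k) (ρ k)) ∧
      (∀ i, wVol f (F i) = wVol f (E i) + ε i) ∧
      clPer g F ≤ clPer g E + Cper * ‖ε‖ ^ β

namespace EpsBeta

variable {n : ℕ}

/-- The measure-theoretic exterior of `E`: the points of density `0`. -/
def extr (E : Set (Pt N)) : Set (Pt N) := {x | densTendsto E x 0}

/-- Points at which `E` has density ratio at most `γ` at all radii below `δ`. -/
def sparse (γ : ENNReal) (δ : ℝ) (E : Set (Pt N)) : Set (Pt N) :=
  {x | ∀ r, 0 < r → r < δ → volume (E ∩ ball x r) ≤ γ * volume (ball x r)}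

lemma volume_ball_center_eq (x y : Pt N) (r : ℝ) : volume (ball x r) = volume (ball y r) := by
  rw [Measure.addHaar_ball_center, Measure.addHaar_ball_center volume y]

lemma lowerSemicontinuous_volume_inter_ball (E : Set (Pt N)) (r : ℝ) :
    LowerSemicontinuous (fun x : Pt N => volume (E ∩ ball x r)) := by
  intro x c hc
  have hmono : Monotone (fun n : ℕ => E ∩ closedBall x (r - 1 / (n + 1 : ℝ))) := by
    intro a b hab
    refine inter_subset_inter_right _ (closedBall_subset_closedBall ?_)
    have := Nat.one_div_le_one_div (α := ℝ) hab
    linarith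
  have hU : E ∩ ball x r = ⋃ n : ℕ, E ∩ closedBall x (r - 1 / (n + 1 : ℝ)) := by
    rw [← inter_iUnion]
    congr 1
    ext y
    simp only [mem_ball, mem_iUnion, mem_closedBall]
    constructor
    · intro h
      obtain ⟨n, hn⟩ := exists_nat_one_div_lt (sub_pos.2 h)
      exact ⟨n, by linarith⟩
    · rintro ⟨n, hn⟩
      have := Nat.one_div_pos_of_nat (α := ℝ) (n := n)
      linarith
  simp only at hc
  rw [hU, hmono.measure_iUnion] at hc
  obtain ⟨n, hn⟩ := lt_iSup_iff.1 hc
  have hp := Nat.one_div_pos_of_nat (α := ℝ) (n := n)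
  filter_upwards [Metric.ball_mem_nhds x hp] with y hy
  refine hn.trans_le (measure_mono (inter_subset_inter_right _ ?_))
  intro z hz
  rw [mem_closedBall] at hz
  rw [mem_ball] at hy ⊢
  have := dist_triangle z x y
  rw [dist_comm x y] at this
  linarith

lemma isClosed_sparse (γ : ENNReal) (δ : ℝ) (E : Set (Pt N)) : IsClosed (sparse γ δ E) := by
  have : sparse γ δ E = ⋂ (r : ℝ) (_ : 0 < r) (_ : r < δ),
      {x | volume (E ∩ ball x r) ≤ γ * volume (ball (0 : Pt N) r)} := by
    ext x
    simp only [sparse, mem_ofPred_eq, mem_iInter, volume_ball_center_eq x 0]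
  rw [this]
  refine isClosed_iInter fun r => isClosed_iInter fun _ => isClosed_iInter fun _ => ?_
  exact (lowerSemicontinuous_volume_inter_ball E r).isClosed_preimage _

lemma volume_ball_ne_zero (x : Pt N) {r : ℝ} (hr : 0 < r) : volume (ball x r) ≠ 0 :=
  (measure_ball_pos volume x hr).ne'

lemma densTendsto_zero_iff (E : Set (Pt N)) (x : Pt N) :
    densTendsto E x 0 ↔ ∀ γ : ENNReal, 0 < γ → ∃ n : ℕ, x ∈ sparse γ (1 / (n + 1 : ℝ)) E := by
  unfold densTendsto
  rw [ENNReal.tendsto_nhds_zero]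
  refine forall₂_congr fun γ hγ => ?_
  rw [eventually_iff, mem_nhdsGT_iff_exists_Ioo_subset]
  constructor
  · rintro ⟨u, hu, h⟩
    obtain ⟨n, hn⟩ := exists_nat_one_div_lt (mem_Ioi.1 hu)
    refine ⟨n, fun r h0 h1 => ?_⟩
    have := h ⟨h0, h1.trans hn⟩
    rwa [mem_ofPred_eq, ENNReal.div_le_iff (volume_ball_ne_zero x h0) measure_ball_lt_top.ne] at this
  · rintro ⟨n, hn⟩
    refine ⟨1 / (n + 1 : ℝ), mem_Ioi.2 Nat.one_div_pos_of_nat, fun r hr => ?_⟩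
    rw [mem_ofPred_eq, ENNReal.div_le_iff (volume_ball_ne_zero x hr.1) measure_ball_lt_top.ne]
    exact hn r hr.1 hr.2

lemma measurableSet_extr (E : Set (Pt N)) : MeasurableSet (extr E) := by
  have : extr E = ⋂ k : ℕ, ⋃ n : ℕ, sparse ((k + 1 : ENNReal)⁻¹) (1 / (n + 1 : ℝ)) E := by
    ext x
    simp only [extr, mem_ofPred_eq, densTendsto_zero_iff, mem_iInter, mem_iUnion]
    constructor
    · intro h k
      exact h _ (by simp)
    · intro h γ hγ
      obtain ⟨k, hk⟩ := ENNReal.exists_inv_nat_lt hγ.ne'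
      obtain ⟨n, hn⟩ := h k
      refine ⟨n, fun r h0 h1 => (hn r h0 h1).trans ?_⟩
      gcongr
      refine le_trans ?_ hk.le
      rw [ENNReal.inv_le_inv]
      exact le_self_add
  rw [this]
  exact MeasurableSet.iInter fun k => MeasurableSet.iUnion fun n => (isClosed_sparse _ _ _).measurableSet

lemma densTendsto_one_iff {E : Set (Pt N)} (hE : MeasurableSet E) (x : Pt N) :
    densTendsto E x 1 ↔ densTendsto Eᶜ x 0 := by
  have key : ∀ {E : Set (Pt N)}, MeasurableSet E → ∀ r : ℝ, 0 < r →
      volume (Eᶜ ∩ ball x r) / volume (ball x r) =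
        1 - volume (E ∩ ball x r) / volume (ball x r) := by
    intro E hE r hr
    have h0 := volume_ball_ne_zero x hr
    have ht : volume (ball x r) ≠ ⊤ := measure_ball_lt_top.ne
    have h1 : volume (E ∩ ball x r) + volume (Eᶜ ∩ ball x r) = volume (ball x r) := by
      rw [inter_comm E, inter_comm Eᶜ, ← sdiff_eq, measure_inter_add_sdiff _ hE]
    have h2 : volume (E ∩ ball x r) / volume (ball x r) + volume (Eᶜ ∩ ball x r) / volume (ball x r)
        = 1 := by
      rw [← ENNReal.add_div, h1, ENNReal.div_self h0 ht]
    refine (ENNReal.sub_eq_of_eq_add_rev ?_ h2.symm).symm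
    refine ne_top_of_le_ne_top ENNReal.one_ne_top (h2 ▸ le_self_add)
  unfold densTendsto
  constructor
  · intro h
    have := ENNReal.Tendsto.sub (tendsto_const_nhds (x := (1 : ENNReal))) h (Or.inl ENNReal.one_ne_top)
    rw [tsub_self] at this
    refine this.congr' ?_
    filter_upwards [self_mem_nhdsWithin] with r hr
    exact (key hE r hr).symm
  · intro h
    have := ENNReal.Tendsto.sub (tendsto_const_nhds (x := (1 : ENNReal))) h (Or.inl ENNReal.one_ne_top)
    rw [tsub_zero] at this
    refine this.congr' ?_
    filter_upwards [self_mem_nhdsWithin] with r hr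
    rw [← key hE.compl r hr, compl_compl]

lemma essBdry_eq {E : Set (Pt N)} (hE : MeasurableSet E) :
    essBdry E = (extr E ∪ extr Eᶜ)ᶜ := by
  ext x
  simp only [essBdry, mem_ofPred_eq, densTendsto_one_iff hE, extr, compl_union, mem_inter_iff,
    mem_compl_iff]

lemma measurableSet_essBdry {E : Set (Pt N)} (hE : MeasurableSet E) :
    MeasurableSet (essBdry E) := by
  rw [essBdry_eq hE]
  exact ((measurableSet_extr _).union (measurableSet_extr _)).compl

lemma not_mem_extr_compl_of_mem_extr {E : Set (Pt N)} (hE : MeasurableSet E) {x : Pt N}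
    (hx : x ∈ extr E) : x ∉ extr Eᶜ := by
  intro h
  have h1 : densTendsto E x 1 := (densTendsto_one_iff hE x).2 h
  exact zero_ne_one (tendsto_nhds_unique hx h1)

lemma ae_mem_extr_of_not_mem {E : Set (Pt N)} (hE : MeasurableSet E) :
    ∀ᵐ x ∂(volume : Measure (Pt N)), x ∉ E → x ∈ extr E := by
  have h := Besicovitch.ae_tendsto_measure_inter_div_of_measurableSet
    (volume : Measure (Pt N)) hE
  filter_upwards [h] with x hx hxE
  rw [indicator_of_notMem hxE] at hx
  refine tendsto_of_tendsto_of_tendsto_of_le_of_le' tendsto_const_nhds hx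
    (Eventually.of_forall fun _ => zero_le) ?_
  filter_upwards [self_mem_nhdsWithin] with r hr
  rw [Measure.addHaar_closedBall volume x (le_of_lt hr), Measure.addHaar_ball_of_pos volume x hr]
  gcongr
  exact ball_subset_closedBall

lemma ae_mem_extr_iff {E : Set (Pt N)} (hE : MeasurableSet E) :
    ∀ᵐ x ∂(volume : Measure (Pt N)), x ∈ extr E ↔ x ∉ E := by
  filter_upwards [ae_mem_extr_of_not_mem hE, ae_mem_extr_of_not_mem hE.compl] with x h1 h2
  refine ⟨fun h hx => ?_, h1⟩
  exact not_mem_extr_compl_of_mem_extr hE h (h2 (by simpa using hx))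

/-- The coordinate projection orthogonal to the `i`-th axis. -/
def proj (i : Fin (n + 1)) (x : Pt (n + 1)) : Fin n → ℝ := fun j => x (i.succAbove j)

/-- The point with `i`-th coordinate `t` and remaining coordinates `y`. -/
def linePt (i : Fin (n + 1)) (t : ℝ) (y : Fin n → ℝ) : Pt (n + 1) :=
  WithLp.toLp 2 (i.insertNth t y : Fin (n + 1) → ℝ)

/-- The `i`-th coordinate vector. -/
def axis {N : ℕ} (i : Fin N) : Pt N := EuclideanSpace.single i (1 : ℝ)

/-- Separation of the `i`-th coordinate from the others. -/
def splitEquiv (i : Fin (n + 1)) : Pt (n + 1) ≃ᵐ ℝ × (Fin n → ℝ) :=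
  (MeasurableEquiv.toLp 2 (Fin (n + 1) → ℝ)).symm.trans
    (MeasurableEquiv.piFinSuccAbove (fun _ => ℝ) i)

lemma measurePreserving_splitEquiv (i : Fin (n + 1)) :
    MeasurePreserving (splitEquiv i) volume volume := by
  refine MeasurePreserving.trans (μb := (volume : Measure (Fin (n + 1) → ℝ))) ?_ ?_
  · exact PiLp.volume_preserving_ofLp (Fin (n + 1))
  · exact volume_preserving_piFinSuccAbove (fun _ => ℝ) i

@[simp] lemma linePt_self (i : Fin (n + 1)) (t : ℝ) (y : Fin n → ℝ) : linePt i t y i = t := by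
  simp [linePt]

@[simp] lemma linePt_succAbove (i : Fin (n + 1)) (t : ℝ) (y : Fin n → ℝ) (j : Fin n) :
    linePt i t y (i.succAbove j) = y j := by
  simp [linePt]

@[simp] lemma proj_linePt (i : Fin (n + 1)) (t : ℝ) (y : Fin n → ℝ) :
    proj i (linePt i t y) = y := by
  ext j; simp [proj]

lemma linePt_proj (i : Fin (n + 1)) (x : Pt (n + 1)) : linePt i (x i) (proj i x) = x := by
  ext j
  rcases Fin.eq_self_or_eq_succAbove i j with rfl | ⟨k, rfl⟩ <;> simp [proj]

lemma linePt_add (i : Fin (n + 1)) (t s : ℝ) (y : Fin n → ℝ) :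
    linePt i t y + s • axis i = linePt i (t + s) y := by
  ext j
  rcases Fin.eq_self_or_eq_succAbove i j with rfl | ⟨k, rfl⟩ <;> simp [axis]

lemma continuous_linePt (i : Fin (n + 1)) (y : Fin n → ℝ) : Continuous fun t => linePt i t y := by
  have : (fun t => linePt i t y) = fun t => linePt i 0 y + t • axis i := by
    ext1 t; rw [linePt_add, zero_add]
  rw [this]; fun_prop

lemma lipschitzWith_proj (i : Fin (n + 1)) : LipschitzWith 1 (proj i) := by
  refine LipschitzWith.of_dist_le_mul fun x y => ?_
  rw [NNReal.coe_one, one_mul, dist_pi_le_iff dist_nonneg]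
  intro j
  simp only [proj]
  rw [dist_eq_norm, dist_eq_norm]
  simpa using PiLp.norm_apply_le (x - y) (i.succAbove j)

lemma dist_le_of_coord_le {N : ℕ} {x y : Pt N} {c : ℝ} (h : ∀ j, |x j - y j| ≤ c) :
    dist x y ≤ N * c := by
  have hx : x - y = ∑ j, (x j - y j) • axis j := by
    ext k
    simp [axis, Pi.single_apply]
  rw [dist_eq_norm, hx]
  refine (norm_sum_le _ _).trans ?_
  refine (Finset.sum_le_sum (g := fun _ => c) fun j _ => ?_).trans (by simp)
  simpa [norm_smul, axis] using h j

lemma exists_sparse_const (n : ℕ) : ∃ γ : ENNReal, 0 < γ ∧ γ < 1 ∧ ∀ (x : Pt (n + 1)) (r : ℝ), 0 < r →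
    γ * volume (ball x (3 * (n + 1) * r)) < ENNReal.ofReal r * (ENNReal.ofReal ((2 * r) ^ n) / 2) := by
  set ω := volume (ball (0 : Pt (n + 1)) 1) with hω
  have hω0 : ω ≠ 0 := volume_ball_ne_zero _ one_pos
  have hωt : ω ≠ ⊤ := measure_ball_lt_top.ne
  set D : ENNReal := ENNReal.ofReal ((3 * (n + 1)) ^ (n + 1)) * ω with hD
  have hDt : D ≠ ⊤ := ENNReal.mul_ne_top ENNReal.ofReal_ne_top hωt
  have hD0 : D ≠ 0 := by
    refine mul_ne_zero ?_ hω0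
    rw [Ne, ENNReal.ofReal_eq_zero, not_le]; positivity
  refine ⟨min (1 / 2) (1 / 4 / D), ?_, ?_, ?_⟩
  · refine lt_min (by norm_num) (ENNReal.div_pos (by norm_num) hDt)
  · exact (min_le_left _ _).trans_lt (by norm_num)
  · intro x r hr
    have h1 : volume (ball x (3 * (n + 1) * r)) = ENNReal.ofReal (r ^ (n + 1)) * D := by
      rw [Measure.addHaar_ball_of_pos volume x (by positivity), hD, ← mul_assoc, ← ENNReal.ofReal_mul (by positivity),
        ← mul_pow]
      simp [hω, mul_comm]
    have h2 : ENNReal.ofReal r * (ENNReal.ofReal ((2 * r) ^ n) / 2)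
        = ENNReal.ofReal (r ^ (n + 1)) * (2 ^ n / 2) := by
      rw [mul_pow, ENNReal.ofReal_mul (by positivity), pow_succ, ENNReal.ofReal_mul (by positivity),
        ENNReal.ofReal_pow (by norm_num : (0 : ℝ) ≤ 2)]
      simp only [ENNReal.ofReal_ofNat, div_eq_mul_inv]
      ring
    rw [h1, h2]
    have h0 : ENNReal.ofReal (r ^ (n + 1)) ≠ 0 := by
      rw [Ne, ENNReal.ofReal_eq_zero, not_le]; positivity
    calc min (1 / 2) (1 / 4 / D) * (ENNReal.ofReal (r ^ (n + 1)) * D)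
        ≤ (1 / 4 / D) * (ENNReal.ofReal (r ^ (n + 1)) * D) := by gcongr; exact min_le_right _ _
      _ = ENNReal.ofReal (r ^ (n + 1)) * (1 / 4 / D * D) := by ring
      _ = ENNReal.ofReal (r ^ (n + 1)) * (1 / 4) := by rw [ENNReal.div_mul_cancel hD0 hDt]
      _ < ENNReal.ofReal (r ^ (n + 1)) * (2 ^ n / 2) := by
        refine ENNReal.mul_lt_mul_right h0 ENNReal.ofReal_ne_top ?_
        calc (1 / 4 : ENNReal) < 1 / 2 := by
              rw [one_div, one_div, ENNReal.inv_lt_inv]; norm_num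
          _ ≤ 2 ^ n / 2 := by gcongr; exact one_le_pow₀ (by norm_num)

lemma volume_proj_image_eq_zero {γ : ENNReal}
    (hγ : ∀ (x : Pt (n + 1)) (r : ℝ), 0 < r →
      γ * volume (ball x (3 * (n + 1) * r)) < ENNReal.ofReal r * (ENNReal.ofReal ((2 * r) ^ n) / 2))
    {E : Set (Pt (n + 1))} (hE : MeasurableSet E) (i : Fin (n + 1)) {σ : ℝ} (hσ : σ = 1 ∨ σ = -1)
    {δ η : ℝ} (hδ : 0 < δ) (hη : 0 < η) {B : Set (Pt (n + 1))} (hB : B ⊆ sparse γ δ E)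
    (hB1 : ∀ x ∈ B, ∀ t, 0 < t → t < 2 * η → x + (σ * t) • axis i ∈ extr Eᶜ)
    (hB2 : ∀ x ∈ B, ∀ x' ∈ B, σ * x i ≤ σ * x' i + η) :
    volume (proj i '' B) = 0 := by
  have hσσ : σ * σ = 1 := by rcases hσ with rfl | rfl <;> norm_num
  have habs : |σ| = 1 := by rcases hσ with rfl | rfl <;> norm_num
  by_contra hpos
  set S := proj i '' B with hS
  have hden := Besicovitch.ae_tendsto_measure_inter_div (volume : Measure (Fin n → ℝ)) S
  have : (volume.restrict S) ≠ 0 := by rwa [Ne, Measure.restrict_eq_zero]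
  have hne : (ae (volume.restrict S)).NeBot := ae_neBot.2 this
  obtain ⟨y, hy⟩ := hden.exists
  have hev : ∀ᶠ r : ℝ in nhdsWithin 0 (Ioi 0),
      (1 / 2 : ENNReal) < volume (S ∩ closedBall y r) / volume (closedBall y r) :=
    hy.eventually (lt_mem_nhds (by norm_num))
  have hev2 : ∀ᶠ r : ℝ in nhdsWithin 0 (Ioi 0), 0 < r ∧ r < η / 2 ∧ 3 * (n + 1) * r < δ := by
    have h1 : ∀ᶠ r : ℝ in nhdsWithin 0 (Ioi 0), r < η / 2 :=
      mem_nhdsWithin_of_mem_nhds (Iio_mem_nhds (half_pos hη))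
    have h2 : ∀ᶠ r : ℝ in nhdsWithin 0 (Ioi 0), r < δ / (3 * (n + 1)) :=
      mem_nhdsWithin_of_mem_nhds (Iio_mem_nhds (by positivity))
    filter_upwards [h1, h2, self_mem_nhdsWithin] with r h1 h2 h3
    refine ⟨h3, h1, ?_⟩
    rw [lt_div_iff₀ (by positivity)] at h2
    linarith
  obtain ⟨r, hr1, hr0, hrη, hrδ⟩ := (hev.and hev2).exists
  have hvol : volume (closedBall y r) = ENNReal.ofReal ((2 * r) ^ n) := by
    rw [Real.volume_pi_closedBall y hr0.le]; simp
  have hvS : ENNReal.ofReal ((2 * r) ^ n) / 2 ≤ volume (S ∩ closedBall y r) := by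
    rw [hvol, ENNReal.lt_div_iff_mul_lt (Or.inr (by norm_num)) (Or.inl ENNReal.ofReal_ne_top)] at hr1
    rw [div_eq_mul_inv, mul_comm, ← one_div]
    exact hr1.le
  set Hs := (fun x : Pt (n + 1) => σ * x i) '' {x ∈ B | proj i x ∈ closedBall y r} with hHs
  have hSne : (S ∩ closedBall y r).Nonempty := by
    by_contra h
    rw [not_nonempty_iff_eq_empty] at h
    rw [h, measure_empty, nonpos_iff_eq_zero, ENNReal.div_eq_zero_iff, ENNReal.ofReal_eq_zero] at hvS
    have : 0 < (2 * r) ^ n := by positivity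
    simp [this.not_ge] at hvS
  have hHne : Hs.Nonempty := by
    obtain ⟨_, ⟨x, hx, rfl⟩, hxy⟩ := hSne
    exact ⟨_, x, ⟨hx, hxy⟩, rfl⟩
  have hHb : BddAbove Hs := by
    obtain ⟨_, x, hx, rfl⟩ := hHne
    refine ⟨σ * x i + η, ?_⟩
    rintro _ ⟨x', hx', rfl⟩
    exact hB2 x' hx'.1 x hx.1
  set h := sSup Hs with hh
  obtain ⟨_, ⟨x, hx, rfl⟩, hxh⟩ := exists_lt_of_lt_csSup hHne (show h - r < sSup Hs by linarith)
  replace hxh : h - r < σ * x i := hxh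
  set T : Set ℝ := {t | σ * t ∈ Ioo h (h + r)} with hT
  have hTvol : volume T = ENNReal.ofReal r := by
    rcases hσ with h1 | h1
    · have : T = Ioo h (h + r) := by ext t; simp [hT, h1]
      rw [this, Real.volume_Ioo]; congr 1; ring
    · have : T = Ioo (-(h + r)) (-h) := by
        ext t; simp only [hT, h1, mem_ofPred_eq, mem_Ioo]; constructor <;> intro ⟨_, _⟩ <;> constructor <;> linarith
      rw [this, Real.volume_Ioo]; congr 1; ring
  set W := splitEquiv i ⁻¹' (T ×ˢ (S ∩ closedBall y r)) with hW
  have hWvol : volume W = ENNReal.ofReal r * volume (S ∩ closedBall y r) := by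
    rw [hW, (measurePreserving_splitEquiv i).measure_preimage_equiv, Measure.volume_eq_prod,
      Measure.prod_prod, hTvol]
  have hWsub : W ⊆ extr Eᶜ ∩ ball x (3 * (n + 1) * r) := by
    rintro w ⟨hw1, ⟨x', hx', hw2⟩, hw3⟩
    change σ * w i ∈ Ioo h (h + r) at hw1
    change proj i x' = proj i w at hw2
    change proj i w ∈ closedBall y r at hw3
    have hx'H : σ * x' i ≤ h := le_csSup hHb ⟨x', ⟨hx', by rw [hw2]; exact hw3⟩, rfl⟩
    have hxH : σ * x i ≤ h := le_csSup hHb ⟨x, hx, rfl⟩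
    constructor
    · have hxx := hB2 x hx.1 x' hx'
      have := hB1 x' hx' (σ * w i - σ * x' i) (by linarith [hw1.1]) (by linarith [hw1.2])
      convert this using 1
      rw [mul_sub, ← mul_assoc, ← mul_assoc, hσσ, one_mul, one_mul]
      conv_lhs => rw [← linePt_proj i w, ← hw2]
      conv_rhs => rw [← linePt_proj i x', linePt_add]
      simp
    · rw [mem_ball]
      refine (dist_le_of_coord_le (c := 2 * r) fun j => ?_).trans_lt ?_
      · rcases Fin.eq_self_or_eq_succAbove i j with hij | ⟨k, hij⟩
        · rw [hij, ← one_mul |_|, ← habs, ← abs_mul, mul_sub, abs_le]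
          constructor <;> linarith [hw1.1, hw1.2]
        · rw [hij]
          have h1 : dist (proj i w k) (y k) ≤ r := (dist_le_pi_dist _ _ k).trans hw3
          have h2 : dist (proj i x k) (y k) ≤ r := (dist_le_pi_dist _ _ k).trans hx.2
          have := dist_triangle_right (proj i w k) (proj i x k) (y k)
          rw [Real.dist_eq] at this
          change |proj i w k - proj i x k| ≤ _
          linarith
      · push_cast
        have : 0 < (n + 1 : ℝ) * r := by positivity
        linarith
  have hfin : volume W ≤ volume (E ∩ ball x (3 * (n + 1) * r)) := by
    refine (measure_mono hWsub).trans (measure_mono_ae ?_)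
    filter_upwards [ae_mem_extr_iff hE.compl] with z hz hz2
    exact ⟨by simpa using hz.1 hz2.1, hz2.2⟩
  have h3 := hB hx.1 (3 * (n + 1) * r) (by positivity) hrδ
  have h4 := hγ x r hr0
  have h5 : ENNReal.ofReal r * (ENNReal.ofReal ((2 * r) ^ n) / 2) ≤ volume W := by
    rw [hWvol]; gcongr
  exact absurd (h5.trans (hfin.trans h3)) (not_le.2 h4)

/-- Almost no line parallel to an axis carries a point of the exterior which bounds a segment
of the interior. -/
lemma ae_not_extr_adjacent {E : Set (Pt (n + 1))} (hE : MeasurableSet E) (i : Fin (n + 1)) {σ : ℝ}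
    (hσ : σ = 1 ∨ σ = -1) :
    ∀ᵐ y : Fin n → ℝ, ∀ t, linePt i t y ∈ extr E → ∀ δ > 0,
      ¬ ∀ s, 0 < s → s < δ → linePt i (t + σ * s) y ∈ extr Eᶜ := by
  obtain ⟨γ, hγ0, hγ1, hγ⟩ := exists_sparse_const n
  let B : ℕ → ℕ → ℤ → Set (Pt (n + 1)) := fun k m j =>
    {x | x ∈ sparse γ (1 / (k + 1 : ℝ)) E ∧
      (∀ t, 0 < t → t < 2 * (1 / (m + 1 : ℝ)) → x + (σ * t) • axis i ∈ extr Eᶜ) ∧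
      ⌊σ * x i * (m + 1)⌋ = j}
  have hB : ∀ k m j, volume (proj i '' B k m j) = 0 := by
    intro k m j
    refine volume_proj_image_eq_zero hγ hE i hσ (δ := 1 / (k + 1 : ℝ)) (η := 1 / (m + 1 : ℝ))
      (by positivity) (by positivity) (fun x hx => hx.1) (fun x hx => hx.2.1) ?_
    intro x hx x' hx'
    have h1 := Int.lt_floor_add_one (σ * x i * (m + 1))
    have h2 := Int.floor_le (σ * x' i * (m + 1))
    rw [hx.2.2] at h1
    rw [hx'.2.2] at h2
    have hm : (0 : ℝ) < m + 1 := by positivity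
    rw [← mul_le_mul_iff_of_pos_right hm, add_mul, one_div_mul_cancel hm.ne']
    linarith
  have hnull : ∀ᵐ y : Fin n → ℝ, ∀ k m j, y ∉ proj i '' B k m j := by
    simp only [ae_all_iff]
    intro k m j
    exact measure_eq_zero_iff_ae_notMem.1 (hB k m j)
  filter_upwards [hnull] with y hy t ht δ hδ hcon
  obtain ⟨k, hk⟩ := (densTendsto_zero_iff _ _).1 ht γ hγ0
  obtain ⟨m, hm⟩ := exists_nat_one_div_lt (half_pos hδ)
  refine hy k m ⌊σ * linePt i t y i * (m + 1)⌋ ⟨linePt i t y, ⟨hk, fun s h0 h1 => ?_, rfl⟩, by simp⟩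
  rw [linePt_add]
  exact hcon s h0 (by linarith)

lemma not_subset_of_inter_closure {I O : Set ℝ} {a b : ℝ} (hdisj : Disjoint I O)
    (hcov : Icc a b ⊆ I ∪ O)
    (hright : ∀ x ∈ I, ∀ δ > 0, ¬ ∀ s, 0 < s → s < δ → x + s ∈ O)
    (hleft : ∀ x ∈ I, ∀ δ > 0, ¬ ∀ s, 0 < s → s < δ → x - s ∈ O)
    {U : Set ℝ} (hU : IsOpen U) {z : ℝ} (hzU : z ∈ U)
    (hz : z ∈ closure (I ∩ Icc a b) ∩ closure (O ∩ Icc a b)) :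
    ¬ U ∩ (closure (I ∩ Icc a b) ∩ closure (O ∩ Icc a b)) ⊆ I := by
  intro hsub
  have hcl : ∀ {S : Set ℝ}, closure (S ∩ Icc a b) ⊆ Icc a b := fun {S} =>
    closure_minimal inter_subset_right isClosed_Icc
  have hzab : z ∈ Icc a b := hcl hz.1
  obtain ⟨δ, hδ, hball⟩ := Metric.isOpen_iff.1 hU z hzU
  obtain ⟨o, ho, hoz⟩ := Metric.mem_closure_iff.1 hz.2 δ hδ
  rw [Real.dist_eq, abs_lt] at hoz
  have hoI : o ∉ closure (I ∩ Icc a b) := by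
    intro h
    refine hdisj.le_bot ⟨hsub ⟨hball ?_, h, subset_closure ho⟩, ho.1⟩
    rw [mem_ball, Real.dist_eq, abs_lt]; constructor <;> linarith
  have hO : ∀ t ∈ Icc a b, t ∉ closure (I ∩ Icc a b) → t ∈ O := fun t ht hn =>
    (hcov ht).resolve_left fun h => hn (subset_closure ⟨h, ht⟩)
  rcases lt_or_ge z o with hlt | hle
  · have hK : IsCompact (closure (I ∩ Icc a b) ∩ Icc z o) := isCompact_Icc.inter_left isClosed_closure
    obtain ⟨c, hc, hmax⟩ := hK.exists_isGreatest ⟨z, hz.1, ⟨le_rfl, hlt.le⟩⟩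
    have hco : c < o := lt_of_le_of_ne hc.2.2 fun h => hoI (h ▸ hc.1)
    have hgap : ∀ t, c < t → t ≤ o → t ∈ O ∩ Icc a b := by
      intro t h1 h2
      have htab : t ∈ Icc a b := ⟨hzab.1.trans (hc.2.1.trans h1.le), h2.trans ho.2.2⟩
      exact ⟨hO t htab fun h => absurd (hmax ⟨h, hc.2.1.trans h1.le, h2⟩) (not_le.2 h1), htab⟩
    have hcO : c ∈ closure (O ∩ Icc a b) := by
      have : closure (Ioo c o) ⊆ closure (O ∩ Icc a b) :=
        closure_mono fun t ht => hgap t ht.1 ht.2.le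
      rw [closure_Ioo hco.ne] at this
      exact this ⟨le_rfl, hco.le⟩
    have hcI : c ∈ I := by
      refine hsub ⟨hball ?_, hc.1, hcO⟩
      have := hc.2.1
      rw [mem_ball, Real.dist_eq, abs_lt]; constructor <;> linarith
    exact hright c hcI (o - c) (by linarith) fun s h0 h1 => (hgap _ (by linarith) (by linarith)).1
  · have hlt : o < z := lt_of_le_of_ne hle fun h => hoI (h ▸ hz.1)
    have hK : IsCompact (closure (I ∩ Icc a b) ∩ Icc o z) := isCompact_Icc.inter_left isClosed_closure
    obtain ⟨c, hc, hmin⟩ := hK.exists_isLeast ⟨z, hz.1, ⟨hlt.le, le_rfl⟩⟩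
    have hco : o < c := lt_of_le_of_ne hc.2.1 fun h => hoI (h ▸ hc.1)
    have hgap : ∀ t, o ≤ t → t < c → t ∈ O ∩ Icc a b := by
      intro t h1 h2
      have htab : t ∈ Icc a b := ⟨ho.2.1.trans h1, (h2.le.trans hc.2.2).trans hzab.2⟩
      exact ⟨hO t htab fun h => absurd (hmin ⟨h, h1, h2.le.trans hc.2.2⟩) (not_le.2 h2), htab⟩
    have hcO : c ∈ closure (O ∩ Icc a b) := by
      have : closure (Ioo o c) ⊆ closure (O ∩ Icc a b) :=
        closure_mono fun t ht => hgap t ht.1.le ht.2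
      rw [closure_Ioo hco.ne] at this
      exact this ⟨hco.le, le_rfl⟩
    have hcI : c ∈ I := by
      refine hsub ⟨hball ?_, hc.1, hcO⟩
      have := hc.2.2
      rw [mem_ball, Real.dist_eq, abs_lt]; constructor <;> linarith
    exact hleft c hcI (c - o) (by linarith) fun s h0 h1 => (hgap _ (by linarith) (by linarith)).1

/-- An interval is covered by only one of two disjoint sets which are countable unions of closed
sets and contain no endpoint of an interval of the other one. -/
lemma Icc_subset_of_mem {I O : Set ℝ} {a b : ℝ} (hdisj : Disjoint I O)
    (hcov : Icc a b ⊆ I ∪ O)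
    (hI1 : ∀ x ∈ I, ∀ δ > 0, ¬ ∀ s, 0 < s → s < δ → x + s ∈ O)
    (hI2 : ∀ x ∈ I, ∀ δ > 0, ¬ ∀ s, 0 < s → s < δ → x - s ∈ O)
    (hO1 : ∀ x ∈ O, ∀ δ > 0, ¬ ∀ s, 0 < s → s < δ → x + s ∈ I)
    (hO2 : ∀ x ∈ O, ∀ δ > 0, ¬ ∀ s, 0 < s → s < δ → x - s ∈ I)
    {G H : ℕ → Set ℝ} (hG : ∀ k, IsClosed (G k)) (hH : ∀ k, IsClosed (H k))
    (hIG : I ⊆ ⋃ k, G k) (hOH : O ⊆ ⋃ k, H k)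
    (hGI : ∀ k, G k ∩ Icc a b ⊆ I) (hHO : ∀ k, H k ∩ Icc a b ⊆ O)
    (hne : (I ∩ Icc a b).Nonempty) : Icc a b ⊆ I := by
  by_contra hnot
  have hneO : (O ∩ Icc a b).Nonempty := by
    obtain ⟨t, ht, htI⟩ := not_subset.1 hnot
    exact ⟨t, (hcov ht).resolve_left htI, ht⟩
  set Bd := closure (I ∩ Icc a b) ∩ closure (O ∩ Icc a b) with hBd
  have hBdc : IsClosed Bd := isClosed_closure.inter isClosed_closure
  have hBdab : Bd ⊆ Icc a b := fun z hz =>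
    closure_minimal (inter_subset_right (s := I)) isClosed_Icc hz.1
  have hBdne : Bd.Nonempty := by
    have hpre : IsPreconnected (Icc a b) := isPreconnected_Icc
    have := isPreconnected_closed_iff.1 hpre (closure (I ∩ Icc a b)) (closure (O ∩ Icc a b))
      isClosed_closure isClosed_closure ?_ ?_ ?_
    · obtain ⟨z, _, hz⟩ := this
      exact ⟨z, hz⟩
    · intro t ht
      exact (hcov ht).imp (fun h => subset_closure ⟨h, ht⟩) fun h => subset_closure ⟨h, ht⟩
    · obtain ⟨t, ht⟩ := hne
      exact ⟨t, ht.2, subset_closure ht⟩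
    · obtain ⟨t, ht⟩ := hneO
      exact ⟨t, ht.2, subset_closure ht⟩
  have : CompleteSpace Bd := hBdc.completeSpace_coe
  have : Nonempty Bd := hBdne.to_subtype
  let K : ℕ ⊕ ℕ → Set Bd := fun k => Subtype.val ⁻¹' (Sum.elim G H k)
  have hKc : ∀ k, IsClosed (K k) := by
    rintro (k | k)
    · exact (hG k).preimage continuous_subtype_val
    · exact (hH k).preimage continuous_subtype_val
  have hKu : ⋃ k, K k = univ := by
    rw [eq_univ_iff_forall]
    rintro ⟨z, hz⟩
    rw [mem_iUnion]
    rcases hcov (hBdab hz) with h | h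
    · obtain ⟨k, hk⟩ := mem_iUnion.1 (hIG h)
      exact ⟨Sum.inl k, hk⟩
    · obtain ⟨k, hk⟩ := mem_iUnion.1 (hOH h)
      exact ⟨Sum.inr k, hk⟩
  obtain ⟨k, ⟨z, hzB⟩, hz⟩ := nonempty_interior_of_iUnion_of_closed hKc hKu
  obtain ⟨V, hVsub, hVo, hzV⟩ := mem_interior.1 hz
  obtain ⟨U, hU, rfl⟩ := isOpen_induced_iff.1 hVo
  have hsub : U ∩ Bd ⊆ Sum.elim G H k := fun w hw => hVsub (show (⟨w, hw.2⟩ : Bd) ∈ _ from hw.1)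
  rcases k with k | k
  · exact not_subset_of_inter_closure hdisj hcov hI1 hI2 hU hzV hzB
      fun w hw => hGI k ⟨hsub hw, hBdab hw.2⟩
  · refine not_subset_of_inter_closure hdisj.symm (by rwa [union_comm]) hO1 hO2 hU hzV hzB.symm
      fun w hw => hHO k ⟨hsub ⟨hw.1, hw.2.symm⟩, hBdab hw.2.symm⟩

/-- On almost every line parallel to an axis, a segment avoiding the essential boundary lies
in the interior or in the exterior. -/
lemma ae_line_const {E : Set (Pt (n + 1))} (hE : MeasurableSet E) (i : Fin (n + 1)) :
    ∀ᵐ y : Fin n → ℝ, ∀ a b, a ≤ b → (∀ t ∈ Icc a b, linePt i t y ∉ essBdry E) →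
      (linePt i a y ∈ extr Eᶜ ↔ linePt i b y ∈ extr Eᶜ) := by
  have e1 : (1 : ℝ) = 1 ∨ (1 : ℝ) = -1 := Or.inl rfl
  have e2 : (-1 : ℝ) = 1 ∨ (-1 : ℝ) = -1 := Or.inr rfl
  filter_upwards [ae_not_extr_adjacent hE i e1, ae_not_extr_adjacent hE i e2,
    ae_not_extr_adjacent hE.compl i e1, ae_not_extr_adjacent hE.compl i e2] with y hO1 hO2 hI1 hI2
  simp only [compl_compl, one_mul, neg_mul, ← sub_eq_add_neg] at hO1 hO2 hI1 hI2
  intro a b hab hfree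
  have hhalf : (0 : ENNReal) < 1 / 2 := by norm_num
  set I : Set ℝ := {t | linePt i t y ∈ extr Eᶜ} with hI
  set O : Set ℝ := {t | linePt i t y ∈ extr E} with hO
  have hdisj : Disjoint I O := by
    rw [Set.disjoint_left]
    intro t h1 h2
    exact not_mem_extr_compl_of_mem_extr hE h2 h1
  have hcov : Icc a b ⊆ I ∪ O := by
    intro t ht
    have := hfree t ht
    rw [essBdry_eq hE, notMem_compl_iff] at this
    exact this.symm
  have hsp : ∀ {F : Set (Pt (n + 1))} (k : ℕ) {x}, MeasurableSet F → x ∈ extr Fᶜ →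
      x ∉ sparse (1 / 2) (1 / (k + 1 : ℝ)) F := by
    intro F k x hF hx hs
    have h1 : densTendsto F x 1 := (densTendsto_one_iff hF x).2 hx
    have h2 : ∀ᶠ r : ℝ in nhdsWithin 0 (Ioi 0),
        volume (F ∩ ball x r) / volume (ball x r) ≤ 1 / 2 := by
      have h1 : ∀ᶠ r : ℝ in nhdsWithin 0 (Ioi 0), r < 1 / (k + 1 : ℝ) :=
        mem_nhdsWithin_of_mem_nhds (Iio_mem_nhds (by positivity))
      filter_upwards [h1, self_mem_nhdsWithin] with r hr1 hr0
      rw [ENNReal.div_le_iff (volume_ball_ne_zero x hr0) measure_ball_lt_top.ne]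
      exact hs r hr0 hr1
    exact absurd (le_of_tendsto h1 h2) (by norm_num)
  have hclosed : ∀ (F : Set (Pt (n + 1))) (k : ℕ),
      IsClosed {t : ℝ | linePt i t y ∈ sparse (1 / 2) (1 / (k + 1 : ℝ)) F} := fun F k =>
    (isClosed_sparse _ _ F).preimage (continuous_linePt i y)
  have hIG : I ⊆ ⋃ k : ℕ, {t : ℝ | linePt i t y ∈ sparse (1 / 2) (1 / (k + 1 : ℝ)) Eᶜ} :=
    fun t ht => mem_iUnion.2 ((densTendsto_zero_iff _ _).1 ht _ hhalf)
  have hOG : O ⊆ ⋃ k : ℕ, {t : ℝ | linePt i t y ∈ sparse (1 / 2) (1 / (k + 1 : ℝ)) E} :=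
    fun t ht => mem_iUnion.2 ((densTendsto_zero_iff _ _).1 ht _ hhalf)
  have hGI : ∀ k : ℕ, {t : ℝ | linePt i t y ∈ sparse (1 / 2) (1 / (k + 1 : ℝ)) Eᶜ} ∩ Icc a b ⊆ I :=
    fun k t ht => (hcov ht.2).resolve_right fun h =>
      hsp k hE.compl (by rwa [compl_compl]) ht.1
  have hHO : ∀ k : ℕ, {t : ℝ | linePt i t y ∈ sparse (1 / 2) (1 / (k + 1 : ℝ)) E} ∩ Icc a b ⊆ O :=
    fun k t ht => (hcov ht.2).resolve_left fun h => hsp k hE h ht.1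
  have key := Icc_subset_of_mem hdisj hcov hI1 hI2 hO1 hO2 (hclosed _) (hclosed _) hIG hOG hGI hHO
  constructor
  · intro h
    exact key ⟨a, h, le_rfl, hab⟩ ⟨hab, le_rfl⟩
  · intro h
    exact key ⟨b, h, hab, le_rfl⟩ ⟨le_rfl, hab⟩

lemma integral_Ioi_eq_neg {φ k : ℝ → ℝ} {R : ℝ} (hk : Integrable k)
    (hφ : ∀ a b, φ b - φ a = ∫ t in a..b, k t) (hR : ∀ t, R < |t| → φ t = 0) (p : ℝ) :
    ∫ t in Ioi p, k t = -φ p := by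
  refine tendsto_nhds_unique
    (intervalIntegral_tendsto_integral_Ioi p hk.integrableOn tendsto_id) ?_
  refine tendsto_const_nhds.congr' ?_
  filter_upwards [eventually_gt_atTop R] with b hb
  rw [id, ← hφ p b, hR b (hb.trans_le (le_abs_self b)), zero_sub]

lemma integral_eq_zero_of_primitive {φ k : ℝ → ℝ} {R : ℝ} (hk : Integrable k)
    (hφ : ∀ a b, φ b - φ a = ∫ t in a..b, k t) (hR : ∀ t, R < |t| → φ t = 0) :
    ∫ t, k t = 0 := by
  refine tendsto_nhds_unique (intervalIntegral_tendsto_integral (a := fun n : ℕ => -(n : ℝ))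
    (b := fun n : ℕ => (n : ℝ)) hk (tendsto_neg_atTop_atBot.comp tendsto_natCast_atTop_atTop)
    tendsto_natCast_atTop_atTop) ?_
  refine tendsto_const_nhds.congr' ?_
  filter_upwards [tendsto_natCast_atTop_atTop.eventually (eventually_gt_atTop R)] with b hb
  rw [← hφ, hR b (hb.trans_le (le_abs_self _)), hR _ (by rw [abs_neg]; exact hb.trans_le (le_abs_self _)),
    sub_zero]

/-- The integral of a derivative over a set whose indicator jumps only on a finite set. -/
lemma abs_setIntegral_le_sum {φ k : ℝ → ℝ} {R : ℝ} (hk : Integrable k)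
    (hφ : ∀ a b, φ b - φ a = ∫ t in a..b, k t) (hR : ∀ t, R < |t| → φ t = 0) (P : Finset ℝ) :
    ∀ I : Set ℝ, MeasurableSet I →
      (∀ x y, x ≤ y → (∀ t ∈ Icc x y, t ∉ P) → (x ∈ I ↔ y ∈ I)) →
      |∫ t in I, k t| ≤ ∑ p ∈ P, |φ p| := by
  classical
  induction P using Finset.induction_on_max with
  | empty =>
    intro I _ hI
    have : I = ∅ ∨ I = univ := by
      rcases I.eq_empty_or_nonempty with h | ⟨x, hx⟩
      · exact Or.inl h
      · refine Or.inr (eq_univ_of_forall fun y => ?_)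
        rcases le_total x y with h | h
        · exact (hI x y h (by simp)).1 hx
        · exact (hI y x h (by simp)).2 hx
    rcases this with rfl | rfl
    · simp
    · simp [integral_eq_zero_of_primitive hk hφ hR]
  | insert p P hp ih =>
    intro I hIm hI
    have hpP : p ∉ P := fun h => lt_irrefl p (hp p h)
    have hright : ∫ t in I ∩ Ici p, k t = 0 ∨ ∫ t in I ∩ Ici p, k t = -φ p := by
      have e : ∫ t in I ∩ Ici p, k t = ∫ t in I ∩ Ioi p, k t :=
        setIntegral_congr_set ((ae_eq_refl I).inter Ioi_ae_eq_Ici.symm)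
      rw [e]
      rcases (I ∩ Ioi p).eq_empty_or_nonempty with h | ⟨x, hx, hxp⟩
      · left; rw [h]; simp
      · right
        have : I ∩ Ioi p = Ioi p := by
          refine inter_eq_right.2 fun y hy => ?_
          have key : ∀ x y, p < x → x ≤ y → (x ∈ I ↔ y ∈ I) := fun x y h1 h2 =>
            hI x y h2 fun t ht hm => by
              rcases Finset.mem_insert.1 hm with rfl | hm
              · exact absurd ht.1 (not_le.2 h1)
              · exact absurd (h1.trans_le ht.1) (not_lt.2 (hp t hm).le)
          rcases le_total x y with h | h
          · exact (key x y hxp h).1 hx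
          · exact (key y x hy h).2 hx
        rw [this, integral_Ioi_eq_neg hk hφ hR]
    let Q : Prop := ∃ c, c < p ∧ (∀ q ∈ P, q < c) ∧ c ∈ I
    let J : Set ℝ := I ∩ Iio p ∪ {t | p ≤ t ∧ Q}
    have hQm : MeasurableSet {t | p ≤ t ∧ Q} := measurableSet_Ici.inter (MeasurableSet.const Q)
    have hJm : MeasurableSet J := (hIm.inter measurableSet_Iio).union hQm
    have hJ := ih J hJm ?_
    · have hJint : ∫ t in J, k t = (∫ t in I ∩ Iio p, k t) + ∫ t in {t | p ≤ t ∧ Q}, k t := by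
        refine setIntegral_union ?_ hQm hk.integrableOn hk.integrableOn
        rw [Set.disjoint_left]
        rintro t ⟨_, h⟩ ⟨h', _⟩
        exact (not_lt.2 (show p ≤ t from h')) h
      have hQint : ∫ t in {t | p ≤ t ∧ Q}, k t = 0 ∨ ∫ t in {t | p ≤ t ∧ Q}, k t = -φ p := by
        by_cases hQ : Q
        · right
          have : {t | p ≤ t ∧ Q} = Ici p := by ext t; simp [hQ]
          rw [this, integral_Ici_eq_integral_Ioi, integral_Ioi_eq_neg hk hφ hR]
        · left; simp [hQ]
      have hIint : ∫ t in I, k t = (∫ t in I ∩ Iio p, k t) + ∫ t in I ∩ Ici p, k t := by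
        rw [← setIntegral_union ?_ (hIm.inter measurableSet_Ici) hk.integrableOn hk.integrableOn,
          ← inter_union_distrib_left, Iio_union_Ici, inter_univ]
        rw [Set.disjoint_left]
        rintro t ⟨_, h⟩ ⟨_, h'⟩
        exact (not_lt.2 (show p ≤ t from h')) h
      rw [Finset.sum_insert hpP]
      have : |∫ t in I, k t| ≤ |∫ t in J, k t| + |φ p| := by
        have e : (∫ t in I, k t) = (∫ t in J, k t) +
            ((∫ t in I ∩ Ici p, k t) - ∫ t in {t | p ≤ t ∧ Q}, k t) := by
          rw [hIint, hJint]; ring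
        rw [e]
        refine (abs_add_le _ _).trans (add_le_add le_rfl ?_)
        rcases hright with h1 | h1 <;> rcases hQint with h2 | h2 <;> rw [h1, h2] <;> simp
      linarith
    · have hq : ∀ x, x < p → (∀ q ∈ P, q < x) → (x ∈ I ↔ Q) := by
        intro x hx hxq
        have key : ∀ x y, x ≤ y → y < p → (∀ q ∈ P, q < x) → (x ∈ I ↔ y ∈ I) :=
          fun x y h1 h2 h3 => hI x y h1 fun t ht hm => by
              rcases Finset.mem_insert.1 hm with rfl | hm
              · exact absurd ht.2 (not_le.2 h2)
              · exact absurd ht.1 (not_le.2 (h3 t hm))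
        refine ⟨fun h => ⟨x, hx, hxq, h⟩, ?_⟩
        rintro ⟨c, hc, hcq, hcI⟩
        rcases le_total x c with h | h
        · exact (key x c h hc hxq).2 hcI
        · exact (key c x h hx hcq).1 hcI
      intro x y hxy hfree
      rcases lt_or_ge y p with hy | hy
      · have hx : x < p := hxy.trans_lt hy
        have := hI x y hxy fun t ht hm => by
          rcases Finset.mem_insert.1 hm with rfl | hm
          · exact absurd ht.2 (not_le.2 hy)
          · exact hfree t ht hm
        simp only [J, mem_union, mem_inter_iff, mem_Iio, mem_ofPred_eq, hx, hy, not_le.2 hx,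
          not_le.2 hy, and_true, false_and, or_false, this]
      · rcases lt_or_ge x p with hx | hx
        · have := hq x hx fun q hqP => by
            by_contra hcon
            exact hfree q ⟨not_lt.1 hcon, (hp q hqP).le.trans hy⟩ hqP
          simp only [J, mem_union, mem_inter_iff, mem_Iio, mem_ofPred_eq, hx, hy, not_le.2 hx,
            not_lt.2 hy, and_true, and_false, false_and, or_false, this, true_and, false_or]
        · simp only [J, mem_union, mem_inter_iff, mem_Iio, mem_ofPred_eq, hx, hy,
            not_lt.2 hx, not_lt.2 hy, and_false, true_and]

lemma volume_proj_image_le (i : Fin (n + 1)) (S : Set (Pt (n + 1))) :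
    volume (proj i '' S) ≤ μH[(n : ℝ)] S := by
  have h := (lipschitzWith_proj i).hausdorffMeasure_image_le (d := (n : ℝ)) (by positivity) S
  have e : (μH[(n : ℝ)] : Measure (Fin n → ℝ)) = volume := by
    have := hausdorffMeasure_pi_real (ι := Fin n)
    rwa [Fintype.card_fin] at this
  rw [e] at h
  simpa using h

lemma exists_slice_bound_indicator (i : Fin (n + 1)) {S : Set (Pt (n + 1))} (hS : MeasurableSet S) :
    ∃ h : (Fin n → ℝ) → ENNReal, Measurable h ∧ ∫⁻ y, h y ≤ μH[(n : ℝ)] S ∧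
      ∀ y, ∀ P : Finset ℝ, ∑ t ∈ P, S.indicator (fun _ => (1 : ENNReal)) (linePt i t y) ≤ h y := by
  classical
  let D : ℕ → ℤ → Set (Pt (n + 1)) := fun m k => {x | ⌊(m : ℝ) * x i⌋ = k}
  have hDm : ∀ m k, MeasurableSet (D m k) := fun m k => by
    have : Measurable fun x : Pt (n + 1) => ⌊(m : ℝ) * x i⌋ := by fun_prop
    exact this (measurableSet_singleton k)
  let T : ℕ → ℤ → Set (Fin n → ℝ) := fun m k => toMeasurable volume (proj i '' (S ∩ D m k))
  let h : ℕ → (Fin n → ℝ) → ENNReal := fun m y => ∑' k, (T m k).indicator (fun _ => 1) y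
  have hm : ∀ m, Measurable (h m) := fun m =>
    Measurable.tsum fun k => measurable_const.indicator (measurableSet_toMeasurable _ _)
  have hint : ∀ m, ∫⁻ y, h m y ≤ μH[(n : ℝ)] S := by
    intro m
    rw [lintegral_tsum fun k => (measurable_const.indicator (measurableSet_toMeasurable _ _)).aemeasurable]
    have e : ∀ k, ∫⁻ y, (T m k).indicator (fun _ => (1 : ENNReal)) y ≤ μH[(n : ℝ)] (S ∩ D m k) := by
      intro k
      rw [lintegral_indicator_const (measurableSet_toMeasurable _ _), one_mul, measure_toMeasurable]
      exact volume_proj_image_le i _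
    refine (ENNReal.tsum_le_tsum e).trans ?_
    rw [← measure_iUnion _ fun k => hS.inter (hDm m k)]
    · exact measure_mono (iUnion_subset fun k => inter_subset_left)
    · intro k l hkl
      refine Set.disjoint_left.2 fun x hx hx' => hkl ?_
      exact hx.2.symm.trans hx'.2
  refine ⟨fun y => liminf (fun m => h m y) atTop, Measurable.liminf hm, ?_, ?_⟩
  · refine (lintegral_liminf_le hm).trans ?_
    exact (liminf_le_liminf (Eventually.of_forall hint)).trans (by simp)
  · intro y P
    have hP : ∃ δ > 0, ∀ s ∈ P, ∀ t ∈ P, s ≠ t → δ ≤ |s - t| := by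
      rcases (P.offDiag).eq_empty_or_nonempty with h0 | h0
      · refine ⟨1, one_pos, fun s hs t ht hst => ?_⟩
        have : (s, t) ∈ P.offDiag := Finset.mem_offDiag.2 ⟨hs, ht, hst⟩
        simp [h0] at this
      · obtain ⟨q, hq, hmin⟩ := P.offDiag.exists_min_image (fun q => |q.1 - q.2|) h0
        refine ⟨|q.1 - q.2|, abs_pos.2 (sub_ne_zero.2 (Finset.mem_offDiag.1 hq).2.2),
          fun s hs t ht hst => hmin (s, t) (Finset.mem_offDiag.2 ⟨hs, ht, hst⟩)⟩
    obtain ⟨δ, hδ, hsep⟩ := hP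
    refine le_liminf_of_le (by isBoundedDefault) ?_
    obtain ⟨M, hM⟩ := exists_nat_gt (1 / δ)
    filter_upwards [eventually_ge_atTop M] with m hmM
    have hm1 : 1 < m * δ := by
      have : (M : ℝ) ≤ m := by exact_mod_cast hmM
      rw [div_lt_iff₀ hδ] at hM
      nlinarith
    set Q := P.filter fun t => linePt i t y ∈ S with hQ
    have hinj : Set.InjOn (fun t : ℝ => ⌊(m : ℝ) * t⌋) (Q : Set ℝ) := by
      intro s hs t ht hst
      by_contra hne
      have h1 := hsep s (Finset.mem_filter.1 hs).1 t (Finset.mem_filter.1 ht).1 hne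
      have h2 := Int.abs_sub_lt_one_of_floor_eq_floor hst
      rw [← mul_sub, abs_mul, abs_of_nonneg (Nat.cast_nonneg m)] at h2
      have : (m : ℝ) * δ ≤ m * |s - t| := by gcongr
      linarith
    calc ∑ t ∈ P, S.indicator (fun _ => (1 : ENNReal)) (linePt i t y)
        = ∑ t ∈ Q, 1 := by
          rw [hQ, Finset.sum_filter]
          refine Finset.sum_congr rfl fun t _ => ?_
          simp [Set.indicator_apply]
      _ ≤ ∑ t ∈ Q, (T m ⌊(m : ℝ) * t⌋).indicator (fun _ => 1) y := by
          refine Finset.sum_le_sum fun t ht => ?_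
          rw [indicator_of_mem]
          refine subset_toMeasurable _ _ ⟨linePt i t y, ⟨(Finset.mem_filter.1 ht).2, ?_⟩, proj_linePt i t y⟩
          simp [D]
      _ = ∑ k ∈ Q.image (fun t : ℝ => ⌊(m : ℝ) * t⌋), (T m k).indicator (fun _ => 1) y := by
          rw [Finset.sum_image hinj]
      _ ≤ h m y := ENNReal.sum_le_tsum _

/-- Integral bound for the sums of a function over the points of the lines parallel to an axis. -/
lemma exists_slice_bound (i : Fin (n + 1)) {φ : Pt (n + 1) → ENNReal} (hφ : Measurable φ) :
    ∃ h : (Fin n → ℝ) → ENNReal, Measurable h ∧ ∫⁻ y, h y ≤ ∫⁻ x, φ x ∂μH[(n : ℝ)] ∧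
      ∀ y, ∀ P : Finset ℝ, ∑ t ∈ P, φ (linePt i t y) ≤ h y := by
  refine hφ.ennreal_induction (motive := fun φ => ∃ h : (Fin n → ℝ) → ENNReal, Measurable h ∧
      ∫⁻ y, h y ≤ ∫⁻ x, φ x ∂μH[(n : ℝ)] ∧
      ∀ y, ∀ P : Finset ℝ, ∑ t ∈ P, φ (linePt i t y) ≤ h y) ?_ ?_ ?_
  · intro c S hS
    obtain ⟨h, hm, hi, hs⟩ := exists_slice_bound_indicator i hS
    refine ⟨fun y => c * h y, hm.const_mul c, ?_, fun y P => ?_⟩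
    · rw [lintegral_const_mul c hm, lintegral_indicator_const hS]
      gcongr
    · refine le_trans (le_of_eq ?_) (mul_le_mul_right (hs y P) c)
      rw [Finset.mul_sum]
      refine Finset.sum_congr rfl fun t _ => ?_
      by_cases ht : linePt i t y ∈ S <;> simp [ht]
  · rintro φ ψ - hφ hψ ⟨h, hm, hi, hs⟩ ⟨h', hm', hi', hs'⟩
    refine ⟨fun y => h y + h' y, hm.add hm', ?_, fun y P => ?_⟩
    · rw [lintegral_add_left hm]
      simp only [Pi.add_apply]
      rw [lintegral_add_left hφ]
      exact add_le_add hi hi'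
    · simp only [Pi.add_apply]
      rw [Finset.sum_add_distrib]
      exact add_le_add (hs y P) (hs' y P)
  · intro φ hφ hmono hk
    choose h hm hi hs using hk
    refine ⟨fun y => liminf (fun m => h m y) atTop, Measurable.liminf hm, ?_, fun y P => ?_⟩
    · refine (lintegral_liminf_le hm).trans ?_
      refine (liminf_le_liminf (v := fun _ => ∫⁻ x, ⨆ k, φ k x ∂μH[(n : ℝ)])
        (Eventually.of_forall fun m => ?_)).trans (by simp)
      exact (hi m).trans (lintegral_mono fun x => le_iSup (fun k => φ k x) m)
    · have hlim : Tendsto (fun m => ∑ t ∈ P, φ m (linePt i t y)) atTop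
          (nhds (∑ t ∈ P, ⨆ m, φ m (linePt i t y))) :=
        tendsto_finsetSum _ fun t _ => tendsto_atTop_iSup fun a b hab => hmono hab _
      rw [← hlim.liminf_eq]
      exact liminf_le_liminf (Eventually.of_forall fun m => hs m y P)

/-- Pairs of bounded measurable functions with bounded support such that the second one is the
derivative of the first one along the `i`-th axis. -/
structure IsTestPair {N : ℕ} (i : Fin N) (φ k : Pt N → ℝ) : Prop where
  measurable_fst : Measurable φ
  measurable_snd : Measurable k
  bounded : ∃ C, ∀ x, |φ x| ≤ C ∧ |k x| ≤ C ∧ (C < ‖x‖ → φ x = 0 ∧ k x = 0)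
  eq_integral : ∀ x h, φ (x + h • axis i) - φ x = ∫ τ in (0 : ℝ)..h, k (x + τ • axis i)

lemma norm_axis {N : ℕ} (i : Fin N) : ‖axis i‖ = 1 := by simp [axis]

lemma integrable_of_bounded {X : Type*} [NormedAddCommGroup X] [ProperSpace X] [MeasurableSpace X]
    [BorelSpace X] {μ : Measure X} [IsFiniteMeasureOnCompacts μ] {k : X → ℝ} (hk : Measurable k)
    {C : ℝ} (h1 : ∀ x, |k x| ≤ C) (h2 : ∀ x, C < ‖x‖ → k x = 0) : Integrable k μ := by
  have : IntegrableOn k (closedBall 0 C) μ :=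
    Measure.integrableOn_of_bounded (M := C) (isCompact_closedBall _ _).measure_lt_top.ne
      hk.aestronglyMeasurable (Eventually.of_forall h1)
  refine (integrableOn_iff_integrable_of_support_subset fun x hx => ?_).1 this
  rw [mem_closedBall_zero_iff]
  by_contra hcon
  exact hx (h2 x (not_le.1 hcon))

lemma IsTestPair.integrable_snd {N : ℕ} {i : Fin N} {φ k : Pt N → ℝ} (h : IsTestPair i φ k)
    {μ : Measure (Pt N)} [IsFiniteMeasureOnCompacts μ] : Integrable k μ := by
  obtain ⟨C, hC⟩ := h.bounded
  exact integrable_of_bounded h.measurable_snd (fun x => (hC x).2.1) fun x hx => ((hC x).2.2 hx).2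

lemma abs_le_norm_linePt (i : Fin (n + 1)) (t : ℝ) (y : Fin n → ℝ) : |t| ≤ ‖linePt i t y‖ := by
  simpa using PiLp.norm_apply_le (linePt i t y) i

lemma finite_of_sum_indicator_le {n : ℕ} {A : Set (Pt (n + 1))} {i : Fin (n + 1)} {y : Fin n → ℝ}
    {c : ENNReal} (hc : c < ⊤)
    (h : ∀ P : Finset ℝ, ∑ t ∈ P, A.indicator (fun _ => (1 : ENNReal)) (linePt i t y) ≤ c) :
    {t | linePt i t y ∈ A}.Finite := by
  by_contra hinf
  obtain ⟨m, hm⟩ := ENNReal.exists_nat_gt hc.ne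
  obtain ⟨P, hP, hcard⟩ := Set.Infinite.exists_subset_card_eq hinf m
  refine absurd (h P) (not_le.2 ?_)
  rw [Finset.sum_congr rfl fun t ht => indicator_of_mem (show linePt i t y ∈ A from hP ht) _]
  simpa [hcard] using hm

lemma integral_eq_integral_linePt (i : Fin (n + 1)) {F : Pt (n + 1) → ℝ} (hF : Integrable F) :
    ∫ x, F x = ∫ y : Fin n → ℝ, ∫ t : ℝ, F (linePt i t y) := by
  have h1 := (measurePreserving_splitEquiv i).symm.integral_comp' F
  have h2 : Integrable (fun p : ℝ × (Fin n → ℝ) => F ((splitEquiv i).symm p)) :=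
    (measurePreserving_splitEquiv i).symm.integrable_comp_of_integrable hF
  rw [← h1]
  exact integral_prod_symm _ h2

theorem IsTestPair.enorm_setIntegral_le {E : Set (Pt (n + 1))} (hE : MeasurableSet E)
    (hA : μH[(n : ℝ)] (essBdry E) < ⊤) {i : Fin (n + 1)} {φ k : Pt (n + 1) → ℝ}
    (h : IsTestPair i φ k) :
    ‖∫ x in E, k x‖ₑ ≤ ∫⁻ x in essBdry E, ‖φ x‖ₑ ∂μH[(n : ℝ)] := by
  classical
  have hAm := measurableSet_essBdry hE
  have hGm := measurableSet_extr Eᶜ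
  have e1 : ∫ x in E, k x = ∫ x, (extr Eᶜ).indicator k x := by
    rw [integral_indicator hGm]
    refine setIntegral_congr_set (eventuallyEq_set.2 ?_)
    filter_upwards [ae_mem_extr_iff hE.compl] with x hx
    rw [hx, notMem_compl_iff]
  obtain ⟨h1, hm1, hi1, hs1⟩ := exists_slice_bound_indicator i hAm
  obtain ⟨h2, hm2, hi2, hs2⟩ := exists_slice_bound i
    (φ := (essBdry E).indicator fun x => ‖φ x‖ₑ) (h.measurable_fst.enorm.indicator hAm)
  rw [e1, integral_eq_integral_linePt i (h.integrable_snd.indicator hGm)]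
  refine (enorm_integral_le_lintegral_enorm _).trans ?_
  rw [← lintegral_indicator hAm]
  refine le_trans (lintegral_mono_ae ?_) hi2
  obtain ⟨C, hC⟩ := h.bounded
  filter_upwards [ae_line_const hE i, ae_lt_top hm1 (hi1.trans_lt hA).ne] with y hy hfin
  have hP := finite_of_sum_indicator_le hfin (hs1 y)
  have hlm : Measurable fun t => linePt i t y := (continuous_linePt i y).measurable
  have key := abs_setIntegral_le_sum (φ := fun t => φ (linePt i t y)) (k := fun t => k (linePt i t y))
    (R := C) (integrable_of_bounded (C := C) (h.measurable_snd.comp hlm) (fun t => (hC _).2.1)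
      fun t ht => ((hC _).2.2 (ht.trans_le (abs_le_norm_linePt i t y))).2) ?_
    (fun t ht => ((hC _).2.2 (ht.trans_le (abs_le_norm_linePt i t y))).1) hP.toFinset
    {t | linePt i t y ∈ extr Eᶜ} (hlm hGm) ?_
  · have e2 : ∫ t, (extr Eᶜ).indicator k (linePt i t y) =
        ∫ t in {t | linePt i t y ∈ extr Eᶜ}, k (linePt i t y) := by
      change _ = ∫ t in (fun t => linePt i t y) ⁻¹' extr Eᶜ, k (linePt i t y)
      rw [← integral_indicator (hlm hGm)]
      rfl
    rw [e2, Real.enorm_eq_ofReal_abs]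
    refine (ENNReal.ofReal_le_ofReal key).trans ?_
    rw [ENNReal.ofReal_sum_of_nonneg fun _ _ => abs_nonneg _]
    refine le_trans (Finset.sum_le_sum fun t ht => ?_) (hs2 y hP.toFinset)
    rw [indicator_of_mem (by simpa using ht), Real.enorm_eq_ofReal_abs]
  · intro a b
    have := h.eq_integral (linePt i a y) (b - a)
    rw [linePt_add, add_sub_cancel] at this
    rw [this]
    simp only [linePt_add]
    rw [intervalIntegral.integral_comp_add_left (fun t => k (linePt i t y))]
    simp
  · intro a b hab hfree
    exact hy a b hab fun t ht hmem => hfree t ht (by simpa using hmem)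

/-- A functional dominated by a Hilbert norm is represented by an inner product. -/
lemma exists_inner_repr {V H : Type*} [AddCommGroup V] [Module ℝ V] [NormedAddCommGroup H]
    [InnerProductSpace ℝ H] [CompleteSpace H] (L : V →ₗ[ℝ] ℝ) (T : V →ₗ[ℝ] H) (C : ℝ)
    (h : ∀ v, |L v| ≤ C * ‖T v‖) : ∃ σ : H, ∀ v, L v = inner ℝ σ (T v) := by
  have hker : LinearMap.ker T ≤ LinearMap.ker L := fun v hv => by
    have := h v
    rw [LinearMap.mem_ker.1 hv, norm_zero, mul_zero] at this
    exact LinearMap.mem_ker.2 (abs_nonpos_iff.1 this)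
  let L₁ : LinearMap.range T →ₗ[ℝ] ℝ :=
    ((LinearMap.ker T).liftQ L hker).comp T.quotKerEquivRange.symm.toLinearMap
  have hL₁ : ∀ v, L₁ ⟨T v, LinearMap.mem_range_self T v⟩ = L v := by
    intro v
    have : T.quotKerEquivRange.symm ⟨T v, LinearMap.mem_range_self T v⟩ = Submodule.Quotient.mk v := by
      rw [LinearEquiv.symm_apply_eq]
      rfl
    simp only [L₁, LinearMap.comp_apply, LinearEquiv.coe_coe]
    rw [this]
    rfl
  let L₂ : LinearMap.range T →L[ℝ] ℝ := L₁.mkContinuous C (by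
    rintro ⟨_, v, rfl⟩
    rw [Real.norm_eq_abs, hL₁]
    exact h v)
  obtain ⟨g, hg, -⟩ := exists_extension_norm_eq (LinearMap.range T) L₂
  refine ⟨(InnerProductSpace.toDual ℝ H).symm g, fun v => ?_⟩
  rw [InnerProductSpace.toDual_symm_apply, ← hL₁ v]
  exact (hg ⟨T v, LinearMap.mem_range_self T v⟩).symm

lemma IsTestPair.add {N : ℕ} {i : Fin N} {φ k φ' k' : Pt N → ℝ} (h : IsTestPair i φ k)
    (h' : IsTestPair i φ' k') : IsTestPair i (φ + φ') (k + k') := by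
  refine ⟨h.1.add h'.1, h.2.add h'.2, ?_, fun x t => ?_⟩
  · obtain ⟨C, hC⟩ := h.3
    obtain ⟨C', hC'⟩ := h'.3
    have h0 : 0 ≤ C := (abs_nonneg _).trans (hC 0).1
    have h0' : 0 ≤ C' := (abs_nonneg _).trans (hC' 0).1
    refine ⟨C + C', fun x => ⟨?_, ?_, fun hx => ?_⟩⟩
    · exact (abs_add_le _ _).trans (add_le_add (hC x).1 (hC' x).1)
    · exact (abs_add_le _ _).trans (add_le_add (hC x).2.1 (hC' x).2.1)
    · have h1 := (hC x).2.2 (by linarith)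
      have h2 := (hC' x).2.2 (by linarith)
      simp [h1.1, h1.2, h2.1, h2.2]
  · have hi : ∀ {φ k : Pt N → ℝ}, IsTestPair i φ k →
        IntervalIntegrable (fun τ => k (x + τ • axis i)) volume 0 t := by
      intro φ k h
      obtain ⟨C, hC⟩ := h.3
      have hm : Measurable fun τ : ℝ => k (x + τ • axis i) := h.2.comp (by fun_prop)
      rw [intervalIntegrable_iff]
      exact Measure.integrableOn_of_bounded (M := C) (by simp) hm.aestronglyMeasurable
        (Eventually.of_forall fun τ => (hC _).2.1)
    have e1 := h.4 x t
    have e2 := h'.4 x t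
    simp only [Pi.add_apply]
    rw [intervalIntegral.integral_add (hi h) (hi h')]
    linarith

lemma IsTestPair.smul {N : ℕ} {i : Fin N} {φ k : Pt N → ℝ} (h : IsTestPair i φ k) (c : ℝ) :
    IsTestPair i (c • φ) (c • k) := by
  refine ⟨h.1.const_smul c, h.2.const_smul c, ?_, fun x t => ?_⟩
  · obtain ⟨C, hC⟩ := h.3
    have h0 : 0 ≤ C := (abs_nonneg _).trans (hC 0).1
    refine ⟨max (|c| * C) C, fun x => ⟨?_, ?_, fun hx => ?_⟩⟩
    · simp only [Pi.smul_apply, smul_eq_mul, abs_mul]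
      exact le_max_of_le_left (mul_le_mul_of_nonneg_left (hC x).1 (abs_nonneg c))
    · simp only [Pi.smul_apply, smul_eq_mul, abs_mul]
      exact le_max_of_le_left (mul_le_mul_of_nonneg_left (hC x).2.1 (abs_nonneg c))
    · have h1 := (hC x).2.2 ((le_max_right _ _).trans_lt hx)
      simp [h1.1, h1.2]
  · have e1 := h.4 x t
    simp only [Pi.smul_apply, smul_eq_mul]
    rw [intervalIntegral.integral_const_mul, ← e1]
    ring

/-- The space of test pairs. -/
def testPairs {N : ℕ} (i : Fin N) : Submodule ℝ ((Pt N → ℝ) × (Pt N → ℝ)) where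
  carrier := {p | IsTestPair i p.1 p.2}
  add_mem' := fun h h' => IsTestPair.add h h'
  zero_mem' := ⟨measurable_const, measurable_const, ⟨0, by simp⟩, by simp⟩
  smul_mem' := fun c _ h => IsTestPair.smul h c

lemma IsTestPair.memLp {N : ℕ} {i : Fin N} {φ k : Pt N → ℝ} (h : IsTestPair i φ k)
    (ν : Measure (Pt N)) [IsFiniteMeasure ν] : MemLp φ 2 ν := by
  obtain ⟨C, hC⟩ := h.3
  exact MemLp.of_bound h.1.aestronglyMeasurable C (Eventually.of_forall fun x => (hC x).1)

/-- Representation of the distributional derivative of the indicator of a set along an axis. -/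
theorem exists_density {E : Set (Pt (n + 1))} (hE : MeasurableSet E)
    (hA : μH[(n : ℝ)] (essBdry E) < ⊤) (i : Fin (n + 1)) :
    ∃ σ : Pt (n + 1) → ℝ, MemLp σ 2 (μH[(n : ℝ)].restrict (essBdry E)) ∧
      ∀ φ k : Pt (n + 1) → ℝ, IsTestPair i φ k →
        ∫ x in E, k x = ∫ x in essBdry E, φ x * σ x ∂μH[(n : ℝ)] := by
  set ν := (μH[(n : ℝ)] : Measure (Pt (n + 1))).restrict (essBdry E) with hν
  have : IsFiniteMeasure ν := ⟨by rwa [hν, Measure.restrict_apply_univ]⟩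
  let L : testPairs i →ₗ[ℝ] ℝ :=
    { toFun := fun p => ∫ x in E, p.1.2 x
      map_add' := fun p q => integral_add (IsTestPair.integrable_snd p.2).integrableOn
        (IsTestPair.integrable_snd q.2).integrableOn
      map_smul' := fun c p => integral_const_mul c _ }
  let T : testPairs i →ₗ[ℝ] Lp ℝ 2 ν :=
    { toFun := fun p => (IsTestPair.memLp p.2 ν).toLp p.1.1
      map_add' := fun p q => rfl
      map_smul' := fun c p => rfl }
  obtain ⟨σ, hσ⟩ := exists_inner_repr L T (ν univ ^ (1 / (1 : ℝ) - 1 / 2)).toReal (by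
    intro p
    have hp : IsTestPair i p.1.1 p.1.2 := p.2
    have h1 := hp.enorm_setIntegral_le hE hA
    have h2 : ∫⁻ x in essBdry E, ‖p.1.1 x‖ₑ ∂μH[(n : ℝ)] ≤
        eLpNorm p.1.1 2 ν * ν univ ^ (1 / (1 : ℝ) - 1 / 2) := by
      have := eLpNorm_le_eLpNorm_mul_rpow_measure_univ (p := 1) (q := 2) (μ := ν) (f := p.1.1)
        (by norm_num) hp.1.aestronglyMeasurable
      rw [eLpNorm_one_eq_lintegral_enorm] at this
      simpa using this
    have h3 : ‖T p‖ = (eLpNorm p.1.1 2 ν).toReal := Lp.norm_toLp _ (hp.memLp ν)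
    have h4 : eLpNorm p.1.1 2 ν * ν univ ^ (1 / (1 : ℝ) - 1 / 2) ≠ ⊤ :=
      ENNReal.mul_ne_top (hp.memLp ν).2.ne
        (ENNReal.rpow_ne_top_of_nonneg (by norm_num) (measure_ne_top _ _))
    have h5 := ENNReal.toReal_mono h4 (h1.trans h2)
    rw [toReal_enorm, Real.norm_eq_abs, ENNReal.toReal_mul, ← h3, mul_comm] at h5
    exact h5)
  refine ⟨σ, Lp.memLp σ, fun φ k hp => ?_⟩
  have := hσ ⟨(φ, k), hp⟩
  rw [MeasureTheory.L2.inner_def] at this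
  refine this.trans (integral_congr_ae ?_)
  filter_upwards [(hp.memLp ν).coeFn_toLp] with x hx
  change inner ℝ (σ x) ((hp.memLp ν).toLp φ x) = _
  rw [hx]
  simp

section

/-- The map moving every point along the `i`-th axis by the amount `u`. -/
def shear (i : Fin N) (u : Pt N → ℝ) (x : Pt N) : Pt N := x + u x • axis i

/-- Admissible displacement functions of shear maps. -/
structure IsShear (K : NNReal) (u : Pt N → ℝ) : Prop where
  lip : LipschitzWith K u
  le_half : K ≤ 1 / 2
  diff : Differentiable ℝ u
  bdd : ∃ C, ∀ x, |u x| ≤ C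

variable {K : NNReal} {u : Pt N → ℝ}

/-- The integral of `η` along the segments swept by the shear map. -/
def sweep (i : Fin N) (u η : Pt N → ℝ) (x : Pt N) : ℝ := ∫ τ in (0 : ℝ)..u x, η (x + τ • axis i)

/-- The derivative of `sweep` along the axis. -/
def sweepDeriv (i : Fin N) (u η : Pt N → ℝ) (x : Pt N) : ℝ :=
  η (shear i u x) * (1 + fderiv ℝ u x (axis i)) - η x

lemma IsShear.abs_fderiv_le (h : IsShear K u) (i : Fin N) (x : Pt N) :
    |fderiv ℝ u x (axis i)| ≤ 1 / 2 := by
  have h1 := norm_fderiv_le_of_lipschitz ℝ (x₀ := x) h.lip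
  have h2 := (fderiv ℝ u x).le_opNorm (axis i)
  rw [norm_axis, mul_one, Real.norm_eq_abs] at h2
  have h3 : (K : ℝ) ≤ 1 / 2 := by exact_mod_cast h.le_half
  linarith

lemma IsShear.continuous (h : IsShear K u) (i : Fin N) : Continuous (shear i u) := by
  have := h.lip.continuous
  unfold shear
  fun_prop

lemma IsShear.lipschitz (h : IsShear K u) (i : Fin N) : LipschitzWith (1 + K) (shear i u) := by
  refine LipschitzWith.of_dist_le_mul fun x y => ?_
  have h1 := h.lip.dist_le_mul x y
  have e : shear i u x - shear i u y = (x - y) + (u x - u y) • axis i := by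
    simp only [shear]; module
  rw [dist_eq_norm, e]
  refine (norm_add_le _ _).trans ?_
  rw [norm_smul, norm_axis, mul_one, ← dist_eq_norm, ← dist_eq_norm]
  push_cast
  linarith

lemma IsShear.antilipschitz (h : IsShear K u) (i : Fin N) : AntilipschitzWith 2 (shear i u) := by
  refine AntilipschitzWith.of_le_mul_dist fun x y => ?_
  have h1 := h.lip.dist_le_mul x y
  have h3 : (K : ℝ) ≤ 1 / 2 := by exact_mod_cast h.le_half
  have e : x - y = (shear i u x - shear i u y) - (u x - u y) • axis i := by
    simp only [shear]; module
  have h2 : dist x y ≤ dist (shear i u x) (shear i u y) + dist (u x) (u y) := by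
    rw [dist_eq_norm, e]
    refine (norm_sub_le _ _).trans ?_
    rw [norm_smul, norm_axis, mul_one, ← dist_eq_norm, ← dist_eq_norm]
  have : (K : ℝ) * dist x y ≤ 1 / 2 * dist x y := by gcongr
  push_cast
  linarith

lemma IsShear.isClosedEmbedding (h : IsShear K u) (i : Fin N) :
    Topology.IsClosedEmbedding (shear i u) :=
  (h.antilipschitz i).isClosedEmbedding (h.lipschitz i).uniformContinuous

lemma IsShear.injective (h : IsShear K u) (i : Fin N) : Function.Injective (shear i u) :=
  (h.antilipschitz i).injective

lemma IsShear.measurableSet_image (h : IsShear K u) (i : Fin N) {S : Set (Pt N)}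
    (hS : MeasurableSet S) : MeasurableSet (shear i u '' S) :=
  (h.isClosedEmbedding i).measurableEmbedding.measurableSet_image.2 hS

lemma IsShear.surjective (h : IsShear K u) (i : Fin N) : Function.Surjective (shear i u) := by
  intro y
  obtain ⟨C, hC⟩ := h.bdd
  have h0 : 0 ≤ C := (abs_nonneg _).trans (hC 0)
  have hc : Continuous fun t : ℝ => t + u (y + t • axis i) := by
    have := h.lip.continuous
    fun_prop
  have h1 := abs_le.1 (hC (y + (-C) • axis i))
  have h2 := abs_le.1 (hC (y + C • axis i))
  obtain ⟨t, -, ht⟩ := intermediate_value_Icc (show -C ≤ C by linarith) hc.continuousOn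
    (show (0 : ℝ) ∈ Icc _ _ from ⟨by linarith, by linarith⟩)
  refine ⟨y + t • axis i, ?_⟩
  have : y + t • axis i + u (y + t • axis i) • axis i = y + (t + u (y + t • axis i)) • axis i := by
    module
  rw [shear, this, show t + u (y + t • axis i) = 0 from ht, zero_smul, add_zero]

lemma IsShear.hasFDerivAt (h : IsShear K u) (i : Fin N) (x : Pt N) :
    HasFDerivAt (shear i u)
      (ContinuousLinearMap.id ℝ (Pt N) + (fderiv ℝ u x).smulRight (axis i)) x :=
  (hasFDerivAt_id x).add ((h.diff x).hasFDerivAt.smul_const (axis i))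

lemma det_id_add_smulRight (l : Pt N →L[ℝ] ℝ) (v : Pt N) :
    (ContinuousLinearMap.id ℝ (Pt N) + l.smulRight v).det = 1 + l v := by
  have : ((ContinuousLinearMap.id ℝ (Pt N) + l.smulRight v : Pt N →L[ℝ] Pt N) : Pt N →ₗ[ℝ] Pt N) =
      LinearMap.transvection (l : Pt N →ₗ[ℝ] ℝ) v := by
    ext1 x; rfl
  rw [ContinuousLinearMap.det, this, LinearMap.transvection.det]
  rfl

lemma IsShear.integral_image (h : IsShear K u) (i : Fin N) {S : Set (Pt N)} (hS : MeasurableSet S)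
    (η : Pt N → ℝ) :
    ∫ x in shear i u '' S, η x =
      ∫ x in S, η (shear i u x) * (1 + fderiv ℝ u x (axis i)) := by
  rw [integral_image_eq_integral_abs_det_fderiv_smul volume hS
    (fun x _ => (h.hasFDerivAt i x).hasFDerivWithinAt) (h.injective i).injOn]
  refine integral_congr_ae (Eventually.of_forall fun x => ?_)
  have := abs_le.1 (h.abs_fderiv_le i x)
  simp only [det_id_add_smulRight, smul_eq_mul]
  rw [abs_of_nonneg (by linarith), mul_comm]

lemma IsShear.volume_image_le (h : IsShear K u) (i : Fin N) {S : Set (Pt N)} (hS : MeasurableSet S) :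
    volume (shear i u '' S) ≤ 2 * volume S := by
  rw [← lintegral_abs_det_fderiv_eq_addHaar_image volume hS
    (fun x _ => (h.hasFDerivAt i x).hasFDerivWithinAt) (h.injective i).injOn, ← setLIntegral_const]
  refine lintegral_mono fun x => ?_
  have := abs_le.1 (h.abs_fderiv_le i x)
  rw [det_id_add_smulRight, abs_of_nonneg (by linarith)]
  exact ENNReal.ofReal_le_of_le_toReal (by norm_num; linarith)

lemma IsShear.isTestPair (h : IsShear K u) (i : Fin N) {η : Pt N → ℝ} (hη : Measurable η)
    {M : ℝ} (hM : ∀ x, |η x| ≤ M) (hM0 : ∀ x, M < ‖x‖ → η x = 0) :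
    IsTestPair i (sweep i u η) (sweepDeriv i u η) := by
  have hum : Measurable u := h.lip.continuous.measurable
  have hsm : Measurable (shear i u) := (h.continuous i).measurable
  have hdm := measurable_fderiv_apply_const ℝ u (axis i)
  have hM' : 0 ≤ M := (abs_nonneg _).trans (hM 0)
  obtain ⟨C, hC⟩ := h.bdd
  have hC0 : 0 ≤ C := (abs_nonneg _).trans (hC 0)
  refine ⟨?_, ?_, ⟨max (M + C) (max (M * C) (3 * M)), fun x => ⟨?_, ?_, fun hx => ?_⟩⟩, fun x t => ?_⟩
  · have e : sweep i u η = fun x => u x * ∫ r in (0 : ℝ)..1, η (x + (u x * r) • axis i) := by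
      ext1 x
      rw [intervalIntegral.mul_integral_comp_mul_left (f := fun τ => η (x + τ • axis i)), sweep]
      simp
    rw [e]
    refine hum.mul ?_
    simp only [intervalIntegral.integral_of_le zero_le_one]
    refine (StronglyMeasurable.integral_prod_right' (f := fun p : Pt N × ℝ =>
      η (p.1 + (u p.1 * p.2) • axis i)) ?_).measurable
    refine (hη.comp ?_).stronglyMeasurable
    fun_prop
  · unfold sweepDeriv
    fun_prop
  · have := intervalIntegral.norm_integral_le_of_norm_le_const (a := 0) (b := u x) (C := M)
      (f := fun τ => η (x + τ • axis i)) fun τ _ => hM _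
    rw [sub_zero, Real.norm_eq_abs] at this
    refine this.trans (le_max_of_le_right (le_max_of_le_left ?_))
    exact mul_le_mul_of_nonneg_left (hC x) hM'
  · refine le_max_of_le_right (le_max_of_le_right ?_)
    have h1 := abs_le.1 (h.abs_fderiv_le i x)
    unfold sweepDeriv
    refine (abs_sub _ _).trans ?_
    rw [abs_mul, abs_of_nonneg (show 0 ≤ 1 + fderiv ℝ u x (axis i) by linarith)]
    have h2 := hM (shear i u x)
    have h3 := hM x
    have : |η (shear i u x)| * (1 + fderiv ℝ u x (axis i)) ≤ M * 2 :=
      mul_le_mul h2 (by linarith) (by linarith) hM'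
    linarith
  · have hx1 : M + C < ‖x‖ := (le_max_left _ _).trans_lt hx
    have key : ∀ τ : ℝ, |τ| ≤ C → η (x + τ • axis i) = 0 := by
      intro τ hτ
      refine hM0 _ ?_
      have : ‖x‖ ≤ ‖x + τ • axis i‖ + ‖τ • axis i‖ := by
        simpa using norm_sub_le (x + τ • axis i) (τ • axis i)
      rw [norm_smul, norm_axis, mul_one, Real.norm_eq_abs] at this
      linarith
    constructor
    · rw [sweep]
      refine (intervalIntegral.integral_congr (g := fun _ => 0) fun τ hτ => key τ ?_).trans (by simp)
      have := abs_sub_left_of_mem_uIcc hτ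
      rw [sub_zero, sub_zero] at this
      exact this.trans (hC x)
    · have h0 := key 0 (by simpa using hC0)
      rw [zero_smul, add_zero] at h0
      rw [sweepDeriv, shear, key _ (hC x), h0]
      simp
  · set q : ℝ → ℝ := fun τ => τ + u (x + τ • axis i) with hq
    have hq' : ∀ τ, HasDerivAt q (1 + fderiv ℝ u (x + τ • axis i) (axis i)) τ := by
      intro τ
      have h1 : HasDerivAt (fun τ : ℝ => x + τ • axis i) (axis i) τ := by
        simpa using ((hasDerivAt_id τ).smul_const (axis i)).const_add x
      exact (hasDerivAt_id τ).add ((h.diff _).hasFDerivAt.comp_hasDerivAt τ h1)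
    have hline : ∀ τ s : ℝ, x + τ • axis i + s • axis i = x + (τ + s) • axis i := fun τ s => by module
    have hηi : ∀ a b, IntervalIntegrable (fun τ => η (x + τ • axis i)) volume a b := by
      intro a b
      have hm : Measurable fun τ : ℝ => η (x + τ • axis i) := hη.comp (by fun_prop)
      rw [intervalIntegrable_iff]
      exact Measure.integrableOn_of_bounded (M := M) (by simp) hm.aestronglyMeasurable
        (Eventually.of_forall fun τ => hM _)
    have e1 : ∫ τ in (0 : ℝ)..t, sweepDeriv i u η (x + τ • axis i) =
        (∫ τ in (0 : ℝ)..t, ((fun s => η (x + s • axis i)) ∘ q) τ *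
          (1 + fderiv ℝ u (x + τ • axis i) (axis i))) - ∫ τ in (0 : ℝ)..t, η (x + τ • axis i) := by
      rw [← intervalIntegral.integral_sub _ (hηi _ _)]
      · simp only [sweepDeriv, shear, hline, hq, Function.comp_apply]
      · have hm : Measurable fun τ : ℝ => ((fun s => η (x + s • axis i)) ∘ q) τ *
            (1 + fderiv ℝ u (x + τ • axis i) (axis i)) := by
          have h1 : Measurable fun τ : ℝ => x + τ • axis i := by fun_prop
          have h2 : Measurable q := measurable_id.add (hum.comp h1)
          exact (hη.comp (h1.comp h2)).mul ((hdm.comp h1).const_add 1)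
        rw [intervalIntegrable_iff]
        refine Measure.integrableOn_of_bounded (M := M * 2) (by simp) hm.aestronglyMeasurable
          (Eventually.of_forall fun τ => ?_)
        have h1 := abs_le.1 (h.abs_fderiv_le i (x + τ • axis i))
        rw [Real.norm_eq_abs, abs_mul]
        refine mul_le_mul (hM _) ?_ (abs_nonneg _) hM'
        rw [abs_le]; constructor <;> linarith
    have hqc : Continuous q := continuous_iff_continuousAt.2 fun τ => (hq' τ).continuousAt
    rw [e1, intervalIntegral.integral_comp_mul_deriv_of_deriv_nonneg hqc.continuousOn
      (fun τ _ => hq' τ) (fun τ _ => by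
        have := abs_le.1 (h.abs_fderiv_le i (x + τ • axis i)); linarith)]
    have e2 : sweep i u η (x + t • axis i) = ∫ s in t..q t, η (x + s • axis i) := by
      rw [sweep]
      simp only [hline]
      rw [intervalIntegral.integral_comp_add_left (fun s => η (x + s • axis i))]
      simp [hq]
    have e3 : sweep i u η x = ∫ s in (0 : ℝ)..q 0, η (x + s • axis i) := by
      simp [sweep, hq]
    rw [e2, e3, ← intervalIntegral.integral_interval_sub_interval_comm' (hηi _ _) (hηi _ _) (hηi _ _)]

lemma IsShear.setIntegral_sweepDeriv (h : IsShear K u) (i : Fin N) {η : Pt N → ℝ} (hη : Measurable η)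
    {M : ℝ} (hM : ∀ x, |η x| ≤ M) (hM0 : ∀ x, M < ‖x‖ → η x = 0) {E : Set (Pt N)}
    (hE : MeasurableSet E) :
    ∫ x in E, sweepDeriv i u η x = (∫ x in shear i u '' E, η x) - ∫ x in E, η x := by
  have h1 : Integrable η := integrable_of_bounded hη hM hM0
  have h2 : Integrable (sweepDeriv i u η) := (h.isTestPair i hη hM hM0).integrable_snd
  have e : ∀ x, η (shear i u x) * (1 + fderiv ℝ u x (axis i)) = sweepDeriv i u η x + η x := by
    intro x; simp [sweepDeriv]
  rw [h.integral_image i hE]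
  simp only [e]
  rw [integral_add h2.integrableOn h1.integrableOn]
  ring

end

section

variable {K : NNReal} {u : Pt N → ℝ}

lemma IsShear.mem_extr_image (h : IsShear K u) (i : Fin N) {E : Set (Pt N)} (hE : MeasurableSet E)
    {x : Pt N} (hx : x ∈ extr E) : shear i u x ∈ extr (shear i u '' E) := by
  have hx' : densTendsto E x 0 := hx
  have h2 : Tendsto (fun r : ℝ => 2 * r) (nhdsWithin 0 (Ioi 0)) (nhdsWithin 0 (Ioi 0)) := by
    refine tendsto_nhdsWithin_iff.2 ⟨?_, ?_⟩
    · have : Tendsto (fun r : ℝ => 2 * r) (nhds 0) (nhds (2 * 0)) := by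
        exact (continuous_const.mul continuous_id).tendsto 0
      rw [mul_zero] at this
      exact this.mono_left nhdsWithin_le_nhds
    · filter_upwards [self_mem_nhdsWithin] with r hr
      have : (0 : ℝ) < r := hr
      exact show (0 : ℝ) < 2 * r by linarith
  set c : ENNReal := 2 * ENNReal.ofReal (2 ^ N) with hc
  have h3 : Tendsto (fun r : ℝ => c * (volume (E ∩ ball x (2 * r)) / volume (ball x (2 * r))))
      (nhdsWithin 0 (Ioi 0)) (nhds (c * 0)) :=
    ENNReal.Tendsto.const_mul (hx'.comp h2) (Or.inr (ENNReal.mul_ne_top (by simp) (by simp)))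
  rw [mul_zero] at h3
  refine tendsto_of_tendsto_of_tendsto_of_le_of_le' tendsto_const_nhds h3
    (Eventually.of_forall fun _ => zero_le) ?_
  filter_upwards [self_mem_nhdsWithin] with r hr
  have hr : 0 < r := hr
  have hsub : shear i u '' E ∩ ball (shear i u x) r ⊆ shear i u '' (E ∩ ball x (2 * r)) := by
    rintro _ ⟨⟨z, hz, rfl⟩, hzr⟩
    refine ⟨z, ⟨hz, ?_⟩, rfl⟩
    have := (h.antilipschitz i).le_mul_dist z x
    rw [mem_ball] at hzr ⊢
    push_cast at this
    linarith
  have hv : volume (ball x (2 * r)) = ENNReal.ofReal (2 ^ N) * volume (ball x r) := by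
    rw [Measure.addHaar_ball_mul_of_pos volume x two_pos, volume_ball_center_eq 0 x]
    simp
  have h0 := volume_ball_ne_zero x hr
  have ht : volume (ball x r) ≠ ⊤ := measure_ball_lt_top.ne
  have hp0 : ENNReal.ofReal (2 ^ N) ≠ 0 := by simp
  have hpt : ENNReal.ofReal (2 ^ N) ≠ ⊤ := by simp
  rw [volume_ball_center_eq (shear i u x) x]
  calc volume (shear i u '' E ∩ ball (shear i u x) r) / volume (ball x r)
      ≤ (2 * volume (E ∩ ball x (2 * r))) / volume (ball x r) := by
        gcongr
        exact (measure_mono hsub).trans (h.volume_image_le i (hE.inter measurableSet_ball))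
    _ = c * (volume (E ∩ ball x (2 * r)) / volume (ball x (2 * r))) := by
        rw [hv, hc, div_eq_mul_inv, div_eq_mul_inv, ENNReal.mul_inv (Or.inl hp0) (Or.inl hpt)]
        calc 2 * volume (E ∩ ball x (2 * r)) * (volume (ball x r))⁻¹
            = (ENNReal.ofReal (2 ^ N) * (ENNReal.ofReal (2 ^ N))⁻¹) *
              (2 * volume (E ∩ ball x (2 * r)) * (volume (ball x r))⁻¹) := by
              rw [ENNReal.mul_inv_cancel hp0 hpt, one_mul]
          _ = _ := by ring

lemma IsShear.image_compl (h : IsShear K u) (i : Fin N) (E : Set (Pt N)) :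
    shear i u '' Eᶜ = (shear i u '' E)ᶜ :=
  image_compl_eq ⟨h.injective i, h.surjective i⟩

lemma IsShear.essBdry_image_subset (h : IsShear K u) (i : Fin N) {E : Set (Pt N)}
    (hE : MeasurableSet E) : essBdry (shear i u '' E) ⊆ shear i u '' essBdry E := by
  intro y hy
  obtain ⟨x, rfl⟩ := h.surjective i y
  refine ⟨x, ?_, rfl⟩
  rw [essBdry_eq (h.measurableSet_image i hE), ← h.image_compl i] at hy
  rw [essBdry_eq hE]
  rintro (hx | hx)
  · exact hy (Or.inl (h.mem_extr_image i hE hx))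
  · exact hy (Or.inr (h.mem_extr_image i hE.compl hx))

lemma IsShear.lintegral_image_le (h : IsShear K u) (i : Fin N) {d : ℝ} (hd : 0 ≤ d)
    (S : Set (Pt N)) {G : Pt N → ENNReal} (hG : Measurable G) :
    ∫⁻ y in shear i u '' S, G y ∂μH[d] ≤
      ((1 + K : NNReal) : ENNReal) ^ d * ∫⁻ x in S, G (shear i u x) ∂μH[d] := by
  have hm := (h.continuous i).measurable
  have hle : (μH[d] : Measure (Pt N)).restrict (shear i u '' S) ≤
      ((1 + K : NNReal) : ENNReal) ^ d • ((μH[d] : Measure (Pt N)).restrict S).map (shear i u) := by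
    refine Measure.le_iff.2 fun T hT => ?_
    rw [Measure.restrict_apply hT, Measure.smul_apply, Measure.map_apply hm hT,
      Measure.restrict_apply (hm hT), smul_eq_mul]
    have : T ∩ shear i u '' S = shear i u '' (shear i u ⁻¹' T ∩ S) := by
      rw [image_preimage_inter]
    rw [this]
    exact (h.lipschitz i).hausdorffMeasure_image_le hd _
  refine (lintegral_mono' hle le_rfl).trans ?_
  rw [lintegral_smul_measure, lintegral_map hG hm, smul_eq_mul]

/-- A shear supported in a ball maps the ball to itself. -/
lemma IsShear.image_ball (h : IsShear K u) (i : Fin N) {x : Pt N} {r : ℝ}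
    (hu : ∀ y ∉ ball x r, u y = 0) : ∀ y ∈ ball x r, shear i u y ∈ ball x r := by
  intro y hy
  by_contra hcon
  have e : shear i u (shear i u y) = shear i u y := by
    conv_lhs => rw [shear, hu _ hcon, zero_smul, add_zero]
  exact hcon (by rwa [h.injective i e])

lemma IsShear.symmDiff_image_subset (h : IsShear K u) (i : Fin N) {x : Pt N} {r : ℝ}
    (hu : ∀ y ∉ ball x r, u y = 0) (E : Set (Pt N)) :
    symmDiff E (shear i u '' E) ⊆ ball x r := by
  have hfix : ∀ y ∉ ball x r, shear i u y = y := fun y hy => by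
    rw [shear, hu y hy, zero_smul, add_zero]
  rintro y (⟨hy, hn⟩ | ⟨⟨z, hz, rfl⟩, hn⟩)
  · by_contra hcon
    exact hn ⟨y, hy, hfix y hcon⟩
  · by_contra hcon
    by_cases hzb : z ∈ ball x r
    · exact hcon (h.image_ball i hu z hzb)
    · rw [hfix z hzb] at hn
      exact hn hz

/-- Change of a weighted boundary integral under a shear supported in a ball. -/
lemma IsShear.lintegral_essBdry_le (h : IsShear K u) (i : Fin N) {x : Pt N} {r d : ℝ} (hd : 0 ≤ d)
    (hu : ∀ y ∉ ball x r, u y = 0) {E : Set (Pt N)} (hE : MeasurableSet E) {G : Pt N → ENNReal}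
    (hG : Measurable G) {c c' : ENNReal} (hc : ∀ y ∈ ball x r, G (shear i u y) ≤ G y + c)
    (hc' : ∀ y ∈ ball x r, G y ≤ c') {b : ENNReal}
    (hb : ((1 + K : NNReal) : ENNReal) ^ d ≤ 1 + b) :
    ∫⁻ y in essBdry (shear i u '' E), G y ∂μH[d] ≤ (∫⁻ y in essBdry E, G y ∂μH[d]) +
      (c + b * (c' + c)) * μH[d] (essBdry E ∩ ball x r) := by
  have hA := measurableSet_essBdry hE
  have hfix : ∀ y ∉ ball x r, shear i u y = y := fun y hy => by
    rw [shear, hu y hy, zero_smul, add_zero]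
  have hsub : essBdry (shear i u '' E) ⊆
      (essBdry E \ ball x r) ∪ shear i u '' (essBdry E ∩ ball x r) := by
    intro y hy
    obtain ⟨z, hz, rfl⟩ := h.essBdry_image_subset i hE hy
    by_cases hzb : z ∈ ball x r
    · exact Or.inr ⟨z, ⟨hz, hzb⟩, rfl⟩
    · left; rw [hfix z hzb]; exact ⟨hz, hzb⟩
  calc ∫⁻ y in essBdry (shear i u '' E), G y ∂μH[d]
      ≤ (∫⁻ y in essBdry E \ ball x r, G y ∂μH[d]) +
        ∫⁻ y in shear i u '' (essBdry E ∩ ball x r), G y ∂μH[d] :=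
        (lintegral_mono_set hsub).trans (lintegral_union_le _ _ _)
    _ ≤ (∫⁻ y in essBdry E \ ball x r, G y ∂μH[d]) +
        ((∫⁻ y in essBdry E ∩ ball x r, G y ∂μH[d]) +
          (c + b * (c' + c)) * μH[d] (essBdry E ∩ ball x r)) := by
        gcongr
        refine (h.lintegral_image_le i hd _ hG).trans ?_
        calc ((1 + K : NNReal) : ENNReal) ^ d *
              ∫⁻ x in essBdry E ∩ ball x r, G (shear i u x) ∂μH[d]
            ≤ (1 + b) * ∫⁻ x in essBdry E ∩ ball x r, (G x + c) ∂μH[d] := by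
              gcongr ?_ * ?_
              exact setLIntegral_mono (hG.add_const c) fun y hy => hc y hy.2
          _ = (∫⁻ x in essBdry E ∩ ball x r, (G x + c) ∂μH[d]) +
              b * ∫⁻ x in essBdry E ∩ ball x r, (G x + c) ∂μH[d] := by ring
          _ ≤ ((∫⁻ x in essBdry E ∩ ball x r, G x ∂μH[d]) +
                c * μH[d] (essBdry E ∩ ball x r)) +
              b * ((c' + c) * μH[d] (essBdry E ∩ ball x r)) := by
              gcongr
              · rw [lintegral_add_left hG, setLIntegral_const]
              · rw [← setLIntegral_const]
                exact setLIntegral_mono measurable_const fun y hy => by gcongr; exact hc' y hy.2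
          _ = _ := by ring
    _ = _ := by
        rw [← add_assoc, add_comm (∫⁻ y in essBdry E \ ball x r, G y ∂μH[d]),
          lintegral_inter_add_sdiff _ _ measurableSet_ball]

end

/-- `σ` represents with respect to `ν` the derivative of the indicator of `E` along an axis. -/
structure IsDensity (ν : Measure (Pt N)) (E : Set (Pt N)) (i : Fin N) (σ : Pt N → ℝ) : Prop where
  integrable : Integrable σ ν
  eq_integral : ∀ φ k : Pt N → ℝ, IsTestPair i φ k → ∫ x in E, k x = ∫ x, φ x * σ x ∂ν

lemma isShear_const (c : ℝ) : IsShear (N := N) 0 fun _ => c :=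
  ⟨LipschitzWith.const c, zero_le, differentiable_const c, ⟨|c|, fun _ => le_rfl⟩⟩

lemma abs_sweep_le {i : Fin N} {u η : Pt N → ℝ} {M : ℝ} (hM : ∀ x, |η x| ≤ M) (x : Pt N) :
    |sweep i u η x| ≤ M * |u x| := by
  have := intervalIntegral.norm_integral_le_of_norm_le_const (a := 0) (b := u x) (C := M)
    (f := fun τ => η (x + τ • axis i)) fun τ _ => hM _
  rwa [sub_zero, Real.norm_eq_abs] at this

/-- Volume of the points of `E` leaving `E` under a translation along an axis. -/
lemma IsDensity.volume_leave_le {ν : Measure (Pt N)} {E : Set (Pt N)} (hE : MeasurableSet E)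
    {i : Fin N} {σ : Pt N → ℝ} (hσ : IsDensity ν E i σ) (x : Pt N) {a h : ℝ}
    (ha : 0 < a) (hh : |h| ≤ 2 * a) :
    (volume {w | w ∈ E ∩ ball x (3 * a) ∧ w + h • axis i ∉ E}).toReal ≤
      2 * a * ∫ y in ball x (5 * a), |σ y| ∂ν := by
  have htr : Measurable fun w : Pt N => w + h • axis i := by fun_prop
  set S := {w | w ∈ E ∩ ball x (3 * a) ∧ w + h • axis i ∉ E} with hS
  have hSm : MeasurableSet S := (hE.inter measurableSet_ball).inter (htr hE).compl
  set η : Pt N → ℝ := S.indicator fun _ => 1 with hη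
  have hηm : Measurable η := measurable_const.indicator hSm
  have h01 : ∀ y, |η y| ≤ 1 := fun y => by
    by_cases hy : y ∈ S <;> simp [hη, hy]
  have hSb : S ⊆ ball x (3 * a) := fun w hw => hw.1.2
  set M := 1 + ‖x‖ + 3 * a with hM
  have hM1 : ∀ y, |η y| ≤ M := fun y => (h01 y).trans (by rw [hM]; have := norm_nonneg x; linarith)
  have hM0 : ∀ y, M < ‖y‖ → η y = 0 := by
    intro y hy
    refine indicator_of_notMem (fun hyS => ?_) _
    have h1 := hSb hyS
    rw [mem_ball, dist_eq_norm] at h1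
    have h2 := norm_sub_norm_le y x
    linarith
  have hu := isShear_const (N := N) (-h)
  have hpair := hu.isTestPair i hηm hM1 hM0
  have e1 := hσ.eq_integral _ _ hpair
  rw [hu.setIntegral_sweepDeriv i hηm hM1 hM0 hE] at e1
  have e2 : ∫ y in shear i (fun _ => -h) '' E, η y = 0 := by
    refine setIntegral_eq_zero_of_forall_eq_zero ?_
    rintro _ ⟨z, hz, rfl⟩
    refine indicator_of_notMem (fun hzS => hzS.2 ?_) _
    rw [shear]
    convert hz using 1
    module
  have e3 : ∫ y in E, η y = (volume S).toReal := by
    rw [hη, setIntegral_indicator hSm, setIntegral_const, smul_eq_mul, mul_one, Measure.real]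
    congr 2
    exact inter_eq_right.2 fun w hw => hw.1.1
  rw [e2, e3, zero_sub] at e1
  have e4 : (volume S).toReal ≤ ∫ y, |sweep i (fun _ => -h) η y * σ y| ∂ν := by
    have := abs_integral_le_integral_abs (μ := ν) (f := fun y => sweep i (fun _ => -h) η y * σ y)
    rw [← e1, abs_neg, abs_of_nonneg ENNReal.toReal_nonneg] at this
    exact this
  refine e4.trans ?_
  rw [← integral_const_mul, ← integral_indicator measurableSet_ball]
  refine integral_mono_of_nonneg (Eventually.of_forall fun y => abs_nonneg _)
    ((hσ.integrable.abs.const_mul _).indicator measurableSet_ball)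
    (Eventually.of_forall fun y => ?_)
  simp only
  by_cases hy : y ∈ ball x (5 * a)
  · rw [indicator_of_mem hy, abs_mul]
    refine mul_le_mul_of_nonneg_right ((abs_sweep_le h01 y).trans ?_) (abs_nonneg _)
    rwa [one_mul, abs_neg]
  · have : sweep i (fun _ => -h) η y = 0 := by
      rw [sweep]
      refine (intervalIntegral.integral_congr (g := fun _ => 0) fun τ hτ => ?_).trans (by simp)
      refine indicator_of_notMem (fun hyS => hy ?_) _
      have h1 := hSb hyS
      have h2 := abs_sub_left_of_mem_uIcc hτ
      rw [sub_zero, sub_zero, abs_neg] at h2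
      rw [mem_ball] at h1 ⊢
      have h3 : dist y (y + τ • axis i) = |τ| := by
        rw [dist_self_add_right, norm_smul, norm_axis, mul_one, Real.norm_eq_abs]
      have := dist_triangle y (y + τ • axis i) x
      linarith
    rw [indicator_of_notMem hy, this]
    simp

lemma sum_smul_axis (h : Pt N) : ∑ j, h j • axis j = h := by
  ext k
  simp [axis, Pi.single_apply]

lemma norm_sum_smul_axis_le (h : Pt N) (J : Finset (Fin N)) : ‖∑ j ∈ J, h j • axis j‖ ≤ ‖h‖ := by
  classical
  have e : ∀ k, (∑ j ∈ J, h j • axis j) k = if k ∈ J then h k else 0 := by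
    intro k
    simp [axis, Pi.single_apply]
  rw [EuclideanSpace.norm_eq, EuclideanSpace.norm_eq]
  refine Real.sqrt_le_sqrt (Finset.sum_le_sum fun k _ => ?_)
  rw [e]
  split_ifs <;> simp [sq_nonneg]

/-- A translation is a composition of translations along the axes. -/
lemma volume_leave_sum_le {E : Set (Pt N)} {x h : Pt N} {a : ℝ}
    (hh : ‖h‖ ≤ 2 * a) {m : ENNReal}
    (hm : ∀ i : Fin N, volume {w | w ∈ E ∩ ball x (3 * a) ∧ w + h i • axis i ∉ E} ≤ m)
    (J : Finset (Fin N)) :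
    volume {z | z ∈ E ∩ ball x a ∧ z + ∑ j ∈ J, h j • axis j ∉ E} ≤ J.card * m := by
  classical
  induction J using Finset.induction_on with
  | empty =>
    have : {z | z ∈ E ∩ ball x a ∧ z + ∑ j ∈ ∅, h j • axis j ∉ E} = ∅ := by
      ext z
      simp only [mem_ofPred_eq, Finset.sum_empty, add_zero, mem_empty_iff_false, iff_false]
      exact fun hz => hz.2 hz.1.1
    rw [this]
    simp
  | insert j J hj ih =>
    set v := ∑ j ∈ J, h j • axis j with hv
    set W := {w | w ∈ E ∩ ball x (3 * a) ∧ w + h j • axis j ∉ E} with hW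
    have hsub : {z | z ∈ E ∩ ball x a ∧ z + ∑ j ∈ insert j J, h j • axis j ∉ E} ⊆
        {z | z ∈ E ∩ ball x a ∧ z + v ∉ E} ∪ (fun z => z + v) ⁻¹' W := by
      rintro z ⟨hz, hn⟩
      rw [Finset.sum_insert hj, ← hv] at hn
      by_cases hzv : z + v ∈ E
      · right
        refine ⟨⟨hzv, ?_⟩, ?_⟩
        · have h1 := hz.2
          rw [mem_ball] at h1 ⊢
          have h2 : dist (z + v) z ≤ 2 * a := by
            rw [dist_self_add_left]
            exact (norm_sum_smul_axis_le h J).trans hh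
          have := dist_triangle (z + v) z x
          linarith
        · rwa [add_assoc, add_comm v]
      · exact Or.inl ⟨hz, hzv⟩
    refine (measure_mono hsub).trans ((measure_union_le _ _).trans ?_)
    rw [measure_preimage_add_right, Finset.card_insert_of_notMem hj]
    push_cast
    rw [add_mul, one_mul]
    exact add_le_add ih (hm j)

/-- In a ball in which `S` and `T` are both substantial some translation moves much of `S` into
`T`. -/
lemma exists_translation {S T : Set (Pt N)} (hS : MeasurableSet S) (hT : MeasurableSet T) {x : Pt N}
    {a : ℝ} (hSb : S ⊆ ball x a) (hTb : T ⊆ ball x a) {m : ENNReal}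
    (hm : m * volume (ball (0 : Pt N) (2 * a)) < volume S * volume T) :
    ∃ h : Pt N, ‖h‖ ≤ 2 * a ∧ m < volume {z | z ∈ S ∧ z + h ∈ T} := by
  by_contra! hcon
  refine absurd hm (not_lt.2 ?_)
  have hmeas : Measurable fun p : Pt N × Pt N =>
      S.indicator (fun _ => (1 : ENNReal)) p.2 * T.indicator (fun _ => (1 : ENNReal)) (p.2 + p.1) :=
    ((measurable_const.indicator hS).comp measurable_snd).mul
      ((measurable_const.indicator hT).comp (measurable_snd.add measurable_fst))
  have e1 : volume S * volume T = ∫⁻ z, ∫⁻ h, S.indicator (fun _ => (1 : ENNReal)) z *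
      T.indicator (fun _ => (1 : ENNReal)) (z + h) := by
    have : ∀ z : Pt N, ∫⁻ h, S.indicator (fun _ => (1 : ENNReal)) z *
        T.indicator (fun _ => (1 : ENNReal)) (z + h) =
        S.indicator (fun _ => (1 : ENNReal)) z * volume T := by
      intro z
      rw [lintegral_const_mul _ (by exact (measurable_const.indicator hT).comp (measurable_const_add z)),
        lintegral_add_left_eq_self (T.indicator fun _ => (1 : ENNReal)) z, lintegral_indicator_const hT,
        one_mul]
    simp only [this]
    rw [lintegral_mul_const _ (measurable_const.indicator hS), lintegral_indicator_const hS, one_mul]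
  rw [e1, lintegral_lintegral_swap (by exact (hmeas.comp measurable_swap).aemeasurable)]
  have e2 : ∀ h : Pt N, ∫⁻ z, S.indicator (fun _ => (1 : ENNReal)) z *
      T.indicator (fun _ => (1 : ENNReal)) (z + h) = volume {z | z ∈ S ∧ z + h ∈ T} := by
    intro h
    have hm : MeasurableSet {z | z ∈ S ∧ z + h ∈ T} := hS.inter ((measurable_add_const h) hT)
    rw [← one_mul (volume _), ← lintegral_indicator_const hm]
    refine lintegral_congr fun z => ?_
    by_cases h1 : z ∈ S <;> by_cases h2 : z + h ∈ T <;> simp [indicator, h1, h2]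
  simp only [e2]
  rw [← lintegral_indicator_const measurableSet_ball]
  refine lintegral_mono fun h => ?_
  by_cases hh : h ∈ ball (0 : Pt N) (2 * a)
  · rw [indicator_of_mem hh]
    exact hcon h (mem_ball_zero_iff.1 hh).le
  · rw [indicator_of_notMem hh]
    refine le_of_eq ?_
    rw [show {z | z ∈ S ∧ z + h ∈ T} = ∅ from ?_, measure_empty]
    rw [eq_empty_iff_forall_notMem]
    rintro z ⟨h1, h2⟩
    refine hh ?_
    have h3 := hSb h1
    have h4 := hTb h2
    rw [mem_ball] at h3 h4
    rw [mem_ball_zero_iff]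
    have h5 : dist (z + h) z = ‖h‖ := by rw [dist_self_add_left]
    have := dist_triangle_right (z + h) z x
    linarith

/-- Volume of the unit ball. -/
def unitVol (N : ℕ) : ℝ := (volume (ball (0 : Pt N) 1)).toReal

lemma unitVol_pos (N : ℕ) : 0 < unitVol N :=
  ENNReal.toReal_pos (volume_ball_ne_zero _ one_pos) measure_ball_lt_top.ne

lemma volume_ball_eq (x : Pt N) {a : ℝ} (ha : 0 < a) :
    volume (ball x a) = ENNReal.ofReal (a ^ N * unitVol N) := by
  rw [Measure.addHaar_ball_of_pos volume x ha, ENNReal.ofReal_mul (by positivity), unitVol,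
    ENNReal.ofReal_toReal measure_ball_lt_top.ne]
  simp

/-- Relative isoperimetric inequality in balls. -/
theorem exists_isoperimetric (n : ℕ) : ∃ c : ℝ, 0 < c ∧ ∀ {ν : Measure (Pt (n + 1))}
    {E : Set (Pt (n + 1))}, MeasurableSet E → ∀ {σ : Fin (n + 1) → Pt (n + 1) → ℝ},
    (∀ i, IsDensity ν E i (σ i)) → ∀ (x : Pt (n + 1)) {a : ℝ}, 0 < a →
      ENNReal.ofReal (1 / 4) * volume (ball x a) ≤ volume (E ∩ ball x a) →
      ENNReal.ofReal (1 / 4) * volume (ball x a) ≤ volume (Eᶜ ∩ ball x a) →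
      ∃ i, c * a ^ n ≤ ∫ y in ball x (5 * a), |σ i y| ∂ν := by
  have hω := unitVol_pos (n + 1)
  set ω := unitVol (n + 1) with hωd
  set c := ω / (64 * (n + 1) * 2 ^ (n + 1)) with hc
  have hc0 : 0 < c := by positivity
  refine ⟨c, hc0, ?_⟩
  intro ν E hE σ hσ x a ha h1 h2
  by_contra! hcon
  have hm : ∀ t : ℝ, |t| ≤ 2 * a → ∀ i : Fin (n + 1),
      volume {w | w ∈ E ∩ ball x (3 * a) ∧ w + t • axis i ∉ E} ≤ ENNReal.ofReal (2 * c * a ^ (n + 1)) := by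
    intro t ht i
    refine ENNReal.le_ofReal_iff_toReal_le (ne_top_of_le_ne_top (measure_ball_lt_top (x := x) (r := 3 * a)).ne
      (measure_mono fun w hw => hw.1.2)) (by positivity) |>.2 ?_
    refine ((hσ i).volume_leave_le hE x ha ht).trans ?_
    have := (hcon i).le
    calc 2 * a * ∫ y in ball x (5 * a), |σ i y| ∂ν ≤ 2 * a * (c * a ^ n) := by gcongr
      _ = _ := by ring
  have hlt : ENNReal.ofReal ((n + 1) * (2 * c * a ^ (n + 1))) * volume (ball (0 : Pt (n + 1)) (2 * a)) <
      volume (E ∩ ball x a) * volume (Eᶜ ∩ ball x a) := by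
    refine lt_of_lt_of_le ?_ (mul_le_mul' h1 h2)
    rw [volume_ball_eq _ ha, volume_ball_eq _ (by linarith : 0 < 2 * a), ← ENNReal.ofReal_mul (by positivity),
      ← ENNReal.ofReal_mul (by positivity), ← ENNReal.ofReal_mul (by positivity),
      ENNReal.ofReal_lt_ofReal_iff (by positivity), ← hωd, mul_pow]
    have e : (n + 1) * (2 * c * a ^ (n + 1)) * (2 ^ (n + 1) * a ^ (n + 1) * ω) =
        (a ^ (n + 1) * ω) ^ 2 / 32 := by
      rw [hc]; field_simp; norm_num
    rw [e]
    have : 0 < (a ^ (n + 1) * ω) ^ 2 := by positivity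
    nlinarith
  obtain ⟨h, hh, hlt'⟩ := exists_translation (hE.inter measurableSet_ball)
    (hE.compl.inter measurableSet_ball) inter_subset_right inter_subset_right hlt
  refine absurd hlt' (not_lt.2 ?_)
  have := volume_leave_sum_le (E := E) (x := x) hh (fun i => hm (h i) ?_ i) Finset.univ
  · rw [sum_smul_axis, Finset.card_univ, Fintype.card_fin] at this
    refine (measure_mono ?_).trans (this.trans (le_of_eq ?_))
    · rintro z ⟨hz, hz'⟩
      exact ⟨hz, hz'.1⟩
    · rw [ENNReal.ofReal_mul (p := (n : ℝ) + 1) (by positivity)]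
      congr 1
      rw [← Nat.cast_succ, ENNReal.ofReal_natCast]
  · exact (PiLp.norm_apply_le h i).trans hh

lemma one_add_pow_le {t : ℝ} (ht : 0 ≤ t) (ht1 : t ≤ 1) (N : ℕ) : (1 + t) ^ N ≤ 1 + 2 ^ N * t := by
  induction N with
  | zero => simpa using ht
  | succ N ih =>
    have h2 : (1 : ℝ) ≤ 2 ^ N := one_le_pow₀ (by norm_num)
    have : (1 + t) ^ N ≤ 2 ^ N := by
      refine pow_le_pow_left₀ (by linarith) (by linarith) N
    calc (1 + t) ^ (N + 1) = (1 + t) ^ N + (1 + t) ^ N * t := by ring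
      _ ≤ (1 + 2 ^ N * t) + 2 ^ N * t := by gcongr
      _ = _ := by ring

/-- Proportion of the ball `ball x a` filled by `E`. -/
def filling (E : Set (Pt N)) (a : ℝ) (x : Pt N) : ℝ :=
  volume.real (E ∩ ball x a) / volume.real (ball x a)

lemma volume_real_ball (x : Pt N) {a : ℝ} (ha : 0 < a) :
    volume.real (ball x a) = a ^ N * unitVol N := by
  rw [Measure.real, volume_ball_eq x ha, ENNReal.toReal_ofReal]
  have := unitVol_pos N
  positivity

lemma filling_le_one (E : Set (Pt N)) (a : ℝ) (x : Pt N) : filling E a x ≤ 1 :=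
  div_le_one_of_le₀ (measureReal_mono inter_subset_right measure_ball_lt_top.ne) measureReal_nonneg

lemma filling_nonneg (E : Set (Pt N)) (a : ℝ) (x : Pt N) : 0 ≤ filling E a x :=
  div_nonneg measureReal_nonneg measureReal_nonneg

lemma filling_compl {E : Set (Pt N)} (hE : MeasurableSet E) {a : ℝ} (ha : 0 < a) (x : Pt N) :
    filling Eᶜ a x = 1 - filling E a x := by
  have h0 : volume.real (ball x a) ≠ 0 := by
    rw [volume_real_ball x ha]
    have := unitVol_pos N
    positivity
  rw [filling, filling, eq_sub_iff_add_eq, ← add_div, div_eq_one_iff_eq h0, add_comm, inter_comm,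
    inter_comm _ (ball x a), ← sdiff_eq, measureReal_inter_add_sdiff hE]

lemma le_volume_inter_ball {E : Set (Pt N)} {a c : ℝ} (ha : 0 < a) (hc : 0 ≤ c) {x : Pt N}
    (h : c ≤ filling E a x) : ENNReal.ofReal c * volume (ball x a) ≤ volume (E ∩ ball x a) := by
  have h0 : 0 < volume.real (ball x a) := by
    rw [volume_real_ball x ha]
    have := unitVol_pos N
    positivity
  rw [filling, le_div_iff₀ h0] at h
  have h1 : volume (ball x a) ≠ ⊤ := measure_ball_lt_top.ne
  rw [← ofReal_measureReal (h := h1), ← ENNReal.ofReal_mul hc,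
    ← ofReal_measureReal (h := measure_ne_top_of_subset inter_subset_right h1)]
  exact ENNReal.ofReal_le_ofReal h

lemma filling_le_add (E : Set (Pt N)) {a : ℝ} (ha : 0 < a) (x y : Pt N) :
    filling E a y ≤ filling E a x + 2 ^ N / a * dist y x := by
  have h2 : (1 : ℝ) ≤ 2 ^ N := one_le_pow₀ (by norm_num)
  have hω := unitVol_pos N
  have hd : 0 ≤ dist y x := dist_nonneg
  rcases le_total a (dist y x) with h | h
  · have : 1 ≤ 2 ^ N / a * dist y x := by
      rw [div_mul_eq_mul_div, le_div_iff₀ ha]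
      nlinarith
    linarith [filling_le_one E a y, filling_nonneg E a x]
  · have hy := volume_real_ball y ha
    have hx := volume_real_ball x ha
    have hsub : E ∩ ball y a ⊆ (E ∩ ball x a) ∪ (ball x (a + dist y x) \ ball x a) := by
      rintro z ⟨hzE, hz⟩
      by_cases hzx : z ∈ ball x a
      · exact Or.inl ⟨hzE, hzx⟩
      · refine Or.inr ⟨?_, hzx⟩
        rw [mem_ball] at hz ⊢
        have := dist_triangle z y x
        linarith
    have hfin : volume (ball x (a + dist y x)) ≠ ⊤ := measure_ball_lt_top.ne
    have h3 : volume.real (E ∩ ball y a) ≤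
        volume.real (E ∩ ball x a) + volume.real (ball x (a + dist y x) \ ball x a) :=
      (measureReal_mono hsub (measure_union_lt_top
        (measure_ne_top_of_subset inter_subset_right (measure_ball_lt_top (x := x) (r := a)).ne).lt_top
        (measure_ne_top_of_subset sdiff_subset hfin).lt_top).ne).trans (measureReal_union_le _ _)
    rw [measureReal_sdiff (ball_subset_ball (by linarith)) measurableSet_ball
      measure_ball_lt_top.ne, volume_real_ball x ha, volume_real_ball x (by linarith)] at h3
    have h4 : (a + dist y x) ^ N ≤ a ^ N * (1 + 2 ^ N * (dist y x / a)) := by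
      have := one_add_pow_le (div_nonneg hd ha.le) ((div_le_one ha).2 h) N
      calc (a + dist y x) ^ N = a ^ N * (1 + dist y x / a) ^ N := by
            rw [← mul_pow]; congr 1; field_simp
        _ ≤ _ := by gcongr
    have haN : 0 < a ^ N * unitVol N := by positivity
    rw [filling, filling, hx, hy, div_add' _ _ _ haN.ne', div_le_div_iff_of_pos_right haN]
    refine h3.trans ?_
    have := mul_le_mul_of_nonneg_right h4 hω.le
    have e : 2 ^ N / a * dist y x = 2 ^ N * (dist y x / a) := by ring
    rw [e]
    nlinarith

lemma abs_filling_sub_le (E : Set (Pt N)) {a : ℝ} (ha : 0 < a) (x y : Pt N) :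
    |filling E a y - filling E a x| ≤ 2 ^ N / a * dist y x := by
  have h1 := filling_le_add E ha x y
  have h2 := filling_le_add E ha y x
  rw [dist_comm] at h2
  rw [abs_le]
  constructor <;> linarith

lemma continuous_filling (E : Set (Pt N)) {a : ℝ} (ha : 0 < a) : Continuous (filling E a) := by
  refine (LipschitzWith.of_dist_le_mul (K := (2 ^ N / a).toNNReal) fun y x => ?_).continuous
  rw [Real.coe_toNNReal _ (by positivity)]
  exact abs_filling_sub_le E ha x y

lemma tendsto_filling_of_densTendsto {E : Set (Pt N)} {x : Pt N} {l : ENNReal} (hl : l ≠ ⊤)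
    (h : densTendsto E x l) :
    Tendsto (fun a => filling E a x) (nhdsWithin 0 (Ioi 0)) (nhds l.toReal) := by
  refine ((ENNReal.tendsto_toReal hl).comp h).congr fun a => ?_
  simp [filling, Measure.real, ENNReal.toReal_div]

/-- If `filling` passes from above to below one half along a segment then it stays in
`[1/4, 3/4]` for a substantial time. -/
lemma le_volume_intermediate (E : Set (Pt N)) {a : ℝ} (ha : 0 < a) {z d : Pt N} (hd : d ≠ 0)
    (had : a ≤ 2 ^ N * ‖d‖) (h0 : 1 / 2 < filling E a z) (h1 : filling E a (z + d) < 1 / 2) :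
    ENNReal.ofReal (a / (2 ^ (N + 1) * ‖d‖)) ≤
      volume (Icc (-1 : ℝ) 2 ∩ {t | filling E a (z + t • d) ∈ Icc (1 / 4) (3 / 4 : ℝ)}) := by
  have hd' : 0 < ‖d‖ := norm_pos_iff.2 hd
  have hcont : Continuous fun t : ℝ => filling E a (z + t • d) :=
    (continuous_filling E ha).comp (by fun_prop)
  obtain ⟨t, ht, hft⟩ := intermediate_value_Icc' zero_le_one hcont.continuousOn
    (show (1 / 2 : ℝ) ∈ _ from ⟨by simpa using h1.le, by simpa using h0.le⟩)
  set r := a / (2 ^ (N + 2) * ‖d‖) with hr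
  have hr0 : 0 < r := by positivity
  have hr1 : r ≤ 1 := by
    rw [hr, div_le_one (by positivity)]
    refine had.trans ?_
    gcongr <;> norm_num
  have e : a / (2 ^ (N + 1) * ‖d‖) = (t + r) - (t - r) := by
    rw [hr]; field_simp; ring
  rw [e, ← Real.volume_Icc]
  refine measure_mono fun s hs => ?_
  refine ⟨⟨by linarith [hs.1, ht.1], by linarith [hs.2, ht.2]⟩, ?_⟩
  have := abs_filling_sub_le E ha (z + t • d) (z + s • d)
  simp only at hft
  rw [hft] at this
  have h3 : 2 ^ N / a * dist (z + s • d) (z + t • d) ≤ 1 / 4 := by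
    rw [dist_add_left, dist_eq_norm, ← sub_smul, norm_smul, Real.norm_eq_abs]
    have h4 : |s - t| ≤ r := abs_le.2 ⟨by linarith [hs.1], by linarith [hs.2]⟩
    calc 2 ^ N / a * (|s - t| * ‖d‖) ≤ 2 ^ N / a * (r * ‖d‖) := by gcongr
      _ = 1 / 4 := by rw [hr]; field_simp; ring
  rw [abs_le] at this
  simp only [mem_ofPred_eq, mem_Icc]
  constructor <;> linarith [this.1, this.2]

/-- Between the points of `S ⊆ E` and their translates outside of `E` there are many points at
which `E` and its complement are both substantial. -/
lemma exists_le_volume_intermediate {E : Set (Pt N)} (hE : MeasurableSet E) {S U : Set (Pt N)}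
    (hS : MeasurableSet S) (hS0 : volume S ≠ 0) (hSt : volume S ≠ ⊤) {d : Pt N} (hd : d ≠ 0)
    (hSE : S ⊆ E) (hSd : ∀ z ∈ S, z + d ∉ E) (hU : MeasurableSet U)
    (hSU : ∀ z ∈ S, ∀ t ∈ Icc (-1 : ℝ) 2, z + t • d ∈ U) :
    ∃ c > 0, ∃ a₀ > 0, ∀ a, 0 < a → a < a₀ → ENNReal.ofReal (c * a) ≤
      volume (filling E a ⁻¹' Icc (1 / 4) (3 / 4) ∩ U) := by
  have hd' : 0 < ‖d‖ := norm_pos_iff.2 hd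
  set S' : ℝ → Set (Pt N) := fun a => S ∩ {z | 1 / 2 < filling E a z ∧ filling E a (z + d) < 1 / 2}
    with hS'
  have hS'm : ∀ a, 0 < a → MeasurableSet (S' a) := by
    intro a ha
    have h1 := continuous_filling E ha
    have h2 : Continuous fun z => filling E a (z + d) := h1.comp (by fun_prop)
    exact hS.inter ((isOpen_lt continuous_const h1).inter (isOpen_lt h2 continuous_const)).measurableSet
  have hae : ∀ᵐ z, z ∈ S → ∀ᶠ a in nhdsWithin (0 : ℝ) (Ioi 0), z ∈ S' a := by
    have h1 := ae_mem_extr_iff hE.compl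
    have h2 := (measurePreserving_add_right volume d).quasiMeasurePreserving.ae (ae_mem_extr_iff hE)
    filter_upwards [h1, h2] with z hz1 hz2 hzS
    have hz1' := hz1.2 (fun h => h (hSE hzS))
    have hz2' := hz2.2 (hSd z hzS)
    have t1 := tendsto_filling_of_densTendsto ENNReal.zero_ne_top hz1'
    have t2 := tendsto_filling_of_densTendsto ENNReal.zero_ne_top hz2'
    filter_upwards [t1.eventually_lt_const (show (0 : ENNReal).toReal < 1 / 2 by norm_num),
      t2.eventually_lt_const (show (0 : ENNReal).toReal < 1 / 2 by norm_num), self_mem_nhdsWithin]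
      with a h1 h2 ha
    rw [filling_compl hE ha] at h1
    exact ⟨hzS, by linarith, h2⟩
  have hlim : Tendsto (fun a => volume (S' a)) (nhdsWithin (0 : ℝ) (Ioi 0)) (nhds (volume S)) := by
    have := tendsto_lintegral_filter_of_dominated_convergence (μ := volume)
      (l := nhdsWithin (0 : ℝ) (Ioi 0)) (F := fun a => (S' a).indicator fun _ => (1 : ENNReal))
      (f := S.indicator fun _ => (1 : ENNReal)) (S.indicator fun _ => (1 : ENNReal)) ?_ ?_ ?_ ?_
    · rw [lintegral_indicator_const hS, one_mul] at this
      refine this.congr' ?_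
      filter_upwards [self_mem_nhdsWithin] with a ha
      rw [lintegral_indicator_const (hS'm a ha), one_mul]
    · filter_upwards [self_mem_nhdsWithin] with a ha
      exact measurable_const.indicator (hS'm a ha)
    · exact Eventually.of_forall fun a => Eventually.of_forall fun z =>
        indicator_le_indicator_of_subset inter_subset_left (fun _ => zero_le) z
    · rw [lintegral_indicator_const hS, one_mul]
      exact hSt
    · filter_upwards [hae] with z hz
      by_cases hzS : z ∈ S
      · refine tendsto_const_nhds.congr' ?_
        filter_upwards [hz hzS] with a ha
        rw [indicator_of_mem ha, indicator_of_mem hzS]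
      · refine tendsto_const_nhds.congr' (Eventually.of_forall fun a => ?_)
        simp only
        rw [indicator_of_notMem hzS, indicator_of_notMem fun h : z ∈ S' a => hzS h.1]
  have hhalf : volume S / 2 < volume S := ENNReal.half_lt_self hS0 hSt
  have hev := hlim.eventually_const_lt hhalf
  obtain ⟨a₁, ha₁, hev⟩ := mem_nhdsGT_iff_exists_Ioo_subset.1 hev
  have hv : 0 < volume.real S := ENNReal.toReal_pos hS0 hSt
  refine ⟨volume.real S / 2 / (2 ^ (N + 1) * ‖d‖) / 3, by positivity, min a₁ (2 ^ N * ‖d‖),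
    lt_min ha₁ (by positivity), fun a ha haa => ?_⟩
  have hcont := continuous_filling E ha
  set W := filling E a ⁻¹' Icc (1 / 4) (3 / 4) ∩ U with hW
  have hWm : MeasurableSet W := (isClosed_Icc.preimage hcont).measurableSet.inter hU
  have key : volume (S' a) * ENNReal.ofReal (a / (2 ^ (N + 1) * ‖d‖)) ≤ 3 * volume W := by
    have hPm : MeasurableSet {p : Pt N × ℝ | p.1 ∈ S' a ∧ p.2 ∈ Icc (-1 : ℝ) 2 ∧ p.1 + p.2 • d ∈ W} :=
      ((hS'm a ha).preimage measurable_fst).inter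
        ((measurableSet_Icc.preimage measurable_snd).inter (hWm.preimage (by fun_prop)))
    calc volume (S' a) * ENNReal.ofReal (a / (2 ^ (N + 1) * ‖d‖))
        = ∫⁻ z in S' a, ENNReal.ofReal (a / (2 ^ (N + 1) * ‖d‖)) := by
          rw [setLIntegral_const, mul_comm]
      _ ≤ ∫⁻ z in S' a, volume (Prod.mk z ⁻¹'
            {p : Pt N × ℝ | p.1 ∈ S' a ∧ p.2 ∈ Icc (-1 : ℝ) 2 ∧ p.1 + p.2 • d ∈ W}) := by
          refine setLIntegral_mono' (hS'm a ha) fun z hz => ?_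
          refine (le_volume_intermediate E ha hd (haa.trans_le (min_le_right _ _)).le hz.2.1
            hz.2.2).trans (measure_mono ?_)
          rintro t ⟨ht, htf⟩
          exact ⟨hz, ht, htf, hSU z hz.1 t ht⟩
      _ ≤ ∫⁻ z, volume (Prod.mk z ⁻¹'
            {p : Pt N × ℝ | p.1 ∈ S' a ∧ p.2 ∈ Icc (-1 : ℝ) 2 ∧ p.1 + p.2 • d ∈ W}) :=
          setLIntegral_le_lintegral _ _
      _ = ∫⁻ t, volume ((fun z => (z, t)) ⁻¹'
            {p : Pt N × ℝ | p.1 ∈ S' a ∧ p.2 ∈ Icc (-1 : ℝ) 2 ∧ p.1 + p.2 • d ∈ W}) := by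
          rw [← Measure.prod_apply hPm, Measure.prod_apply_symm hPm]
      _ ≤ ∫⁻ t, (Icc (-1 : ℝ) 2).indicator (fun _ => volume W) t := by
          refine lintegral_mono fun t => ?_
          by_cases ht : t ∈ Icc (-1 : ℝ) 2
          · rw [indicator_of_mem ht, ← measure_preimage_add_right volume (t • d) W]
            exact measure_mono fun z hz => hz.2.2
          · rw [indicator_of_notMem ht, show (fun z => (z, t)) ⁻¹' _ = (∅ : Set (Pt N)) from ?_,
              measure_empty]
            exact eq_empty_of_forall_notMem fun z hz => ht hz.2.1
      _ = 3 * volume W := by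
          rw [lintegral_indicator_const measurableSet_Icc, Real.volume_Icc, mul_comm]
          norm_num
  have h1 : volume S / 2 ≤ volume (S' a) := (hev ⟨ha, haa.trans_le (min_le_left _ _)⟩ : _ < _).le
  have h2 : ENNReal.ofReal (volume.real S / 2) ≤ volume (S' a) := by
    rwa [ENNReal.ofReal_div_of_pos two_pos, ofReal_measureReal hSt, ENNReal.ofReal_ofNat]
  have h3 := (mul_le_mul_left h2 _).trans key
  rw [← ENNReal.ofReal_mul (by positivity)] at h3
  rw [← ENNReal.mul_le_mul_iff_right (a := 3) (by simp) (by simp)]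
  refine le_trans (le_of_eq ?_) h3
  rw [← ENNReal.ofReal_ofNat 3, ← ENNReal.ofReal_mul (by positivity)]
  congr 1
  field_simp

/-- Balls with large measure have centers in a small set. -/
lemma volume_heavy_le {μ : Measure (Pt N)} [SFinite μ] {r m M b : ℝ} (hr : 0 < r) (hm : 0 < m)
    (hM : μ univ ≤ ENNReal.ofReal M) (h : r ^ N * unitVol N * M ≤ m * b) :
    volume {x | ENNReal.ofReal m ≤ μ (ball x r)} ≤ ENNReal.ofReal b := by
  have hP : MeasurableSet {p : Pt N × Pt N | dist p.2 p.1 < r} :=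
    measurableSet_lt (by fun_prop) measurable_const
  have hball : ∀ x, μ (ball x r) = μ (Prod.mk x ⁻¹' {p : Pt N × Pt N | dist p.2 p.1 < r}) :=
    fun x => rfl
  have hmeas : Measurable fun x => μ (ball x r) := measurable_measure_prodMk_left hP
  have h1 := mul_meas_ge_le_lintegral (μ := volume) hmeas (ENNReal.ofReal m)
  have h2 : ∫⁻ x, μ (ball x r) = volume (ball (0 : Pt N) r) * μ univ := by
    simp only [hball]
    rw [← Measure.prod_apply hP, Measure.prod_apply_symm hP, ← setLIntegral_univ, ← setLIntegral_const]
    refine lintegral_congr fun y => ?_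
    rw [volume_ball_center_eq 0 y r]
    congr 1
    ext x
    simp [dist_comm]
  have hω := unitVol_pos N
  have h3 : ENNReal.ofReal m * volume {x | ENNReal.ofReal m ≤ μ (ball x r)} ≤
      ENNReal.ofReal m * ENNReal.ofReal b := by
    refine h1.trans ?_
    rw [h2, volume_ball_eq 0 hr, ← ENNReal.ofReal_mul hm.le]
    refine (mul_le_mul_right hM _).trans ?_
    rw [← ENNReal.ofReal_mul (by positivity)]
    exact ENNReal.ofReal_le_ofReal h
  exact (ENNReal.mul_le_mul_iff_right (ENNReal.ofReal_pos.2 hm).ne' ENNReal.ofReal_ne_top).1 h3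

/-- Centers of small balls in which `ν` is not concentrated, one of the densities is not small, and
this density is almost constant. -/
theorem exists_good_points {ν : Measure (Pt (n + 1))} [IsFiniteMeasure ν] [ν.Regular] {E : Set (Pt (n + 1))}
    (hE : MeasurableSet E) {σ : Fin (n + 1) → Pt (n + 1) → ℝ} (hσ : ∀ i, IsDensity ν E i (σ i))
    {S U : Set (Pt (n + 1))}
    (hS : MeasurableSet S) (hS0 : volume S ≠ 0) (hSt : volume S ≠ ⊤) {d : Pt (n + 1)} (hd : d ≠ 0)
    (hSE : S ⊆ E) (hSd : ∀ z ∈ S, z + d ∉ E) (hU : MeasurableSet U)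
    (hSU : ∀ z ∈ S, ∀ t ∈ Icc (-1 : ℝ) 2, z + t • d ∈ U) :
    ∃ c > 0, ∃ K > 0, ∀ δ > 0, ∃ a₀ > 0, ∀ a, 0 < a → a < a₀ → ∃ x ∈ U, ∃ i, ∃ s : ℝ,
      c * a ^ n ≤ ∫ y in ball x (5 * a), |σ i y| ∂ν ∧
      ν.real (ball x (10 * a)) ≤ K * a ^ n ∧
      ∫ y in ball x (10 * a), |σ i y - s| ∂ν ≤ δ * a ^ n := by
  obtain ⟨c, hc, hiso⟩ := exists_isoperimetric n
  obtain ⟨c₀, hc₀, a₁, ha₁, hvol⟩ := exists_le_volume_intermediate hE hS hS0 hSt hd hSE hSd hU hSU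
  have hω := unitVol_pos (n + 1)
  set Q := 10 ^ (n + 1) * unitVol (n + 1) with hQ
  have hQ0 : 0 < Q := by positivity
  have hν0 : 0 ≤ ν.real univ := measureReal_nonneg
  set K := 4 * Q * (ν.real univ + 1) / c₀ with hK
  have hK0 : 0 < K := by positivity
  refine ⟨c, hc, K, hK0, fun δ hδ => ?_⟩
  set θ := δ / 2 * c₀ / (4 * (n + 1)) / Q with hθ
  have hθ0 : 0 < θ := by positivity
  choose h hcs hint hcont hhi using fun i =>
    (hσ i).integrable.exists_hasCompactSupport_integral_sub_le hθ0
  have huc : ∀ i, ∃ r > 0, ∀ x y, dist y x < r → |h i y - h i x| < δ / (2 * K) := by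
    intro i
    obtain ⟨r, hr, H⟩ := Metric.uniformContinuous_iff.1
      ((hcont i).uniformContinuous_of_tendsto_cocompact (hcs i).is_zero_at_infty)
      (δ / (2 * K)) (by positivity)
    exact ⟨r, hr, fun x y hxy => H hxy⟩
  choose r hr hosc using huc
  obtain ⟨r₀, hr₀, hr₀r⟩ : ∃ r₀ > 0, ∀ i, r₀ ≤ r i :=
    ⟨Finset.univ.inf' Finset.univ_nonempty r, (Finset.lt_inf'_iff _).2 fun i _ => hr i,
      fun i => Finset.inf'_le _ (Finset.mem_univ i)⟩
  refine ⟨min a₁ (r₀ / 10), lt_min ha₁ (by positivity), fun a ha haa => ?_⟩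
  have ha1 := haa.trans_le (min_le_left _ _)
  have ha2 := haa.trans_le (min_le_right _ _)
  set μ : Fin (n + 1) → Measure (Pt (n + 1)) := fun i =>
    ν.withDensity fun y => ENNReal.ofReal |σ i y - h i y| with hμ
  have hsub : ∀ i, Integrable (fun y => |σ i y - h i y|) ν := fun i =>
    ((hσ i).integrable.sub (hhi i)).abs
  have hμball : ∀ i (s : Set (Pt (n + 1))), MeasurableSet s → μ i s = ENNReal.ofReal (∫ y in s, |σ i y - h i y| ∂ν) := by
    intro i s hs
    rw [hμ, withDensity_apply _ hs, ofReal_integral_eq_lintegral_ofReal (hsub i).integrableOn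
      (Eventually.of_forall fun _ => abs_nonneg _)]
  set B₁ := {x | ENNReal.ofReal (K * a ^ n) ≤ ν (ball x (10 * a))} with hB₁
  set B₂ : Fin (n + 1) → Set (Pt (n + 1)) := fun i =>
    {x | ENNReal.ofReal (δ / 2 * a ^ n) ≤ μ i (ball x (10 * a))} with hB₂
  have hv1 : volume B₁ ≤ ENNReal.ofReal (c₀ * a / 4) := by
    refine volume_heavy_le (M := ν.real univ) (by positivity) (by positivity)
      (ofReal_measureReal (measure_ne_top _ _)).ge ?_
    calc (10 * a) ^ (n + 1) * unitVol (n + 1) * ν.real univ = Q * a ^ (n + 1) * ν.real univ := by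
          rw [hQ]; ring
      _ ≤ Q * a ^ (n + 1) * (ν.real univ + 1) := by gcongr; linarith
      _ = _ := by rw [hK]; field_simp; ring
  have hv2 : ∀ i, volume (B₂ i) ≤ ENNReal.ofReal (c₀ * a / (4 * (n + 1))) := by
    intro i
    have : IsFiniteMeasure (μ i) := isFiniteMeasure_withDensity_ofReal (hsub i).2
    refine volume_heavy_le (M := θ) (by positivity) (by positivity) ?_ ?_
    · rw [hμball i _ MeasurableSet.univ, setIntegral_univ]
      exact ENNReal.ofReal_le_ofReal (hint i)
    · refine le_of_eq ?_
      rw [hθ, mul_pow, hQ]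
      field_simp
      ring
  have hlt : volume (B₁ ∪ ⋃ i, B₂ i) < volume (filling E a ⁻¹' Icc (1 / 4) (3 / 4) ∩ U) := by
    refine lt_of_lt_of_le ?_ (hvol a ha ha1)
    refine ((measure_union_le _ _).trans (add_le_add hv1 ((measure_iUnion_fintype_le _ _).trans
      (Finset.sum_le_sum fun i _ => hv2 i)))).trans_lt ?_
    rw [Finset.sum_const, Finset.card_univ, Fintype.card_fin, ← ENNReal.ofReal_nsmul,
      ← ENNReal.ofReal_add (by positivity) (by positivity), ENNReal.ofReal_lt_ofReal_iff (by positivity),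
      nsmul_eq_mul]
    have e : ((n + 1 : ℕ) : ℝ) * (c₀ * a / (4 * (n + 1))) = c₀ * a / 4 := by
      push_cast; field_simp
    rw [e]
    have : 0 < c₀ * a := by positivity
    linarith
  obtain ⟨x, ⟨hx1, hxU⟩, hx2⟩ : ∃ x ∈ filling E a ⁻¹' Icc (1 / 4) (3 / 4) ∩ U, x ∉ B₁ ∪ ⋃ i, B₂ i := by
    by_contra! hcon
    exact absurd (measure_mono hcon) (not_le.2 hlt)
  simp only [mem_union, mem_iUnion, not_or, not_exists] at hx2
  obtain ⟨i, hi⟩ := hiso hE hσ x ha (le_volume_inter_ball ha (by norm_num) hx1.1)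
    (le_volume_inter_ball ha (by norm_num)
      (by rw [filling_compl hE ha]; linarith [hx1.2] : (1 / 4 : ℝ) ≤ filling Eᶜ a x))
  have hν : ν.real (ball x (10 * a)) ≤ K * a ^ n := by
    have : ν (ball x (10 * a)) ≤ ENNReal.ofReal (K * a ^ n) := (not_le.1 fun h => hx2.1 h).le
    exact ENNReal.toReal_le_of_le_ofReal (by positivity) this
  refine ⟨x, hxU, i, h i x, hi, hν, ?_⟩
  have hxi : μ i (ball x (10 * a)) ≤ ENNReal.ofReal (δ / 2 * a ^ n) :=
    (not_le.1 fun h => hx2.2 i h).le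
  rw [hμball i _ measurableSet_ball, ENNReal.ofReal_le_ofReal_iff (by positivity)] at hxi
  have hosc' : ∀ y ∈ ball x (10 * a), |h i y - h i x| ≤ δ / (2 * K) := fun y hy =>
    (hosc i x y (lt_of_lt_of_le (mem_ball.1 hy) (by have := hr₀r i; linarith))).le
  calc ∫ y in ball x (10 * a), |σ i y - h i x| ∂ν
      ≤ ∫ y in ball x (10 * a), (|σ i y - h i y| + δ / (2 * K)) ∂ν := by
        refine setIntegral_mono_on ((hσ i).integrable.sub (integrable_const _)).abs.integrableOn
          ((hsub i).add (integrable_const _)).integrableOn measurableSet_ball fun y hy => ?_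
        have := abs_sub_le (σ i y) (h i y) (h i x)
        have := hosc' y hy
        linarith
    _ = (∫ y in ball x (10 * a), |σ i y - h i y| ∂ν) + ν.real (ball x (10 * a)) * (δ / (2 * K)) := by
        rw [integral_add (hsub i).integrableOn (integrable_const _), setIntegral_const, smul_eq_mul]
    _ ≤ δ / 2 * a ^ n + K * a ^ n * (δ / (2 * K)) := by gcongr
    _ = δ * a ^ n := by field_simp; ring

section

/-- Smooth cutoff functions between the balls of radii `5 * a` and `10 * a`. -/
structure IsCutoff (L : ℝ) (x : Pt N) (a : ℝ) (ψ : Pt N → ℝ) : Prop where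
  nonneg : ∀ y, 0 ≤ ψ y
  le_one : ∀ y, ψ y ≤ 1
  eq_one : ∀ y ∈ ball x (5 * a), ψ y = 1
  eq_zero : ∀ y ∉ ball x (10 * a), ψ y = 0
  diff : Differentiable ℝ ψ
  lip : ∀ y z, |ψ y - ψ z| ≤ L / a * dist y z

lemma exists_isCutoff (N : ℕ) : ∃ L > 0, ∀ (x : Pt N) (a : ℝ), 0 < a → ∃ ψ, IsCutoff L x a ψ := by
  let ψ₁ : ContDiffBump (0 : Pt N) := ⟨5, 10, by norm_num, by norm_num⟩
  obtain ⟨L, hL⟩ := ContDiff.lipschitzWith_of_hasCompactSupport (𝕂 := ℝ) ψ₁.hasCompactSupport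
    (ψ₁.contDiff (n := 1)) (by simp)
  refine ⟨L + 1, by positivity, fun x a ha => ⟨fun y => ψ₁ (a⁻¹ • (y - x)), fun y => ψ₁.nonneg,
    fun y => ψ₁.le_one, fun y hy => ?_, fun y hy => ?_, ?_, fun y z => ?_⟩⟩
  · refine ψ₁.one_of_mem_closedBall ?_
    rw [mem_ball, dist_eq_norm] at hy
    rw [mem_closedBall_zero_iff, norm_smul, norm_inv, Real.norm_of_nonneg ha.le,
      inv_mul_le_iff₀ ha, mul_comm]
    exact hy.le
  · refine ψ₁.zero_of_le_dist ?_
    rw [mem_ball, dist_eq_norm, not_lt] at hy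
    rw [dist_zero_right, norm_smul, norm_inv, Real.norm_of_nonneg ha.le, le_inv_mul_iff₀ ha,
      mul_comm]
    exact hy
  · exact ((ψ₁.contDiff (n := 1)).differentiable (by simp)).comp (by fun_prop)
  · have h1 := hL.dist_le_mul (a⁻¹ • (y - x)) (a⁻¹ • (z - x))
    rw [Real.dist_eq, dist_smul₀, dist_sub_right, norm_inv, Real.norm_of_nonneg ha.le] at h1
    refine h1.trans ?_
    have : 0 ≤ a⁻¹ * dist y z := by positivity
    calc (L : ℝ) * (a⁻¹ * dist y z) ≤ (L + 1) * (a⁻¹ * dist y z) := by gcongr; linarith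
      _ = _ := by ring

variable {L a : ℝ} {x : Pt N} {ψ : Pt N → ℝ}

lemma IsCutoff.isShear (hψ : IsCutoff L x a ψ) {s : ℝ} (hL : 0 ≤ L / a)
    (hs : |s| * (L / a) ≤ 1 / 2) : IsShear (|s| * (L / a)).toNNReal fun y => s * ψ y := by
  have h0 : 0 ≤ |s| * (L / a) := by positivity
  refine ⟨LipschitzWith.of_dist_le_mul fun y z => ?_, ?_, hψ.diff.const_mul s, |s|, fun y => ?_⟩
  · rw [Real.coe_toNNReal _ h0, Real.dist_eq, ← mul_sub, abs_mul, mul_assoc]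
    exact mul_le_mul_of_nonneg_left (hψ.lip y z) (abs_nonneg s)
  · rw [Real.toNNReal_le_iff_le_coe]
    simpa using hs
  · rw [abs_mul, abs_of_nonneg (hψ.nonneg y)]
    exact mul_le_of_le_one_right (abs_nonneg s) (hψ.le_one y)

lemma intervalIntegrable_of_abs_le {h : ℝ → ℝ} (hm : Measurable h) {M : ℝ} (hM : ∀ t, |h t| ≤ M)
    (b c : ℝ) : IntervalIntegrable h volume b c :=
  (intervalIntegrable_const (c := M)).mono_fun hm.aestronglyMeasurable
    (Eventually.of_forall fun t => (hM t).trans (le_abs_self M))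

variable {i : Fin N} {η : Pt N → ℝ} {m M : ℝ}

lemma abs_sweep_sub_le (hη : Measurable η) (hM : ∀ y, |η y| ≤ M) (u v : Pt N → ℝ) (y : Pt N) :
    |sweep i u η y - sweep i v η y| ≤ M * |u y - v y| := by
  have hm : Measurable fun τ : ℝ => η (y + τ • axis i) := by fun_prop
  have hI := intervalIntegrable_of_abs_le hm fun t => hM _
  rw [sweep, sweep, intervalIntegral.integral_interval_sub_left (hI _ _) (hI _ _)]
  exact intervalIntegral.norm_integral_le_of_norm_le_const (f := fun τ => η (y + τ • axis i))
    fun τ _ => hM _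

/-- Bounds for `sweep` when the displacement is a multiple of a cutoff function. -/
lemma IsCutoff.sweep_bounds (hψ : IsCutoff L x a ψ) (hη : Measurable η) (hM : ∀ y, |η y| ≤ M)
    (hm : ∀ y ∈ ball x (11 * a), m ≤ η y) {s : ℝ} (hs : 0 ≤ s) (hsa : s ≤ a)
    (y : Pt N) :
    m * (s * ψ y) ≤ sweep i (fun y => s * ψ y) η y ∧
      sweep i (fun y => -s * ψ y) η y ≤ -(m * (s * ψ y)) := by
  by_cases hy : y ∈ ball x (10 * a)
  · have hm' : Measurable fun τ : ℝ => η (y + τ • axis i) := by fun_prop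
    have hI := intervalIntegrable_of_abs_le hm' fun t => hM _
    have h0 : 0 ≤ s * ψ y := mul_nonneg hs (hψ.nonneg y)
    have h1 : s * ψ y ≤ a := (mul_le_of_le_one_right hs (hψ.le_one y)).trans hsa
    have hle : ∀ τ, |τ| ≤ a → m ≤ η (y + τ • axis i) := by
      intro τ hτ
      refine hm _ ?_
      rw [mem_ball] at hy ⊢
      have h2 : dist (y + τ • axis i) y = |τ| := by
        rw [dist_self_add_left, norm_smul, norm_axis, mul_one, Real.norm_eq_abs]
      have := dist_triangle (y + τ • axis i) y x
      linarith
    constructor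
    · have := intervalIntegral.integral_mono_on (f := fun _ => m) h0 intervalIntegrable_const (hI _ _)
        fun τ hτ => hle τ (abs_le.2 ⟨by linarith [hτ.1], by linarith [hτ.2]⟩)
      rw [intervalIntegral.integral_const, smul_eq_mul, sub_zero] at this
      rw [sweep]
      linarith
    · have := intervalIntegral.integral_mono_on (f := fun _ => m) (neg_nonpos.2 h0)
        intervalIntegrable_const (hI _ _)
        fun τ hτ => hle τ (abs_le.2 ⟨by linarith [hτ.1], by linarith [hτ.2]⟩)
      rw [intervalIntegral.integral_const, smul_eq_mul, sub_neg_eq_add, zero_add] at this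
      rw [sweep, intervalIntegral.integral_symm, neg_mul]
      linarith
  · simp [sweep, hψ.eq_zero y hy]

/-- A function which is almost a nonnegative constant has a large integral against a
nonnegative weight. -/
lemma le_integral_mul_of_nonneg {X : Type*} [MeasurableSpace X] {ν : Measure X}
    {σ p : X → ℝ} (hσ : Integrable σ ν) (hp : Integrable (fun y => p y * σ y) ν) {A B : Set X}
    (hA : MeasurableSet A) (hB : MeasurableSet B) (hBf : ν B ≠ ⊤) {b C ς : ℝ} (hς : 0 ≤ ς)
    (hp0 : ∀ y, 0 ≤ p y) (hpA : ∀ y ∈ A, b ≤ p y) (hpC : ∀ y, p y ≤ C)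
    (hpB : ∀ y ∉ B, p y = 0) :
    b * (∫ y in A, |σ y| ∂ν) - 2 * C * ∫ y in B, |σ y - ς| ∂ν ≤ ∫ y, p y * σ y ∂ν := by
  have h1 : IntegrableOn (fun y => 2 * C * |σ y - ς|) B ν :=
    (hσ.integrableOn.sub (integrableOn_const hBf)).abs.const_mul _
  rw [← integral_const_mul, ← integral_const_mul, ← integral_indicator hA, ← integral_indicator hB,
    ← integral_sub ((hσ.abs.const_mul b).indicator hA) (h1.integrable_indicator hB)]
  refine integral_mono (((hσ.abs.const_mul b).indicator hA).sub
    (h1.integrable_indicator hB)) hp fun y => ?_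
  have h2 : p y * |σ y| - 2 * (p y * |σ y - ς|) ≤ p y * σ y := by
    have h3 : |σ y| - 2 * |σ y - ς| ≤ σ y := by
      rcases abs_cases (σ y) with h | h <;> rcases abs_cases (σ y - ς) with h' | h' <;> linarith
    nlinarith [hp0 y]
  refine le_trans ?_ h2
  have h4 : A.indicator (fun y => b * |σ y|) y ≤ p y * |σ y| := by
    by_cases hy : y ∈ A
    · rw [indicator_of_mem hy]
      exact mul_le_mul_of_nonneg_right (hpA y hy) (abs_nonneg _)
    · rw [indicator_of_notMem hy]
      exact mul_nonneg (hp0 y) (abs_nonneg _)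
  have h5 : 2 * (p y * |σ y - ς|) ≤ B.indicator (fun y => 2 * C * |σ y - ς|) y := by
    by_cases hy : y ∈ B
    · rw [indicator_of_mem hy, ← mul_assoc]
      exact mul_le_mul_of_nonneg_right (by linarith [hpC y]) (abs_nonneg _)
    · rw [indicator_of_notMem hy, hpB y hy]
      simp
  linarith

/-- Small displacements along an axis realize all small values of the volume change. -/
theorem IsCutoff.exists_integral_sweep_eq {ν : Measure (Pt N)} [IsFiniteMeasure ν] {σ : Pt N → ℝ}
    (hσ : Integrable σ ν) (hψ : IsCutoff L x a ψ) (ha : 0 < a) (hL : 0 < L) (hη : Measurable η)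
    (hM : ∀ y, |η y| ≤ M) (hM0 : ∀ y, M < ‖y‖ → η y = 0)
    (hm0 : 0 ≤ m) (hm : ∀ y ∈ ball x (11 * a), m ≤ η y) {c δ V ς : ℝ}
    (h5 : c * V ≤ ∫ y in ball x (5 * a), |σ y| ∂ν)
    (h10 : ∫ y in ball x (10 * a), |σ y - ς| ∂ν ≤ δ * V) (hδ : 4 * M * δ ≤ m * c) (hV : 0 ≤ V)
    {s : ℝ} (hs0 : 0 ≤ s) (hsa : s ≤ a) (hs : s * (L / a) ≤ 1 / 2) {e : ℝ}
    (he : |e| ≤ m * c / 2 * V * s) :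
    ∃ t, |t| ≤ s ∧ ∫ y, sweep i (fun y => t * ψ y) η y * σ y ∂ν = e := by
  have hM' : 0 ≤ M := (abs_nonneg _).trans (hM 0)
  have hLa : 0 ≤ L / a := by positivity
  have hshear : ∀ t, |t| ≤ s → IsShear (|t| * (L / a)).toNNReal fun y => t * ψ y := fun t ht =>
    hψ.isShear hLa ((mul_le_mul_of_nonneg_right ht hLa).trans hs)
  set W : ℝ → ℝ := fun t => ∫ y, sweep i (fun y => t * ψ y) η y * σ y ∂ν with hW
  have hle : ∀ t y, |sweep i (fun y => t * ψ y) η y| ≤ M * |t| := fun t y => by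
    refine (abs_sweep_le hM y).trans ?_
    rw [abs_mul, abs_of_nonneg (hψ.nonneg y)]
    exact mul_le_mul_of_nonneg_left (mul_le_of_le_one_right (abs_nonneg t) (hψ.le_one y)) hM'
  have hmeas : ∀ t, |t| ≤ s → Measurable (sweep i (fun y => t * ψ y) η) := fun t ht =>
    ((hshear t ht).isTestPair i hη hM hM0).measurable_fst
  have hint : ∀ t, |t| ≤ s → Integrable (fun y => sweep i (fun y => t * ψ y) η y * σ y) ν :=
    fun t ht => hσ.bdd_mul (hmeas t ht).aestronglyMeasurable (Eventually.of_forall (hle t))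
  have hcont : ContinuousOn W (Icc (-s) s) := by
    refine (LipschitzOnWith.of_dist_le_mul (K := (M * ∫ y, |σ y| ∂ν).toNNReal)
      fun t ht t' ht' => ?_).continuousOn
    have hσ0 : 0 ≤ ∫ y, |σ y| ∂ν := integral_nonneg fun _ => abs_nonneg _
    rw [Real.coe_toNNReal _ (by positivity), Real.dist_eq, hW]
    simp only
    rw [← integral_sub (hint t (abs_le.2 ht)) (hint t' (abs_le.2 ht'))]
    refine abs_integral_le_integral_abs.trans ?_
    rw [mul_assoc, mul_comm _ (dist t t'), ← mul_assoc, ← integral_const_mul]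
    refine integral_mono ((hint t (abs_le.2 ht)).sub (hint t' (abs_le.2 ht'))).abs
      (hσ.abs.const_mul _) fun y => ?_
    simp only
    rw [← sub_mul, abs_mul]
    refine mul_le_mul_of_nonneg_right ((abs_sweep_sub_le hη hM _ _ y).trans ?_) (abs_nonneg _)
    rw [← sub_mul, abs_mul, abs_of_nonneg (hψ.nonneg y), ← Real.dist_eq]
    exact mul_le_mul_of_nonneg_left (mul_le_of_le_one_right dist_nonneg (hψ.le_one y)) hM'
  have hs1 : |s| ≤ s := (abs_of_nonneg hs0).le
  have hs2 : |-s| ≤ s := by rw [abs_neg]; exact hs1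
  have hb := fun y => hψ.sweep_bounds (i := i) hη hM hm hs0 hsa y
  have hV1 : 0 ≤ V * s := by positivity
  have key : ∀ (ρ : Pt N → ℝ) (r : ℝ), 0 ≤ r → Integrable ρ ν →
      (∀ t, |t| ≤ s → Integrable (fun y => sweep i (fun y => t * ψ y) η y * ρ y) ν) →
      c * V ≤ ∫ y in ball x (5 * a), |ρ y| ∂ν →
      ∫ y in ball x (10 * a), |ρ y - r| ∂ν ≤ δ * V →
      m * c / 2 * V * s ≤ ∫ y, sweep i (fun y => s * ψ y) η y * ρ y ∂ν ∧
      ∫ y, sweep i (fun y => -s * ψ y) η y * ρ y ∂ν ≤ -(m * c / 2 * V * s) := by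
    intro ρ r hr hρ hρi hρ5 hρ10
    have hlow : m * c / 2 * V * s ≤ m * s * (∫ y in ball x (5 * a), |ρ y| ∂ν) -
        2 * (M * s) * ∫ y in ball x (10 * a), |ρ y - r| ∂ν := by
      have i1 := mul_le_mul_of_nonneg_left hρ5 (mul_nonneg hm0 hs0)
      have i2 := mul_le_mul_of_nonneg_left hρ10 (by positivity : 0 ≤ 2 * (M * s))
      have i3 := mul_le_mul_of_nonneg_right hδ hV1
      nlinarith
    constructor
    · refine hlow.trans (le_integral_mul_of_nonneg hρ (hρi s hs1) measurableSet_ball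
        measurableSet_ball (measure_ne_top _ _) hr (fun y => ?_) (fun y hy => ?_) (fun y => ?_)
        fun y hy => ?_)
      · exact (by have := hψ.nonneg y; positivity : 0 ≤ m * (s * ψ y)).trans (hb y).1
      · simpa [hψ.eq_one y hy] using (hb y).1
      · exact (le_abs_self _).trans ((hle s y).trans_eq (by rw [abs_of_nonneg hs0]))
      · simp [sweep, hψ.eq_zero y hy]
    · rw [le_neg, ← integral_neg]
      simp only [← neg_mul (sweep _ _ _ _)]
      refine hlow.trans (le_integral_mul_of_nonneg hρ ?_ measurableSet_ball
        measurableSet_ball (measure_ne_top _ _) hr (fun y => ?_) (fun y hy => ?_) (fun y => ?_)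
        fun y hy => ?_)
      · simpa only [neg_mul, Pi.neg_def] using (hρi (-s) hs2).neg
      · exact (by have := hψ.nonneg y; positivity : 0 ≤ m * (s * ψ y)).trans (le_neg.1 (hb y).2)
      · simpa [hψ.eq_one y hy] using le_neg.1 (hb y).2
      · refine (neg_le_abs _).trans ((hle (-s) y).trans_eq (by rw [abs_neg, abs_of_nonneg hs0]))
      · simp [sweep, hψ.eq_zero y hy]
  have hIcc : -s ≤ s := by linarith
  obtain ⟨t, ht, hte⟩ : e ∈ W '' Icc (-s) s := by
    rcases le_total 0 ς with hς | hς
    · obtain ⟨k1, k2⟩ := key σ ς hς hσ hint h5 h10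
      exact intermediate_value_Icc hIcc hcont
        ⟨k2.trans (abs_le.1 he).1, (abs_le.1 he).2.trans k1⟩
    · obtain ⟨k1, k2⟩ := key (fun y => -σ y) (-ς) (neg_nonneg.2 hς) hσ.neg
        (fun t ht => by simpa only [mul_neg, Pi.neg_def] using (hint t ht).neg) (by simpa only [abs_neg] using h5)
        (by
          refine le_trans (le_of_eq ?_) h10
          congr 1 with y
          rw [← abs_neg]
          congr 1
          ring)
      simp only [mul_neg, integral_neg] at k1 k2
      exact intermediate_value_Icc' hIcc hcont
        ⟨by rw [hW]; linarith [(abs_le.1 he).1], by rw [hW]; linarith [(abs_le.1 he).2]⟩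
  exact ⟨t, abs_le.2 ht, hte⟩

end

lemma densTendsto_congr {E F : Set (Pt N)} {y : Pt N} {r : ℝ} (hr : 0 < r)
    (h : E ∩ ball y r = F ∩ ball y r) (l : ENNReal) : densTendsto E y l ↔ densTendsto F y l := by
  refine tendsto_congr' ?_
  filter_upwards [Ioo_mem_nhdsGT hr] with ρ hρ
  have hsub : ball y ρ ⊆ ball y r := ball_subset_ball hρ.2.le
  have : E ∩ ball y ρ = F ∩ ball y ρ := by
    rw [← inter_eq_right.2 hsub, ← inter_assoc, ← inter_assoc, h]
  rw [this]

/-- The essential boundary is determined locally. -/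
lemma essBdry_sdiff_subset {E F : Set (Pt N)} {x : Pt N} {r : ℝ}
    (h : symmDiff E F ⊆ ball x r) : essBdry E \ closedBall x r ⊆ essBdry F := by
  rintro y ⟨hy, hyx⟩
  obtain ⟨ρ, hρ, hb⟩ := Metric.isOpen_iff.1 isClosed_closedBall.isOpen_compl y hyx
  have e : E ∩ ball y ρ = F ∩ ball y ρ := by
    ext z
    refine and_congr_left fun hz => ?_
    have hz' : z ∉ symmDiff E F := fun hzs => hb hz (ball_subset_closedBall (h hzs))
    rw [mem_symmDiff] at hz'
    tauto
  exact ⟨fun hF => hy.1 ((densTendsto_congr hρ e 0).2 hF),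
    fun hF => hy.2 ((densTendsto_congr hρ e 1).2 hF)⟩

/-- A perimeter estimate with extended values gives one for `wPer`. -/
lemma wPer_le_add {g : Pt N → ℝ} {E F : Set (Pt N)} {x : Pt N} {r M X : ℝ}
    (hA : μH[(N : ℝ) - 1] (essBdry E) < ⊤) (h : symmDiff E F ⊆ ball x r)
    (hg : ∀ y ∈ closedBall x r, g y ≤ M) (hX : 0 ≤ X)
    (hle : ∫⁻ y in essBdry F, ENNReal.ofReal (g y) ∂(μH[(N : ℝ) - 1]) ≤
      (∫⁻ y in essBdry E, ENNReal.ofReal (g y) ∂(μH[(N : ℝ) - 1])) + ENNReal.ofReal X) :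
    wPer g F ≤ wPer g E + X := by
  rw [wPer, wPer]
  by_cases hfin : ∫⁻ y in essBdry E, ENNReal.ofReal (g y) ∂(μH[(N : ℝ) - 1]) = ⊤
  · have h1 : ∫⁻ y in essBdry E ∩ closedBall x r, ENNReal.ofReal (g y) ∂(μH[(N : ℝ) - 1]) < ⊤ := by
      refine (setLIntegral_mono measurable_const fun y hy =>
        ENNReal.ofReal_le_ofReal (hg y hy.2)).trans_lt ?_
      rw [setLIntegral_const]
      exact (ENNReal.mul_lt_top ENNReal.ofReal_lt_top ((measure_mono inter_subset_left).trans_lt hA))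
    have h2 : ∫⁻ y in essBdry F, ENNReal.ofReal (g y) ∂(μH[(N : ℝ) - 1]) = ⊤ := by
      rw [← lintegral_inter_add_sdiff _ _ (isClosed_closedBall (x := x) (ε := r)).measurableSet,
        ENNReal.add_eq_top] at hfin
      exact top_unique ((hfin.resolve_left h1.ne).ge.trans (lintegral_mono_set (essBdry_sdiff_subset h)))
    rw [h2, hfin]
    simpa using hX
  · have := ENNReal.toReal_mono (ENNReal.add_ne_top.2 ⟨hfin, ENNReal.ofReal_ne_top⟩) hle
    rwa [ENNReal.toReal_add hfin ENNReal.ofReal_ne_top, ENNReal.toReal_ofReal hX] at this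

lemma exists_hausdorffMeasure_eq (N : ℕ) :
    ∃ k : ENNReal, k ≠ 0 ∧ k ≠ ⊤ ∧ (μH[(N : ℝ)] : Measure (Pt N)) = k • volume := by
  have h : Measure.IsAddHaarMeasure (μH[(N : ℝ)] : Measure (Pt N)) := by
    simpa using isAddHaarMeasure_hausdorffMeasure (E := Pt N)
  exact ⟨Measure.addHaarScalarFactor (μH[(N : ℝ)] : Measure (Pt N)) volume,
    by simpa using (Measure.addHaarScalarFactor_pos_of_isAddHaarMeasure (μH[(N : ℝ)] : Measure (Pt N)) volume).ne', ENNReal.coe_ne_top,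
    Measure.isAddLeftInvariant_eq_smul _ _⟩

/-- Change of the weighted volume under a local modification. -/
lemma wVol_sub_eq {k : ENNReal} (hk : (μH[(N : ℝ)] : Measure (Pt N)) = k • volume)
    (hk' : k ≠ ⊤) {f : Pt N → ℝ}
    (hf0 : ∀ x, 0 < f x) {E F B : Set (Pt N)} (hB : MeasurableSet B)
    (hfB : Integrable (B.indicator f)) (hE : MeasurableSet E) (hF : MeasurableSet F)
    (hsub : symmDiff E F ⊆ B) (hfin : wVolE f E < ⊤) :
    wVol f F = wVol f E + k.toReal * ((∫ x in F, B.indicator f x) - ∫ x in E, B.indicator f x) := by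
  have key : ∀ S : Set (Pt N), MeasurableSet S → wVolE f S =
      k * ENNReal.ofReal (∫ x in S, B.indicator f x) + wVolE f (S \ B) := by
    intro S hS
    rw [wVolE, ← lintegral_inter_add_sdiff _ S hB, ← wVolE]
    congr 1
    rw [wVolE, hk, Measure.restrict_smul, lintegral_smul_measure, smul_eq_mul, setIntegral_indicator hB,
      ofReal_integral_eq_lintegral_ofReal]
    · exact ((integrable_indicator_iff hB).1 hfB).mono_set inter_subset_right
    · exact Eventually.of_forall fun x => (hf0 x).le
  have hd : F \ B = E \ B := by
    ext z
    refine and_congr_left fun hz => ?_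
    have hz' : z ∉ symmDiff E F := fun hzs => hz (hsub hzs)
    rw [mem_symmDiff] at hz'
    tauto
  have h1 : wVolE f (E \ B) ≠ ⊤ := ((lintegral_mono_set sdiff_subset).trans_lt hfin).ne
  have h0 : ∀ S : Set (Pt N), 0 ≤ ∫ x in S, B.indicator f x := fun S =>
    integral_nonneg fun x => indicator_nonneg (fun x _ => (hf0 x).le) x
  rw [wVol, wVol, key E hE, key F hF, hd,
    ENNReal.toReal_add (ENNReal.mul_ne_top hk' ENNReal.ofReal_ne_top) h1,
    ENNReal.toReal_add (ENNReal.mul_ne_top hk' ENNReal.ofReal_ne_top) h1,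
    ENNReal.toReal_mul, ENNReal.toReal_mul, ENNReal.toReal_ofReal (h0 _), ENNReal.toReal_ofReal (h0 _)]
  ring

/-- Perimeter estimate for the image under a shear map supported in a ball. -/
lemma IsCutoff.wPer_image_le {L a : ℝ} {x : Pt (n + 1)} {ψ : Pt (n + 1) → ℝ} (hψ : IsCutoff L x a ψ)
    (ha : 0 < a) (hL : 0 < L) {E : Set (Pt (n + 1))} (hE : MeasurableSet E)
    (hA : μH[(n : ℝ)] (essBdry E) < ⊤) {g : Pt (n + 1) → ℝ} (hgm : Measurable g) {α H M K s t : ℝ}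
    (hα : 0 ≤ α) (hH : 0 ≤ H) (hM : 0 ≤ M) (hgM : ∀ y ∈ closedBall x (10 * a), g y ≤ M)
    (hgH : ∀ y ∈ ball x (10 * a), ∀ z ∈ ball x (10 * a), |g y - g z| ≤ H * dist y z ^ α)
    (hK : μH[(n : ℝ)] (essBdry E ∩ ball x (10 * a)) ≤ ENNReal.ofReal (K * a ^ n)) (hK0 : 0 ≤ K)
    (hts : |t| ≤ s) (hs : s * (L / a) ≤ 1 / 2) (i : Fin (n + 1)) :
    wPer g (shear i (fun y => t * ψ y) '' E) ≤ wPer g E +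
      (H * s ^ α + 2 ^ n * (s * (L / a)) * (M + H * s ^ α)) * (K * a ^ n) := by
  have hs0 : 0 ≤ s := (abs_nonneg t).trans hts
  have hLa : 0 ≤ L / a := by positivity
  have hts' : |t| * (L / a) ≤ s * (L / a) := mul_le_mul_of_nonneg_right hts hLa
  have h := hψ.isShear hLa (hts'.trans hs)
  have hu : ∀ y ∉ ball x (10 * a), t * ψ y = 0 := fun y hy => by rw [hψ.eq_zero y hy, mul_zero]
  have hdim : ((n + 1 : ℕ) : ℝ) - 1 = n := by push_cast; ring
  have hsα : 0 ≤ s ^ α := Real.rpow_nonneg hs0 α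
  refine wPer_le_add (by rwa [hdim]) (h.symmDiff_image_subset i hu E) hgM (by positivity) ?_
  rw [hdim]
  have key := h.lintegral_essBdry_le i (d := n) (by positivity) hu hE (G := fun y => ENNReal.ofReal (g y))
    (by fun_prop) (c := ENNReal.ofReal (H * s ^ α)) (c' := ENNReal.ofReal M) ?_
    (fun y hy => ENNReal.ofReal_le_ofReal (hgM y (ball_subset_closedBall hy)))
    (b := ENNReal.ofReal (2 ^ n * (s * (L / a)))) ?_
  · refine key.trans (add_le_add_right ?_ _)
    refine (mul_le_mul_right hK _).trans (le_of_eq ?_)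
    rw [← ENNReal.ofReal_add (by positivity) (by positivity), ← ENNReal.ofReal_mul (by positivity),
      ← ENNReal.ofReal_add (by positivity) (by positivity), ← ENNReal.ofReal_mul (by positivity)]
  · intro y hy
    refine (ENNReal.ofReal_le_ofReal ?_).trans ENNReal.ofReal_add_le
    have h1 := hgH _ (h.image_ball i hu y hy) y hy
    have h2 : dist (shear i (fun y => t * ψ y) y) y ≤ s := by
      rw [shear, dist_self_add_left, norm_smul, norm_axis, mul_one, Real.norm_eq_abs, abs_mul,
        abs_of_nonneg (hψ.nonneg y)]
      exact (mul_le_of_le_one_right (abs_nonneg t) (hψ.le_one y)).trans hts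
    have h3 : H * dist (shear i (fun y => t * ψ y) y) y ^ α ≤ H * s ^ α :=
      mul_le_mul_of_nonneg_left (Real.rpow_le_rpow dist_nonneg h2 hα) hH
    have := le_abs_self (g (shear i (fun y => t * ψ y) y) - g y)
    linarith
  · rw [ENNReal.rpow_natCast, ← ENNReal.coe_pow, ← ENNReal.ofReal_one, ← ENNReal.ofReal_add (by positivity) (by positivity),
      ← ENNReal.ofReal_coe_nnreal]
    refine ENNReal.ofReal_le_ofReal ?_
    push_cast
    rw [Real.coe_toNNReal _ (by positivity)]
    refine (one_add_pow_le (by positivity) (by linarith) n).trans ?_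
    gcongr

/-- Quantitative bounds for a pair of densities on a bounded set `B`. -/
structure IsControlled (f g : Pt n → ℝ) (α : ℝ) (B : Set (Pt n)) (m M H : ℝ) : Prop where
  measurableSet : MeasurableSet B
  norm_le : ∀ y ∈ B, ‖y‖ ≤ M
  lower_pos : 0 < m
  lower : ∀ y ∈ B, m ≤ f y
  upper_fst : ∀ y ∈ B, f y ≤ M
  upper_snd : ∀ y ∈ B, g y ≤ M
  upper_pos : 0 < M
  holder_nonneg : 0 ≤ H
  holder : ∀ y ∈ B, ∀ z ∈ B, |g y - g z| ≤ H * dist y z ^ α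

lemma exists_isControlled {f g : Pt n → ℝ} (h : IsDensityPair f g) {α : ℝ}
    (hg : LocallyHolder α g) {R : ℝ} (hR : 0 ≤ R) :
    ∃ m M H, IsControlled f g α (closedBall 0 R) m M H := by
  have hK := isCompact_closedBall (0 : Pt n) R
  obtain ⟨y₀, hy₀, hmin⟩ :=
    (h.1.lowerSemicontinuousOn (closedBall (0 : Pt n) R)).exists_isMinOn ⟨0, by simpa⟩ hK
  obtain ⟨C, hC⟩ := h.2.2.2.2 _ hK
  obtain ⟨D, hD⟩ := hg _ hK
  refine ⟨f y₀, max C (R + 1), |D|, isClosed_closedBall.measurableSet, fun y hy => ?_, h.2.2.1 y₀,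
    fun y hy => hmin hy, fun y hy => (hC y hy).1.trans (le_max_left _ _),
    fun y hy => (hC y hy).2.trans (le_max_left _ _), lt_of_lt_of_le (by linarith) (le_max_right _ _),
    abs_nonneg D, fun y hy z hz => (hD y hy z hz).trans ?_⟩
  · rw [mem_closedBall_zero_iff] at hy
    exact hy.trans ((le_add_of_nonneg_right zero_le_one).trans (le_max_right _ _))
  · exact mul_le_mul_of_nonneg_right (le_abs_self D) (Real.rpow_nonneg dist_nonneg _)

/-- Near a good point the weighted volume can be prescribed by a shear, with a controlled cost in
weighted perimeter. -/
lemma IsCutoff.exists_deformation {L a : ℝ} {x : Pt (n + 1)} {ψ : Pt (n + 1) → ℝ}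
    (hψ : IsCutoff L x a ψ) (ha : 0 < a) (hL : 0 < L) {E : Set (Pt (n + 1))} (hE : MeasurableSet E)
    (hA : μH[(n : ℝ)] (essBdry E) < ⊤) {f g : Pt (n + 1) → ℝ} (hfg : IsDensityPair f g)
    (hvol : wVolE f E < ⊤) {α : ℝ} (hα : 0 ≤ α) {B : Set (Pt (n + 1))} {m M H : ℝ}
    (hB : IsControlled f g α B m M H) (hxB : ball x (11 * a) ⊆ B) {k : ENNReal}
    (hk : (μH[((n + 1 : ℕ) : ℝ)] : Measure (Pt (n + 1))) = k • volume) (hk0 : k ≠ 0) (hk' : k ≠ ⊤)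
    {i : Fin (n + 1)} {σ : Pt (n + 1) → ℝ} (hσ : IsDensity (μH[(n : ℝ)].restrict (essBdry E)) E i σ)
    {c δ K ς : ℝ} (hK0 : 0 ≤ K)
    (h5 : c * a ^ n ≤ ∫ y in ball x (5 * a), |σ y| ∂μH[(n : ℝ)].restrict (essBdry E))
    (h10 : ∫ y in ball x (10 * a), |σ y - ς| ∂μH[(n : ℝ)].restrict (essBdry E) ≤ δ * a ^ n)
    (hK : (μH[(n : ℝ)].restrict (essBdry E)).real (ball x (10 * a)) ≤ K * a ^ n)
    (hδ : 4 * M * δ ≤ m * c) {s : ℝ} (hs0 : 0 ≤ s) (hsa : s ≤ a) (hs : s * (L / a) ≤ 1 / 2) {ε : ℝ}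
    (hε : |ε| ≤ k.toReal * (m * c / 2 * a ^ n * s)) :
    ∃ F, MeasurableSet F ∧ symmDiff E F ⊆ ball x (10 * a) ∧ wVol f F = wVol f E + ε ∧
      wPer g F ≤ wPer g E + (H * s ^ α + 2 ^ n * (s * (L / a)) * (M + H * s ^ α)) * (K * a ^ n) := by
  have : IsFiniteMeasure (μH[(n : ℝ)].restrict (essBdry E)) := isFiniteMeasure_restrict.2 hA.ne
  have hLa : 0 ≤ L / a := by positivity
  have hk1 : 0 < k.toReal := ENNReal.toReal_pos hk0 hk'
  have hη : Measurable (B.indicator f) := hfg.1.measurable.indicator hB.measurableSet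
  have hM : ∀ y, |B.indicator f y| ≤ M := fun y => by
    by_cases hy : y ∈ B
    · rw [indicator_of_mem hy, abs_of_pos (hfg.2.2.1 y)]
      exact hB.upper_fst y hy
    · simpa [indicator_of_notMem hy] using hB.upper_pos.le
  have hM0 : ∀ y, M < ‖y‖ → B.indicator f y = 0 := fun y hy =>
    indicator_of_notMem (fun h => hy.not_ge (hB.norm_le y h)) f
  have hm : ∀ y ∈ ball x (11 * a), m ≤ B.indicator f y := fun y hy => by
    rw [indicator_of_mem (hxB hy)]
    exact hB.lower y (hxB hy)
  have hsub : ball x (10 * a) ⊆ ball x (11 * a) := ball_subset_ball (by linarith)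
  obtain ⟨t, hts, ht⟩ := hψ.exists_integral_sweep_eq (i := i) hσ.integrable ha hL hη hM hM0
    hB.lower_pos.le hm h5 h10 hδ (by positivity) hs0 hsa hs (e := ε / k.toReal) (by
      rw [abs_div, abs_of_pos hk1, div_le_iff₀ hk1]
      linarith)
  have h := hψ.isShear hLa ((mul_le_mul_of_nonneg_right hts hLa).trans hs)
  have hu : ∀ y ∉ ball x (10 * a), t * ψ y = 0 := fun y hy => by rw [hψ.eq_zero y hy, mul_zero]
  have hF := h.measurableSet_image i hE
  have hsym := h.symmDiff_image_subset i hu E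
  refine ⟨_, hF, hsym, ?_, ?_⟩
  · rw [wVol_sub_eq hk hk' hfg.2.2.1 hB.measurableSet (integrable_of_bounded hη hM hM0) hE hF
      (hsym.trans (hsub.trans hxB)) hvol, ← h.setIntegral_sweepDeriv i hη hM hM0 hE,
      hσ.eq_integral _ _ (h.isTestPair i hη hM hM0), ht]
    field_simp
  · refine hψ.wPer_image_le ha hL hE hA hfg.2.1.measurable hα hB.holder_nonneg hB.upper_pos.le
      (fun y hy => hB.upper_snd y (hxB (closedBall_subset_ball (by linarith) hy)))
      (fun y hy z hz => hB.holder y (hxB (hsub hy)) z (hxB (hsub hz))) ?_ hK0 hts hs i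
    rw [measureReal_restrict_apply measurableSet_ball, inter_comm] at hK
    exact (ENNReal.le_ofReal_iff_toReal_le (measure_ne_top_of_subset inter_subset_left hA.ne)
      (by positivity)).2 hK

/-- Optimal choice of the radius `a` and of the displacement `s` for a prescribed change of
volume. -/
lemma exists_scales (n : ℕ) {α : ℝ} (hα0 : 0 ≤ α) (hα1 : α ≤ 1) {L b H M K a₁ : ℝ} (hL : 0 < L)
    (hb : 0 < b) (hH : 0 ≤ H) (hM : 0 ≤ M) (hK : 0 ≤ K) (ha₁ : 0 < a₁) :
    ∃ εbar > 0, ∃ C > 0, ∀ ε : ℝ, 0 < ε → ε < εbar → ∃ a s : ℝ, 0 < a ∧ a < a₁ ∧ 0 ≤ s ∧ s ≤ a ∧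
      s * (L / a) ≤ 1 / 2 ∧ ε ≤ b * (a ^ n * s) ∧
      (H * s ^ α + 2 ^ n * (s * (L / a)) * (M + H * s ^ α)) * (K * a ^ n) ≤
        C * ε ^ ((α + n * (1 - α)) / (1 + n * (1 - α))) := by
  set D : ℝ := 1 + n * (1 - α) with hD
  have hα1' : 0 ≤ 1 - α := sub_nonneg.2 hα1
  have hD0 : 0 < D := by positivity
  set κ : ℝ := min (a₁ / 2) 1 with hκ
  have hκ0 : 0 < κ := lt_min (by positivity) one_pos
  have hκ1 : κ ≤ 1 := min_le_right _ _
  have hκa : κ < a₁ := (min_le_left _ _).trans_lt (by linarith)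
  set c : ℝ := min 1 (1 / (2 * L)) with hc
  have hc0 : 0 < c := lt_min one_pos (by positivity)
  have hc1 : c ≤ 1 := min_le_left _ _
  have hcL : c * L ≤ 1 / 2 := by
    have h := mul_le_mul_of_nonneg_right (min_le_right 1 (1 / (2 * L))) hL.le
    have h2 : 1 / (2 * L) * L = 1 / 2 := by field_simp
    rwa [h2] at h
  set d : ℝ := b * (κ ^ n * (c * κ)) with hd
  have hd0 : 0 < d := by positivity
  set C : ℝ := (H + 2 ^ n * (M + H)) * K with hC
  have hC0 : 0 ≤ C := by positivity
  set β : ℝ := (α + n * (1 - α)) / D with hβ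
  refine ⟨d, hd0, C / d ^ β + 1, by positivity, fun ε hε hεd => ?_⟩
  set t : ℝ := (ε / d) ^ (1 / D) with ht
  have hr0 : 0 < ε / d := by positivity
  have ht0 : 0 < t := Real.rpow_pos_of_pos hr0 _
  have ht1 : t ≤ 1 := Real.rpow_le_one hr0.le ((div_le_one hd0).2 hεd.le) (by positivity)
  have htp : ∀ p : ℝ, t ^ p = (ε / d) ^ (p / D) := fun p => by
    rw [ht, ← Real.rpow_mul hr0.le]
    congr 1
    ring
  have htα : t ^ (1 - α) * t ^ α = t := by
    rw [← Real.rpow_add ht0]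
    simp
  have hta0 : 0 < t ^ (1 - α) := Real.rpow_pos_of_pos ht0 _
  have htb0 : 0 < t ^ α := Real.rpow_pos_of_pos ht0 _
  have hta1 : t ^ (1 - α) ≤ 1 := Real.rpow_le_one ht0.le ht1 hα1'
  have htb1 : t ^ α ≤ 1 := Real.rpow_le_one ht0.le ht1 hα0
  have hpow : (κ * t ^ (1 - α)) ^ n = κ ^ n * t ^ (n * (1 - α)) := by
    rw [mul_pow, mul_comm (n : ℝ), Real.rpow_mul ht0.le, Real.rpow_natCast]
  have hq0 : 0 < t ^ (n * (1 - α)) := Real.rpow_pos_of_pos ht0 _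
  have hsL : c * κ * t * (L / (κ * t ^ (1 - α))) = c * L * t ^ α := by
    nth_rw 1 [← htα]
    field_simp
  have hst : c * κ * t ≤ t := mul_le_of_le_one_left ht0.le (mul_le_one₀ hc1 hκ0.le hκ1)
  refine ⟨κ * t ^ (1 - α), c * κ * t, by positivity, (mul_le_of_le_one_right hκ0.le hta1).trans_lt hκa,
    by positivity, ?_, ?_, ?_, ?_⟩
  · rw [mul_assoc]
    refine (mul_le_of_le_one_left (by positivity) hc1).trans (mul_le_mul_of_nonneg_left ?_ hκ0.le)
    nth_rw 1 [← htα]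
    exact mul_le_of_le_one_right hta0.le htb1
  · rw [hsL]
    exact (mul_le_of_le_one_right (by positivity) htb1).trans hcL
  · rw [hpow]
    have h1 : t ^ (n * (1 - α)) * t = ε / d := by
      have : t ^ (n * (1 - α)) * t = t ^ D := by
        rw [hD, add_comm, Real.rpow_add ht0, Real.rpow_one]
      rw [this, htp, div_self hD0.ne', Real.rpow_one]
    calc ε = d * (ε / d) := by field_simp
      _ = d * (t ^ (n * (1 - α)) * t) := by rw [h1]
      _ ≤ b * (κ ^ n * t ^ (n * (1 - α)) * (c * κ * t)) := by rw [hd]; apply le_of_eq; ring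
  · have hsα : (c * κ * t) ^ α ≤ t ^ α := Real.rpow_le_rpow (by positivity) hst hα0
    have hs0 : 0 ≤ (c * κ * t) ^ α := by positivity
    have h2 : t ^ α * t ^ (n * (1 - α)) = (ε / d) ^ β := by
      rw [← Real.rpow_add ht0, htp]
    rw [hsL, hpow]
    calc _ ≤ (H * t ^ α + 2 ^ n * (1 * t ^ α) * (M + H * 1)) * (K * (1 * t ^ (n * (1 - α)))) := by
          gcongr
          · linarith
          · exact hsα.trans htb1
          · exact pow_le_one₀ hκ0.le hκ1
      _ = C * (t ^ α * t ^ (n * (1 - α))) := by rw [hC]; ring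
      _ = C / d ^ β * ε ^ β := by rw [h2, Real.div_rpow hε.le hd0.le]; ring
      _ ≤ (C / d ^ β + 1) * ε ^ β := by gcongr; linarith

/-- The `ε`–`ε^β` property, localized near a set met by a family of segments leaving `E`. -/
lemma exists_local_deformation {E : Set (Pt (n + 1))} (hE : MeasurableSet E)
    (hA : μH[(n : ℝ)] (essBdry E) < ⊤) {f g : Pt (n + 1) → ℝ} (hfg : IsDensityPair f g)
    (hvol : wVolE f E < ⊤) {α : ℝ} (hα0 : 0 ≤ α) (hα1 : α ≤ 1) (hg : LocallyHolder α g)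
    {S U : Set (Pt (n + 1))} {d : Pt (n + 1)} (hS : MeasurableSet S) (hS0 : volume S ≠ 0)
    (hSt : volume S ≠ ⊤) (hd : d ≠ 0) (hSE : S ⊆ E) (hSd : ∀ z ∈ S, z + d ∉ E)
    (hU : MeasurableSet U) (hUb : Bornology.IsBounded U)
    (hSU : ∀ z ∈ S, ∀ t ∈ Icc (-1 : ℝ) 2, z + t • d ∈ U) {r : ℝ} (hr : 0 < r) :
    ∃ εbar > 0, ∃ C > 0, ∀ ε : ℝ, |ε| < εbar → ∃ x ∈ U, ∃ F, MeasurableSet F ∧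
      symmDiff E F ⊆ ball x r ∧ wVol f F = wVol f E + ε ∧
      wPer g F ≤ wPer g E + C * |ε| ^ ((α + n * (1 - α)) / (1 + n * (1 - α))) := by
  have : IsFiniteMeasure (μH[(n : ℝ)].restrict (essBdry E)) := isFiniteMeasure_restrict.2 hA.ne
  choose σ hσ using fun i => exists_density hE hA i
  have hσ' : ∀ i, IsDensity (μH[(n : ℝ)].restrict (essBdry E)) E i (σ i) := fun i =>
    ⟨(hσ i).1.integrable one_le_two, (hσ i).2⟩
  obtain ⟨c, hc, K, hK, hgood⟩ := exists_good_points hE hσ' hS hS0 hSt hd hSE hSd hU hSU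
  obtain ⟨R, hR⟩ := hUb.subset_closedBall 0
  obtain ⟨m, M, H, hB⟩ := exists_isControlled hfg hg (R := |R| + 11) (by positivity)
  obtain ⟨L, hL, hcut⟩ := exists_isCutoff (n + 1)
  obtain ⟨k, hk0, hk', hk⟩ := exists_hausdorffMeasure_eq (n + 1)
  have hk1 : 0 < k.toReal := ENNReal.toReal_pos hk0 hk'
  have hm := hB.lower_pos
  have hM := hB.upper_pos
  obtain ⟨a₀, ha₀, hgood⟩ := hgood (m * c / (4 * M)) (by positivity)
  obtain ⟨εbar, hεbar, C, hC, hsc⟩ := exists_scales n hα0 hα1 hL (b := k.toReal * (m * c / 2))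
    (by positivity) hB.holder_nonneg hM.le hK.le (a₁ := min a₀ (min 1 (r / 10))) (by positivity)
  refine ⟨εbar, hεbar, C, hC, fun ε hε => ?_⟩
  obtain rfl | hε0 := eq_or_ne ε 0
  · obtain ⟨z, hz⟩ := nonempty_of_measure_ne_zero hS0
    refine ⟨_, hSU z hz 0 (by norm_num), E, hE, by simp, by simp, ?_⟩
    exact le_add_of_nonneg_right (by positivity)
  obtain ⟨a, s, ha, haa, hs0, hsa, hs, hes, hper⟩ := hsc |ε| (abs_pos.2 hε0) hε
  simp only [lt_min_iff] at haa
  obtain ⟨x, hxU, i, ς, h5, h10, h10'⟩ := hgood a ha haa.1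
  obtain ⟨ψ, hψ⟩ := hcut x a ha
  have hxB : ball x (11 * a) ⊆ closedBall 0 (|R| + 11) := by
    intro y hy
    have h1 := mem_closedBall.1 (hR hxU)
    have h2 := mem_ball.1 hy
    have h3 := dist_triangle y x 0
    have h4 := le_abs_self R
    rw [mem_closedBall]
    linarith [haa.2.1]
  obtain ⟨F, hF, hsym, hFv, hFp⟩ := hψ.exists_deformation ha hL hE hA hfg hvol hα0 hB hxB hk hk0 hk'
    (hσ' i) hK.le h5 h10' h10 (by apply le_of_eq; field_simp) hs0 hsa hs (ε := ε)
    (hes.trans (le_of_eq (by ring)))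
  exact ⟨x, hxU, F, hF, hsym.trans (ball_subset_ball (by linarith [haa.2.2])), hFv,
    hFp.trans (add_le_add_right hper _)⟩

lemma exists_translation_ne_zero {E : Set (Pt n)} (hE : MeasurableSet E) (h : volume E ≠ 0)
    (h' : volume Eᶜ ≠ 0) : ∃ d : Pt n, d ≠ 0 ∧ volume {z | z ∈ E ∧ z + d ∉ E} ≠ 0 := by
  obtain ⟨x, -, hx⟩ := exists_mem_forall_mem_nhdsWithin_pos_measure h
  obtain ⟨y, -, hy⟩ := exists_mem_forall_mem_nhdsWithin_pos_measure h'
  set a : ℝ := ‖x‖ + ‖y‖ + 1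
  have hxa : ball (0 : Pt n) a ∈ nhds x :=
    isOpen_ball.mem_nhds (mem_ball_zero_iff.2 (by linarith [norm_nonneg y]))
  have hya : ball (0 : Pt n) a ∈ nhds y :=
    isOpen_ball.mem_nhds (mem_ball_zero_iff.2 (by linarith [norm_nonneg x]))
  obtain ⟨d, -, hd⟩ := exists_translation (m := 0) (hE.inter measurableSet_ball)
    (hE.compl.inter measurableSet_ball) inter_subset_right inter_subset_right (x := 0) (a := a) (by
      rw [zero_mul]
      exact ENNReal.mul_pos (hx _ (inter_mem_nhdsWithin _ hxa)).ne'
        (hy _ (inter_mem_nhdsWithin _ hya)).ne')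
  have hle := hd.trans_le (measure_mono (t := {z | z ∈ E ∧ z + d ∉ E}) fun z hz => ⟨hz.1.1, hz.2.1⟩)
  refine ⟨d, ?_, hle.ne'⟩
  rintro rfl
  obtain ⟨z, hz, hz'⟩ := nonempty_of_measure_ne_zero hd.ne'
  exact hz'.1 (by simpa using hz.1)

/-- Two points of a nonnull set, each charged by the set in all of its neighbourhoods, with
distinct projections along `d`. -/
lemma exists_pair_of_measure_ne_zero (hn : 2 ≤ n) {S : Set (Pt n)} (hS : volume S ≠ 0) (d : Pt n) :
    ∃ p q : Pt n, (∀ ρ > 0, volume (S ∩ ball p ρ) ≠ 0) ∧ (∀ ρ > 0, volume (S ∩ ball q ρ) ≠ 0) ∧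
      ∃ D > 0, ∀ t : ℝ, D ≤ dist q (p + t • d) := by
  obtain ⟨p, -, hp⟩ := exists_mem_forall_mem_nhdsWithin_pos_measure hS
  set l : AffineSubspace ℝ (Pt n) := AffineSubspace.mk' p (ℝ ∙ d) with hl
  have hmem : ∀ t : ℝ, p + t • d ∈ l := fun t => by
    rw [hl, AffineSubspace.mem_mk', vsub_eq_sub, add_sub_cancel_left]
    exact Submodule.smul_mem _ _ (Submodule.mem_span_singleton_self d)
  have hl0 : volume (l : Set (Pt n)) = 0 := by
    refine Measure.addHaar_affineSubspace _ l fun h => ?_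
    have h1 : (ℝ ∙ d) = ⊤ := by rw [← AffineSubspace.direction_mk' p (ℝ ∙ d), ← hl, h, AffineSubspace.direction_top]
    have h2 := finrank_span_le_card (R := ℝ) {d}
    rw [h1, finrank_top, finrank_euclideanSpace_fin, toFinset_singleton, Finset.card_singleton] at h2
    omega
  obtain ⟨q, hq, hq'⟩ := exists_mem_forall_mem_nhdsWithin_pos_measure
    (show volume (S \ l) ≠ 0 by rwa [measure_sdiff_null hl0])
  have hcl : IsClosed (l : Set (Pt n)) := AffineSubspace.closed_of_finiteDimensional l
  refine ⟨p, q, fun ρ hρ => (hp _ (inter_mem_nhdsWithin _ (ball_mem_nhds p hρ))).ne',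
    fun ρ hρ => ((hq' _ (inter_mem_nhdsWithin _ (ball_mem_nhds q hρ))).trans_le
      (measure_mono (inter_subset_inter_left _ sdiff_subset))).ne',
    infDist q l, (hcl.notMem_iff_infDist_pos ⟨_, hmem 0⟩).1 hq.2, fun t => infDist_le_dist_of_mem (hmem t)⟩

/-- The `ε`–`ε^β` property, localized in a tube. -/
lemma exists_tube_deformation {E : Set (Pt (n + 1))} (hE : MeasurableSet E)
    (hA : μH[(n : ℝ)] (essBdry E) < ⊤) {f g : Pt (n + 1) → ℝ} (hfg : IsDensityPair f g)
    (hvol : wVolE f E < ⊤) {α : ℝ} (hα0 : 0 ≤ α) (hα1 : α ≤ 1) (hg : LocallyHolder α g)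
    {d : Pt (n + 1)} (hd : d ≠ 0) {p : Pt (n + 1)} {ρ : ℝ}
    (hp : volume ({z | z ∈ E ∧ z + d ∉ E} ∩ ball p ρ) ≠ 0) {r : ℝ} (hr : 0 < r) :
    ∃ εbar > 0, ∃ C > 0, ∀ ε : ℝ, |ε| < εbar → ∃ x, (∃ t : ℝ, dist x (p + t • d) < ρ) ∧
      ∃ F, MeasurableSet F ∧ symmDiff E F ⊆ ball x r ∧ wVol f F = wVol f E + ε ∧
      wPer g F ≤ wPer g E + C * |ε| ^ ((α + n * (1 - α)) / (1 + n * (1 - α))) := by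
  have hT : IsCompact ((fun t : ℝ => p + t • d) '' Icc (-1) 2) :=
    isCompact_Icc.image (by fun_prop)
  have hS : MeasurableSet {z | z ∈ E ∧ z + d ∉ E} :=
    hE.inter (measurable_add_const d hE.compl)
  obtain ⟨εbar, hεbar, C, hC, h⟩ := exists_local_deformation hE hA hfg hvol hα0 hα1 hg
    (U := thickening ρ ((fun t : ℝ => p + t • d) '' Icc (-1) 2)) (hS.inter measurableSet_ball) hp
    (measure_ne_top_of_subset inter_subset_right measure_ball_lt_top.ne) hd (fun z hz => hz.1.1)
    (fun z hz => hz.1.2) isOpen_thickening.measurableSet hT.isBounded.thickening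
    (fun z hz t ht => mem_thickening_iff.2 ⟨_, mem_image_of_mem _ ht, by
      simpa [dist_add_right] using hz.2⟩) hr
  refine ⟨εbar, hεbar, C, hC, fun ε hε => ?_⟩
  obtain ⟨x, hx, hF⟩ := h ε hε
  obtain ⟨_, ⟨t, -, rfl⟩, ht⟩ := mem_thickening_iff.1 hx
  exact ⟨x, ⟨t, ht⟩, hF⟩

lemma disjoint_ball_or_disjoint_ball {X : Type*} [PseudoMetricSpace X] {x y : X} {r : ℝ}
    (h : 4 * r ≤ dist x y) (w : X) : Disjoint (ball x r) (ball w r) ∨ Disjoint (ball y r) (ball w r) := by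
  by_contra! hcon
  obtain ⟨u, hu, hu'⟩ := not_disjoint_iff.1 hcon.1
  obtain ⟨v, hv, hv'⟩ := not_disjoint_iff.1 hcon.2
  rw [mem_ball] at hu hu' hv hv'
  have h1 := dist_triangle4_left x w u w
  have h2 := dist_triangle x u w
  have h3 := dist_triangle y v w
  have h4 := dist_triangle_right x y w
  rw [dist_comm] at hu hv
  linarith

end EpsBeta

open EpsBeta in
/-- the `ε`–`ε^β` property for a single set (case `m = 1`),
with at most two balls. -/
theorem epsEpsBeta_property_single_set (N : ℕ) (hN : 2 ≤ N)
    (α : ℝ) (hα0 : 0 ≤ α) (hα1 : α ≤ 1)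
    (f g : Pt N → ℝ) (hfg : IsDensityPair f g) (hg : LocallyHolder α g)
    (E : Set (Pt N)) (hE : MeasurableSet E)
    (hpos : 0 < volume E) (hpos' : 0 < volume Eᶜ)
    (hvol : wVolE f E < ⊤) (hper : μH[(N : ℝ) - 1] (essBdry E) < ⊤) :
    ∃ rbar εbar Cper : ℝ, 0 < rbar ∧ 0 < εbar ∧ 0 < Cper ∧
      ∀ ε : ℝ, |ε| < εbar → ∀ w : Pt N,
        ∃ F : Set (Pt N), MeasurableSet F ∧
          (∃ (c : Fin 2 → Pt N) (ρ : Fin 2 → ℝ),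
            (∀ k, ρ k ≤ rbar) ∧
            (∀ k, Disjoint (ball (c k) (ρ k)) (ball w rbar)) ∧
            symmDiff E F ⊆ ⋃ k, ball (c k) (ρ k)) ∧
          wVol f F = wVol f E + ε ∧
          wPer g F ≤ wPer g E +
            Cper * |ε| ^ ((α + ((N : ℝ) - 1) * (1 - α)) / (α + (N : ℝ) * (1 - α))) := by
  obtain ⟨n, rfl⟩ : ∃ n, N = n + 1 := ⟨N - 1, by omega⟩
  have hdim : ((n + 1 : ℕ) : ℝ) - 1 = n := by push_cast; ring
  have hβ : α + ((n + 1 : ℕ) : ℝ) * (1 - α) = 1 + n * (1 - α) := by push_cast; ring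
  rw [hdim] at hper
  rw [hdim, hβ]
  obtain ⟨d, hd, hS⟩ := exists_translation_ne_zero hE hpos.ne' hpos'.ne'
  obtain ⟨p, q, hp, hq, D, hD, hpq⟩ := exists_pair_of_measure_ne_zero hN hS d
  obtain ⟨ε₁, hε₁, C₁, hC₁, h₁⟩ := exists_tube_deformation hE hper hfg hvol hα0 hα1 hg hd
    (hp (D / 4) (by positivity)) (r := D / 8) (by positivity)
  obtain ⟨ε₂, hε₂, C₂, hC₂, h₂⟩ := exists_tube_deformation hE hper hfg hvol hα0 hα1 hg hd
    (hq (D / 4) (by positivity)) (r := D / 8) (by positivity)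
  refine ⟨D / 8, min ε₁ ε₂, max C₁ C₂, by positivity, lt_min hε₁ hε₂, lt_max_of_lt_left hC₁,
    fun ε hε w => ?_⟩
  obtain ⟨x, ⟨t, hxt⟩, F, hF, hFx, hFv, hFp⟩ := h₁ ε (hε.trans_le (min_le_left _ _))
  obtain ⟨y, ⟨τ, hyτ⟩, G, hG, hGy, hGv, hGp⟩ := h₂ ε (hε.trans_le (min_le_right _ _))
  have hxy : 4 * (D / 8) ≤ dist x y := by
    have h3 := hpq (t - τ)
    have h4 : dist q (p + (t - τ) • d) = dist (q + τ • d) (p + t • d) := by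
      rw [← dist_add_right q _ (τ • d), add_assoc, ← add_smul, sub_add_cancel]
    have h5 := dist_triangle4 (q + τ • d) y x (p + t • d)
    rw [dist_comm (q + τ • d) y, dist_comm y x] at h5
    linarith
  have hD8 : 0 ≤ D / 8 := by positivity
  have hball : ∀ {z : Pt (n + 1)} {T}, symmDiff E T ⊆ ball z (D / 8) →
      Disjoint (ball z (D / 8)) (ball w (D / 8)) → ∃ (c : Fin 2 → Pt (n + 1)) (ρ : Fin 2 → ℝ),
        (∀ k, ρ k ≤ D / 8) ∧ (∀ k, Disjoint (ball (c k) (ρ k)) (ball w (D / 8))) ∧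
        symmDiff E T ⊆ ⋃ k, ball (c k) (ρ k) := fun {z T} hT hz => by
    refine ⟨![z, z], ![D / 8, 0], ?_, ?_, hT.trans (subset_iUnion_of_subset 0 subset_rfl)⟩ <;>
      simp [Fin.forall_fin_two, hz, hD8]
  obtain h | h := disjoint_ball_or_disjoint_ball hxy w
  · exact ⟨F, hF, hball hFx h, hFv, hFp.trans (by gcongr; exact le_max_left _ _)⟩
  · exact ⟨G, hG, hball hGy h, hGv, hGp.trans (by gcongr; exact le_max_right _ _)⟩
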